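/- Let k be an algebraically closed field, Q a strongly locally finite quiver, and M an indecomposable representation in rep(Q) that is neither finitely presented nor finitely co-presented. Then: (i) if L₁ and L₂ are indecomposable representations in rep(Q) admitting irreducible morphisms L₁ → M and L₂ → M, then L₁ ≅ L₂; and (ii) for any indecomposable representation L there is no irreducible morphism L ⊕ L → M. -/

import Mathlib

open CategoryTheory CategoryTheory.Limits

namespace Paper

variable (k : Type) [Field k]

section General

variable (A : Type) [Category.{0} A] [Preadditive A] [CategoryTheory.Linear k A]

/-- A spectroid over `k`: a (small) Hom-finite `k`-linear category in which every object
has a local endomorphism ring and distinct objects are not isomorphic. -/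
class Spectroid : Prop where
  homFinite : ∀ a b : A, FiniteDimensional k (a ⟶ b)
  localEnd : ∀ a : A, IsLocalRing (End a)
  skeletal : ∀ a b : A, (a ≅ b) → a = b

variable {A}

/-- `M` is a module over `A`, i.e. the functor `M : A ⥤ ModuleCat k` is additive and
`k`-linear on morphisms. -/
def IsMod (M : A ⥤ ModuleCat.{0} k) : Prop :=
  (∀ {a b : A} (f g : a ⟶ b), M.map (f + g) = M.map f + M.map g) ∧
  (∀ {a b : A} (r : k) (f : a ⟶ b), M.map (r • f) = r • M.map f)

/-- `M` is a locally finite dimensional module over `A`, i.e. an object of `mod A`. -/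
def IsLfdMod (M : A ⥤ ModuleCat.{0} k) : Prop :=
  IsMod k M ∧ ∀ a : A, FiniteDimensional k (M.obj a)

/-- The projective module `P_a = Hom_A(a, -)` at an object `a`. -/
noncomputable def ProjAt (a : A) : A ⥤ ModuleCat.{0} k :=
  (linearCoyoneda k A).obj (Opposite.op a)

/-- The injective module `I_a = D Hom_A(-, a)` at an object `a`. -/
noncomputable def InjAt (a : A) : A ⥤ ModuleCat.{0} k where
  obj b := ModuleCat.of k (Module.Dual k (b ⟶ a))
  map {b c} f := ModuleCat.ofHom (LinearMap.dualMap (Linear.leftComp k a f))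
  map_id b := by
    have h : Linear.leftComp k a (𝟙 b) = LinearMap.id := by
      apply LinearMap.ext; intro g; simp
    rw [h, LinearMap.dualMap_id]; rfl
  map_comp {b c d} f g := by
    have h : Linear.leftComp k a (f ≫ g) =
        (Linear.leftComp k a f).comp (Linear.leftComp k a g) := by
      apply LinearMap.ext; intro h; simp
    rw [h]; rfl

instance : HasFiniteBiproducts (A ⥤ ModuleCat.{0} k) :=
  CategoryTheory.Abelian.hasFiniteBiproducts

/-- `M` is finitely generated: there is an epimorphism `⊕_{i=1}^r P_{a_i} → M`. -/
def IsFG (M : A ⥤ ModuleCat.{0} k) : Prop :=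
  ∃ (r : ℕ) (a : Fin r → A) (f : (⨁ fun i => ProjAt k (a i)) ⟶ M), Epi f

/-- `M` is finitely presented: there is an epimorphism `⊕_{i=1}^r P_{a_i} → M` with
finitely generated kernel. -/
def IsFP (M : A ⥤ ModuleCat.{0} k) : Prop :=
  ∃ (r : ℕ) (a : Fin r → A) (f : (⨁ fun i => ProjAt k (a i)) ⟶ M),
    Epi f ∧ IsFG k (kernel f)

/-- `M` is finitely co-generated: there is a monomorphism `M → ⊕_{j=1}^s I_{b_j}`. -/
def IsFCG (M : A ⥤ ModuleCat.{0} k) : Prop :=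
  ∃ (s : ℕ) (b : Fin s → A) (f : M ⟶ ⨁ fun j => InjAt k (b j)), Mono f

/-- `M` is finitely co-presented: there is a monomorphism `M → ⊕_{j=1}^s I_{b_j}` with
finitely co-generated cokernel. -/
def IsFCP (M : A ⥤ ModuleCat.{0} k) : Prop :=
  ∃ (s : ℕ) (b : Fin s → A) (f : M ⟶ ⨁ fun j => InjAt k (b j)),
    Mono f ∧ IsFCG k (cokernel f)

/-- `f` is an irreducible morphism in `mod A`: it is neither a split mono nor a split epi,
and in any factorization `f = g ≫ h` through an object of `mod A`, `g` is a split mono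
or `h` is a split epi. -/
def Irred {L M : A ⥤ ModuleCat.{0} k} (f : L ⟶ M) : Prop :=
  ¬ IsSplitMono f ∧ ¬ IsSplitEpi f ∧
    ∀ ⦃X : A ⥤ ModuleCat.{0} k⦄, IsLfdMod k X →
      ∀ (g : L ⟶ X) (h : X ⟶ M), g ≫ h = f → IsSplitMono g ∨ IsSplitEpi h

/-- `M` is an indecomposable object of `mod A`: it is nonzero, and whenever `M ≅ X ⊞ Y`
with `X`, `Y` in `mod A`, one of `X`, `Y` is zero. -/
def Indec (M : A ⥤ ModuleCat.{0} k) : Prop :=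
  ¬ IsZero M ∧ ∀ ⦃X Y : A ⥤ ModuleCat.{0} k⦄, IsLfdMod k X → IsLfdMod k Y →
    (M ≅ X ⊞ Y) → IsZero X ∨ IsZero Y

/-- `0 → L →f M →g N → 0` is an almost split sequence in `mod A`. -/
structure AlmostSplitSeq {L M N : A ⥤ ModuleCat.{0} k} (f : L ⟶ M) (g : M ⟶ N) : Prop where
  mono : Mono f
  epi : Epi g
  zero : f ≫ g = 0
  exact : (ShortComplex.mk f g zero).Exact
  not_splitMono : ¬ IsSplitMono f
  not_splitEpi : ¬ IsSplitEpi g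
  left_almost_split : ∀ ⦃X : A ⥤ ModuleCat.{0} k⦄, IsLfdMod k X →
    ∀ u : L ⟶ X, ¬ IsSplitMono u → ∃ v : M ⟶ X, f ≫ v = u
  right_almost_split : ∀ ⦃X : A ⥤ ModuleCat.{0} k⦄, IsLfdMod k X →
    ∀ u : X ⟶ N, ¬ IsSplitEpi u → ∃ v : X ⟶ M, v ≫ g = u

/-- `M` is projective as an object of `mod A`. -/
def ProjInMod (M : A ⥤ ModuleCat.{0} k) : Prop :=
  ∀ ⦃X Y : A ⥤ ModuleCat.{0} k⦄, IsLfdMod k X → IsLfdMod k Y →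
    ∀ (e : X ⟶ Y), Epi e → ∀ u : M ⟶ Y, ∃ t : M ⟶ X, t ≫ e = u

/-- `M` is injective as an object of `mod A`. -/
def InjInMod (M : A ⥤ ModuleCat.{0} k) : Prop :=
  ∀ ⦃X Y : A ⥤ ModuleCat.{0} k⦄, IsLfdMod k X → IsLfdMod k Y →
    ∀ (m : X ⟶ Y), Mono m → ∀ u : X ⟶ M, ∃ t : Y ⟶ M, m ≫ t = u

/-- `h` is a (nonempty) composition of irreducible morphisms between indecomposable
objects of `mod A`. -/
inductive IrredChain : ∀ {X Y : A ⥤ ModuleCat.{0} k}, (X ⟶ Y) → Prop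
  | single {X Y : A ⥤ ModuleCat.{0} k} (f : X ⟶ Y) :
      IsLfdMod k X → Indec k X → IsLfdMod k Y → Indec k Y → Irred k f → IrredChain f
  | comp {X Y Z : A ⥤ ModuleCat.{0} k} (f : X ⟶ Y) (g : Y ⟶ Z) :
      IsLfdMod k X → Indec k X → Irred k f → IrredChain g → IrredChain (f ≫ g)

end General

section QuiverSection

variable (Q : Type) [Quiver.{0} Q]

/-- `Q` is locally finite: every vertex is the source of finitely many arrows and the
target of finitely many arrows. -/
def LocallyFinite : Prop :=
  ∀ x : Q, Finite (Σ y : Q, x ⟶ y) ∧ Finite (Σ y : Q, y ⟶ x)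

/-- `Q` is interval finite: there are finitely many paths between any two vertices. -/
def IntervalFinite : Prop :=
  ∀ x y : Q, Finite (Quiver.Path x y)

/-- `Q` is strongly locally finite: locally finite and interval finite. -/
def StronglyLocallyFinite : Prop :=
  LocallyFinite Q ∧ IntervalFinite Q

/-- `Q` is connected: nonempty, and any two vertices are joined by a walk. -/
def QuiverConnected : Prop :=
  Nonempty Q ∧ ∀ x y : Q,
    Nonempty (Quiver.Path (Quiver.Symmetrify.of.obj x) (Quiver.Symmetrify.of.obj y))

/-- The path category `kQ` of the quiver `Q`: the free `k`-linear category on the free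
category on `Q`. -/
abbrev PathCat := CategoryTheory.Free k (Paths Q)

/-- A vertex of `Q`, seen as an object of the path category `kQ`. -/
noncomputable def vtx (x : Q) : PathCat k Q :=
  (Free.embedding k (Paths Q)).obj ((Paths.of Q).obj x)

/-- An arrow of `Q`, seen as a morphism of the path category `kQ`. -/
noncomputable def arrHom {x y : Q} (α : x ⟶ y) : vtx k Q x ⟶ vtx k Q y :=
  (Free.embedding k (Paths Q)).map ((Paths.of Q).map α)

/-- The degree of a vertex of `Q`: the total number of arrows incident to it. -/
noncomputable def degree (x : Q) : ℕ :=
  Nat.card ((Σ y : Q, x ⟶ y) ⊕ (Σ y : Q, y ⟶ x))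

/-- `M` belongs to `rrep(Q)`: it is the middle term of a short exact sequence
`0 → L → M → N → 0` with `L` finitely presented, `N` finitely co-presented, and only
finitely many arrows `α` of `Q` satisfy `M(α) ≠ 0`, `L(α) = 0` and `N(α) = 0`. -/
def InRrep (M : PathCat k Q ⥤ ModuleCat.{0} k) : Prop :=
  ∃ (L N : PathCat k Q ⥤ ModuleCat.{0} k) (f : L ⟶ M) (g : M ⟶ N) (zero : f ≫ g = 0),
    Mono f ∧ Epi g ∧ (ShortComplex.mk f g zero).Exact ∧ IsFP k L ∧ IsFCP k N ∧
    Set.Finite {p : Σ (x : Q) (y : Q), x ⟶ y |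
      M.map (arrHom k Q p.2.2) ≠ 0 ∧ L.map (arrHom k Q p.2.2) = 0 ∧
      N.map (arrHom k Q p.2.2) = 0}

variable {Q}

/-- The vertices occurring in a path. -/
def InPath {x : Q} : ∀ {y : Q}, Quiver.Path x y → Q → Prop
  | _, Quiver.Path.nil, v => v = x
  | _, @Quiver.Path.cons _ _ _ _ c p _, v => v = c ∨ InPath p v

variable (Q)

/-- `Q` is a star quiver: it is obtained from a finite full convex subquiver `Γ` by
attaching finitely many rays and co-rays with no common vertices. -/
def IsStarQuiver : Prop :=
  ∃ (Γ S₁ S₂ : Set Q) (v : Q → ℕ → Q),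
    Γ.Finite ∧ S₁ ⊆ Γ ∧ S₂ ⊆ Γ ∧ Disjoint S₁ S₂ ∧
    (∀ x y : Q, x ∈ Γ → y ∈ Γ → ∀ p : Quiver.Path x y, ∀ z : Q, InPath p z → z ∈ Γ) ∧
    (∀ s ∈ S₁ ∪ S₂, ∀ i : ℕ, v s i ∉ Γ) ∧
    (∀ s ∈ S₁ ∪ S₂, ∀ t ∈ S₁ ∪ S₂, ∀ i j : ℕ, v s i = v t j → s = t ∧ i = j) ∧
    (∀ x : Q, x ∉ Γ → ∃ s ∈ S₁ ∪ S₂, ∃ i : ℕ, x = v s i) ∧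
    (∀ s ∈ S₁, Nat.card (s ⟶ v s 0) = 1 ∧ ∀ i : ℕ, Nat.card (v s i ⟶ v s (i + 1)) = 1) ∧
    (∀ s ∈ S₂, Nat.card (v s 0 ⟶ s) = 1 ∧ ∀ i : ℕ, Nat.card (v s (i + 1) ⟶ v s i) = 1) ∧
    (∀ x y : Q, (x ⟶ y) → ¬(x ∈ Γ ∧ y ∈ Γ) →
      (∃ s ∈ S₁, (x = s ∧ y = v s 0) ∨ ∃ i : ℕ, x = v s i ∧ y = v s (i + 1)) ∨
      (∃ s ∈ S₂, (x = v s 0 ∧ y = s) ∨ ∃ i : ℕ, x = v s (i + 1) ∧ y = v s i))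

end QuiverSection

theorem exists_rec_family {Q : Type} {C : Q → Type} [∀ x, Inhabited (C x)] {r : Q → Q → Prop}
    (hr : WellFounded r) (P : ∀ x, C x → Prop) (R : ∀ x y, C x → C y → Prop)
    (step : ∀ y (φ : ∀ x, C x), (∀ x, r x y → P x (φ x)) →
      ∃ c, P y c ∧ ∀ x, r x y → R x y (φ x) c) :
    ∃ φ : ∀ x, C x, ∀ y, P y (φ y) ∧ ∀ x, r x y → R x y (φ x) (φ y) := by
  classical
  let F : ∀ y, (∀ x, r x y → C x) → C y := fun y ih =>
    if h : ∃ c, P y c ∧ ∀ x (hx : r x y), R x y (ih x hx) c then h.choose else default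
  let φ : ∀ x, C x := hr.fix F
  have hφ : ∀ y, φ y = F y fun x _ => φ x := fun y => hr.fix_eq F y
  have key : ∀ y, P y (φ y) ∧ ∀ x, r x y → R x y (φ x) (φ y) := by
    intro y
    induction y using hr.induction with
    | _ y ih =>
      have h : ∃ c, P y c ∧ ∀ x, r x y → R x y (φ x) c := step y φ fun x hx => (ih x hx).1
      rw [hφ y]
      simp only [F]
      rw [dif_pos h]
      exact h.choose_spec
  exact ⟨φ, key⟩

section FiveLemma

variable {k} {A B C A' B' C' : Type} [AddCommGroup A] [AddCommGroup B] [AddCommGroup C]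
  [AddCommGroup A'] [AddCommGroup B'] [AddCommGroup C'] [Module k A] [Module k B] [Module k C]
  [Module k A'] [Module k B'] [Module k C'] {i : A →ₗ[k] B} {p : B →ₗ[k] C} {i' : A' →ₗ[k] B'}
  {p' : B' →ₗ[k] C'} {a : A →ₗ[k] A'} {b : B →ₗ[k] B'} {c : C →ₗ[k] C'}

lemma five_mid_inj (hi' : Function.Injective i')
    (hip : ∀ v, p v = 0 → ∃ u, i u = v) (h₁ : ∀ v, b (i v) = i' (a v))
    (h₂ : ∀ v, c (p v) = p' (b v)) (ha : Function.Injective a) (hc : Function.Injective c) :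
    Function.Injective b := by
  rw [injective_iff_map_eq_zero] at *
  intro v hv
  obtain ⟨u, rfl⟩ := hip v (hc _ (by rw [h₂, hv, map_zero]))
  rw [ha u (hi' _ (by rw [← h₁, hv])), map_zero]

lemma five_mid_surj (hp : Function.Surjective p)
    (hip' : ∀ v, p' v = 0 → ∃ u, i' u = v) (h₁ : ∀ v, b (i v) = i' (a v))
    (h₂ : ∀ v, c (p v) = p' (b v)) (ha : Function.Surjective a) (hc : Function.Surjective c) :
    Function.Surjective b := by
  intro v
  obtain ⟨w, hw⟩ := hc (p' v)
  obtain ⟨u, rfl⟩ := hp w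
  obtain ⟨t, ht⟩ := hip' (v - b u) (by rw [map_sub, ← h₂, hw, sub_self])
  obtain ⟨s, rfl⟩ := ha t
  exact ⟨i s + u, by rw [map_add, h₁, ht, sub_add_cancel]⟩

lemma five_right_inj (hp : Function.Surjective p) (hpi : ∀ u, p (i u) = 0)
    (hip' : ∀ v, p' v = 0 → ∃ u, i' u = v) (h₁ : ∀ v, b (i v) = i' (a v))
    (h₂ : ∀ v, c (p v) = p' (b v)) (ha : Function.Surjective a) (hb : Function.Injective b) :
    Function.Injective c := by
  rw [injective_iff_map_eq_zero]
  intro w hw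
  obtain ⟨v, rfl⟩ := hp w
  obtain ⟨t, ht⟩ := hip' (b v) (by rw [← h₂, hw])
  obtain ⟨s, rfl⟩ := ha t
  rw [← h₁] at ht
  rw [← hb ht, hpi]

lemma five_right_surj (hp' : Function.Surjective p')
    (h₂ : ∀ v, c (p v) = p' (b v)) (hb : Function.Surjective b) :
    Function.Surjective c := by
  intro w
  obtain ⟨v, rfl⟩ := hp' w
  obtain ⟨u, rfl⟩ := hb v
  exact ⟨p u, h₂ u⟩

lemma five_left_inj (hi : Function.Injective i) (h₁ : ∀ v, b (i v) = i' (a v))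
    (hb : Function.Injective b) : Function.Injective a := by
  intro v w h
  apply hi
  apply hb
  rw [h₁, h₁, h]

lemma five_left_surj (hi' : Function.Injective i') (hip : ∀ v, p v = 0 → ∃ u, i u = v)
    (hpi' : ∀ u, p' (i' u) = 0) (h₁ : ∀ v, b (i v) = i' (a v))
    (h₂ : ∀ v, c (p v) = p' (b v)) (hb : Function.Surjective b) (hc : Function.Injective c) :
    Function.Surjective a := by
  intro w
  obtain ⟨v, hv⟩ := hb (i' w)
  obtain ⟨u, rfl⟩ := hip v (hc (by rw [h₂, hv, hpi', map_zero]))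
  exact ⟨u, hi' (by rw [← h₁, hv])⟩

end FiveLemma

section LinearExtension

variable {k} {W R L N : Type} [AddCommGroup W] [AddCommGroup R] [AddCommGroup L]
  [AddCommGroup N] [Module k W] [Module k R] [Module k L] [Module k N]

lemma exists_lift_extending (e : L →ₗ[k] N) (he : Function.Surjective e) (h : R →ₗ[k] N)
    (c : W →ₗ[k] R) (hc : Function.Injective c) (d : W →ₗ[k] L) (hd : ∀ w, e (d w) = h (c w)) :
    ∃ s : R →ₗ[k] L, (∀ r, e (s r) = h r) ∧ ∀ w, s (c w) = d w := by
  obtain ⟨σ, hσ⟩ := LinearMap.exists_rightInverse_of_surjective e (LinearMap.range_eq_top.2 he)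
  obtain ⟨ρ, hρ⟩ := LinearMap.exists_leftInverse_of_injective c (LinearMap.ker_eq_bot.2 hc)
  have hσ' : ∀ v, e (σ v) = v := fun v => LinearMap.congr_fun hσ v
  have hρ' : ∀ v, ρ (c v) = v := fun v => LinearMap.congr_fun hρ v
  refine ⟨σ ∘ₗ h + (d - σ ∘ₗ h ∘ₗ c) ∘ₗ ρ, fun r => ?_, fun w => ?_⟩
  · simp [hσ', hd]
  · simp [hρ']

lemma exists_dual_of_finite {F I : Type} [AddCommGroup F] [Module k F] (ℓ : I → F) (b : I → k)
    (h : ∀ S : Finset I, ∃ φ : Module.Dual k F, ∀ i ∈ S, φ (ℓ i) = b i) :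
    ∃ φ : Module.Dual k F, ∀ i, φ (ℓ i) = b i := by
  have hker : Finsupp.linearCombination k b ∈
      LinearMap.range (Finsupp.linearCombination k ℓ).dualMap := by
    rw [LinearMap.range_dualMap_eq_dualAnnihilator_ker, Submodule.mem_dualAnnihilator]
    intro c hc
    obtain ⟨φ, hφ⟩ := h c.support
    have h1 : φ (Finsupp.linearCombination k ℓ c) = Finsupp.linearCombination k b c := by
      simp only [Finsupp.linearCombination_apply, Finsupp.sum, map_sum, map_smul]
      exact Finset.sum_congr rfl fun i hi => by rw [hφ i hi]
    rw [← h1, LinearMap.mem_ker.1 hc, map_zero]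
  obtain ⟨φ, hφ⟩ := hker
  refine ⟨φ, fun i => ?_⟩
  have := LinearMap.congr_fun hφ (Finsupp.single i 1)
  simpa using this

lemma exists_family_of_finite_of_dual {V I : Type} {D : V → Type} [∀ x, AddCommGroup (D x)]
    [∀ x, Module k (D x)] (x y : I → V) (ξ : ∀ i, D (x i)) (η : ∀ i, D (y i)) (b : I → k)
    (h : ∀ G : Set V, G.Finite → ∃ φ : ∀ v, D v →ₗ[k] k, ∀ i, x i ∈ G → y i ∈ G →
      φ (x i) (ξ i) - φ (y i) (η i) = b i) :
    ∃ φ : ∀ v, D v →ₗ[k] k, ∀ i, φ (x i) (ξ i) - φ (y i) (η i) = b i := by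
  classical
  have key : ∃ Φ : (Π₀ v, D v) →ₗ[k] k,
      ∀ i, Φ (DFinsupp.single (x i) (ξ i) - DFinsupp.single (y i) (η i)) = b i := by
    refine exists_dual_of_finite (k := k) (F := Π₀ v, D v) _ b fun S => ?_
    obtain ⟨φ, hφ⟩ := h (x '' S ∪ y '' S)
      ((S.finite_toSet.image x).union (S.finite_toSet.image y))
    refine ⟨DFinsupp.lsum k φ, fun i hi => ?_⟩
    rw [map_sub, DFinsupp.lsum_single, DFinsupp.lsum_single]
    exact hφ i (Or.inl ⟨i, hi, rfl⟩) (Or.inr ⟨i, hi, rfl⟩)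
  obtain ⟨Φ, hΦ⟩ := key
  refine ⟨fun v => Φ ∘ₗ DFinsupp.lsingle v, fun i => ?_⟩
  rw [← hΦ, map_sub]
  rfl

lemma exists_family_of_finite {V I : Type} {E : V → Type} [∀ x, AddCommGroup (E x)]
    [∀ x, Module k (E x)] [∀ x, FiniteDimensional k (E x)] (x y : I → V)
    (ξ : ∀ i, Module.Dual k (E (x i))) (η : ∀ i, Module.Dual k (E (y i))) (b : I → k)
    (h : ∀ G : Set V, G.Finite → ∃ φ : ∀ v, E v, ∀ i, x i ∈ G → y i ∈ G →
      ξ i (φ (x i)) - η i (φ (y i)) = b i) :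
    ∃ φ : ∀ v, E v, ∀ i, ξ i (φ (x i)) - η i (φ (y i)) = b i := by
  obtain ⟨Φ, hΦ⟩ := exists_family_of_finite_of_dual (k := k) (D := fun v => Module.Dual k (E v))
    x y ξ η b fun G hG => by
      obtain ⟨φ, hφ⟩ := h G hG
      exact ⟨fun v => Module.Dual.eval k (E v) (φ v), hφ⟩
  refine ⟨fun v => (Module.evalEquiv k (E v)).symm (Φ v), fun i => ?_⟩
  rw [Module.apply_evalEquiv_symm_apply, Module.apply_evalEquiv_symm_apply, hΦ]

end LinearExtension

section Helpers

variable {k} {Q : Type} [Quiver.{0} Q]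

/-- A locally finite dimensional representation of the quiver `Q`, given by vector spaces at the
vertices and linear maps along the arrows. -/
structure QRep (k : Type) [Field k] (Q : Type) [Quiver.{0} Q] where
  V : Q → Type
  [acg : ∀ x, AddCommGroup (V x)]
  [mod : ∀ x, Module k (V x)]
  [fd : ∀ x, FiniteDimensional k (V x)]
  map : ∀ {x y : Q}, (x ⟶ y) → V x →ₗ[k] V y

namespace QRep

attribute [instance] QRep.acg QRep.mod QRep.fd

/-- Morphisms of representations. -/
@[ext]
structure Hom (L M : QRep k Q) where
  app : ∀ x, L.V x →ₗ[k] M.V x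
  comm : ∀ {x y : Q} (α : x ⟶ y) (v : L.V x), app y (L.map α v) = M.map α (app x v)

variable {L M N X Y Z : QRep k Q}

namespace Hom

/-- The identity morphism. -/
def id (M : QRep k Q) : Hom M M := ⟨fun _ => LinearMap.id, fun _ _ => rfl⟩

/-- Composition, in the order of application of functions. -/
def comp (g : Hom M N) (f : Hom L M) : Hom L N :=
  ⟨fun x => g.app x ∘ₗ f.app x, fun α v => by simp [f.comm, g.comm]⟩

instance : Zero (Hom L M) := ⟨⟨fun _ => 0, fun _ _ => by simp⟩⟩
instance : Add (Hom L M) := ⟨fun f g => ⟨fun x => f.app x + g.app x, fun α v => by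
  simp [f.comm, g.comm]⟩⟩
instance : Sub (Hom L M) := ⟨fun f g => ⟨fun x => f.app x - g.app x, fun α v => by
  simp [f.comm, g.comm]⟩⟩

@[simp] lemma id_app (x : Q) (v : M.V x) : (Hom.id M).app x v = v := rfl
@[simp] lemma comp_app (g : Hom M N) (f : Hom L M) (x : Q) (v : L.V x) :
    (g.comp f).app x v = g.app x (f.app x v) := rfl
@[simp] lemma add_app (f g : Hom L M) (x : Q) (v : L.V x) :
    (f + g).app x v = f.app x v + g.app x v := rfl
@[simp] lemma sub_app (f g : Hom L M) (x : Q) (v : L.V x) :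
    (f - g).app x v = f.app x v - g.app x v := rfl

lemma ext' {f g : Hom L M} (h : ∀ x v, f.app x v = g.app x v) : f = g :=
  Hom.ext (funext fun x => LinearMap.ext (h x))

/-- Pointwise injectivity. -/
def Inj (f : Hom L M) : Prop := ∀ x, Function.Injective (f.app x)
/-- Pointwise surjectivity. -/
def Surj (f : Hom L M) : Prop := ∀ x, Function.Surjective (f.app x)
/-- Existence of a retraction. -/
def SplitMono (f : Hom L M) : Prop := ∃ r : Hom M L, ∀ x v, r.app x (f.app x v) = v
/-- Existence of a section. -/
def SplitEpi (f : Hom L M) : Prop := ∃ s : Hom M L, ∀ x v, f.app x (s.app x v) = v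
/-- Pointwise bijectivity. -/
def Bij (f : Hom L M) : Prop := ∀ x, Function.Bijective (f.app x)
/-- `f` is a kernel of `g`, in the pointwise sense. -/
def ExactAt (f : Hom L M) (g : Hom M N) : Prop := ∀ x v, g.app x v = 0 ↔ ∃ u, f.app x u = v

/-- Irreducibility of morphisms of representations. -/
def Irr (f : Hom L M) : Prop :=
  ¬ f.SplitMono ∧ ¬ f.SplitEpi ∧ ∀ (X : QRep k Q) (g : Hom L X) (h : Hom X M),
    (∀ x v, h.app x (g.app x v) = f.app x v) → g.SplitMono ∨ h.SplitEpi

lemma Bij.exists_inv {f : Hom L M} (h : f.Bij) :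
    ∃ g : Hom M L, (∀ x v, g.app x (f.app x v) = v) ∧ ∀ x v, f.app x (g.app x v) = v := by
  refine ⟨⟨fun x => (LinearEquiv.ofBijective (f.app x) (h x)).symm.toLinearMap, ?_⟩, ?_, ?_⟩
  · intro x y α v
    apply (h y).1
    have h1 : ∀ z (w : M.V z), f.app z ((LinearEquiv.ofBijective (f.app z) (h z)).symm w) = w :=
      fun z w => (LinearEquiv.ofBijective (f.app z) (h z)).apply_symm_apply w
    simp only [LinearEquiv.coe_coe]
    rw [h1, f.comm, h1]
  · intro x v
    exact (LinearEquiv.ofBijective (f.app x) (h x)).symm_apply_apply v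
  · intro x v
    exact (LinearEquiv.ofBijective (f.app x) (h x)).apply_symm_apply v

lemma SplitMono.inj {f : Hom L M} (h : f.SplitMono) : f.Inj := by
  obtain ⟨r, hr⟩ := h
  intro x
  exact Function.LeftInverse.injective (hr x)

lemma SplitEpi.surj {f : Hom L M} (h : f.SplitEpi) : f.Surj := by
  obtain ⟨r, hr⟩ := h
  intro x
  exact Function.RightInverse.surjective (hr x)

lemma exists_lift_of_inj (i : Hom N M) (hi : i.Inj) (φ : Hom X M)
    (h : ∀ x v, ∃ u, i.app x u = φ.app x v) :
    ∃ ψ : Hom X N, ∀ x v, i.app x (ψ.app x v) = φ.app x v := by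
  have h' : ∀ x, ∃ ψ : X.V x →ₗ[k] N.V x, ∀ v, i.app x (ψ v) = φ.app x v := by
    intro x
    refine ⟨(LinearEquiv.ofInjective (i.app x) (hi x)).symm.toLinearMap ∘ₗ
      (φ.app x).codRestrict (LinearMap.range (i.app x)) (fun v => h x v), fun v => ?_⟩
    have := (LinearEquiv.ofInjective (i.app x) (hi x)).apply_symm_apply
      ((φ.app x).codRestrict (LinearMap.range (i.app x)) (fun v => h x v) v)
    exact congrArg Subtype.val this
  choose ψ hψ using h'
  refine ⟨⟨ψ, fun {x y} α v => hi y ?_⟩, hψ⟩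
  rw [hψ, φ.comm, i.comm, hψ]

lemma exists_desc_of_surj (e : Hom Y N) (he : e.Surj) (φ : Hom Y M)
    (h : ∀ x v, e.app x v = 0 → φ.app x v = 0) :
    ∃ ψ : Hom N M, ∀ x v, ψ.app x (e.app x v) = φ.app x v := by
  have h' : ∀ x, ∃ ψ : N.V x →ₗ[k] M.V x, ∀ v, ψ (e.app x v) = φ.app x v := by
    intro x
    refine ⟨(LinearMap.ker (e.app x)).liftQ (φ.app x) (fun v hv => h x v hv) ∘ₗ
      ((e.app x).quotKerEquivOfSurjective (he x)).symm.toLinearMap, fun v => ?_⟩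
    have : ((e.app x).quotKerEquivOfSurjective (he x)).symm (e.app x v) =
      Submodule.Quotient.mk v := by
      rw [LinearEquiv.symm_apply_eq]; rfl
    simp only [LinearMap.comp_apply, LinearEquiv.coe_coe, this]
    rfl
  choose ψ hψ using h'
  refine ⟨⟨ψ, fun {x y} α v => ?_⟩, hψ⟩
  obtain ⟨w, rfl⟩ := he x v
  rw [hψ, ← e.comm, hψ, φ.comm]

end Hom

/-- Subrepresentations. -/
structure Sub (M : QRep k Q) where
  S : ∀ x, Submodule k (M.V x)
  closed : ∀ {x y : Q} (α : x ⟶ y) (v : M.V x), v ∈ S x → M.map α v ∈ S y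

namespace Sub

/-- A subrepresentation as a representation. -/
def rep (A : Sub M) : QRep k Q where
  V x := A.S x
  map α := (M.map α).restrict (fun v hv => A.closed α v hv)

/-- The inclusion of a subrepresentation. -/
def incl (A : Sub M) : Hom A.rep M := ⟨fun x => (A.S x).subtype, fun _ _ => rfl⟩

/-- The quotient by a subrepresentation. -/
def quot (A : Sub M) : QRep k Q where
  V x := M.V x ⧸ A.S x
  map {x y} α := (A.S x).mapQ (A.S y) (M.map α) (fun v hv => A.closed α v hv)

/-- The projection onto the quotient. -/
def proj (A : Sub M) : Hom M A.quot := ⟨fun x => (A.S x).mkQ, fun _ _ => rfl⟩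

lemma incl_inj (A : Sub M) : A.incl.Inj := fun x => (A.S x).injective_subtype

lemma proj_surj (A : Sub M) : A.proj.Surj := fun x => (A.S x).mkQ_surjective

lemma exact (A : Sub M) : Hom.ExactAt A.incl A.proj := by
  intro x v
  constructor
  · intro h
    exact ⟨⟨v, (Submodule.Quotient.mk_eq_zero _).1 h⟩, rfl⟩
  · rintro ⟨u, rfl⟩
    exact (Submodule.Quotient.mk_eq_zero _).2 u.2

lemma proj_eq_zero_iff (A : Sub M) {x : Q} {v : M.V x} : A.proj.app x v = 0 ↔ v ∈ A.S x :=
  Submodule.Quotient.mk_eq_zero _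

lemma incl_mem (A : Sub M) {x : Q} (v : A.rep.V x) : A.incl.app x v ∈ A.S x := v.2

/-- An element of a subrepresentation. -/
def elt (A : Sub M) {x : Q} (v : M.V x) (h : v ∈ A.S x) : A.rep.V x := ⟨v, h⟩

@[simp] lemma incl_elt (A : Sub M) {x : Q} (v : M.V x) (h : v ∈ A.S x) :
    A.incl.app x (A.elt v h) = v := rfl

end Sub

/-- The kernel as a subrepresentation. -/
def Hom.ker (f : Hom L M) : Sub L where
  S x := LinearMap.ker (f.app x)
  closed α v hv := by
    rw [LinearMap.mem_ker] at *
    rw [f.comm, hv, map_zero]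

/-- The range as a subrepresentation. -/
def Hom.range (f : Hom L M) : Sub M where
  S x := LinearMap.range (f.app x)
  closed := by
    rintro x y α _ ⟨v, rfl⟩
    exact ⟨L.map α v, f.comm α v⟩

@[simp] lemma Hom.mem_ker {f : Hom L M} {x : Q} {v : L.V x} :
    v ∈ f.ker.S x ↔ f.app x v = 0 := Iff.rfl

/-- The direct sum of two representations. -/
def prod (L M : QRep k Q) : QRep k Q where
  V x := L.V x × M.V x
  map α := (L.map α).prodMap (M.map α)

/-- Morphisms out of a direct sum. -/
def Hom.coprod (f : Hom L N) (g : Hom M N) : Hom (prod L M) N where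
  app x := (f.app x).coprod (g.app x)
  comm {x y} α v := by
    change f.app y (L.map α v.1) + g.app y (M.map α v.2) = N.map α (f.app x v.1 + g.app x v.2)
    rw [f.comm, g.comm, map_add]

/-- Morphisms into a direct sum. -/
def Hom.prod (f : Hom N L) (g : Hom N M) : Hom N (QRep.prod L M) where
  app x := (f.app x).prod (g.app x)
  comm {x y} α v := by
    change (f.app y (N.map α v), g.app y (N.map α v)) =
      (L.map α (f.app x v), M.map α (g.app x v))
    rw [f.comm, g.comm]

/-- The first inclusion. -/
def Hom.inl (L M : QRep k Q) : Hom L (QRep.prod L M) := Hom.prod (Hom.id L) 0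
/-- The second inclusion. -/
def Hom.inr (L M : QRep k Q) : Hom M (QRep.prod L M) := Hom.prod 0 (Hom.id M)
/-- The first projection. -/
def Hom.fst (L M : QRep k Q) : Hom (QRep.prod L M) L := Hom.coprod (Hom.id L) 0
/-- The second projection. -/
def Hom.snd (L M : QRep k Q) : Hom (QRep.prod L M) M := Hom.coprod 0 (Hom.id M)

/-- The pair of two vectors, as a vector of the direct sum. -/
def pair {x : Q} (a : L.V x) (b : M.V x) : (QRep.prod L M).V x := (a, b)

@[simp] lemma Hom.fst_pair {x : Q} (a : L.V x) (b : M.V x) :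
    (Hom.fst L M).app x (pair a b) = a := add_zero _
@[simp] lemma Hom.snd_pair {x : Q} (a : L.V x) (b : M.V x) :
    (Hom.snd L M).app x (pair a b) = b := zero_add _
lemma Hom.fst_app_eq {x : Q} (v : (QRep.prod L M).V x) :
    (Hom.fst L M).app x v = Prod.fst (α := L.V x) (β := M.V x) v := add_zero _
lemma Hom.snd_app_eq {x : Q} (v : (QRep.prod L M).V x) :
    (Hom.snd L M).app x v = Prod.snd (α := L.V x) (β := M.V x) v := zero_add _
lemma pair_eta {x : Q} (v : (QRep.prod L M).V x) :
    pair ((Hom.fst L M).app x v) ((Hom.snd L M).app x v) = v := by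
  rw [Hom.fst_app_eq, Hom.snd_app_eq]; rfl
lemma prod_ext {x : Q} {v w : (QRep.prod L M).V x}
    (h₁ : (Hom.fst L M).app x v = (Hom.fst L M).app x w)
    (h₂ : (Hom.snd L M).app x v = (Hom.snd L M).app x w) : v = w := by
  rw [← pair_eta v, ← pair_eta w, h₁, h₂]
@[simp] lemma pair_zero {x : Q} : pair (0 : L.V x) (0 : M.V x) = 0 := rfl
lemma Hom.coprod_app (f : Hom L N) (g : Hom M N) {x : Q} (v : (QRep.prod L M).V x) :
    (f.coprod g).app x v = f.app x ((Hom.fst L M).app x v) + g.app x ((Hom.snd L M).app x v) := by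
  rw [Hom.fst_app_eq, Hom.snd_app_eq]; rfl
@[simp] lemma Hom.coprod_pair (f : Hom L N) (g : Hom M N) {x : Q} (a : L.V x) (b : M.V x) :
    (f.coprod g).app x (pair a b) = f.app x a + g.app x b := rfl
@[simp] lemma Hom.prod_app (f : Hom N L) (g : Hom N M) (x : Q) (v : N.V x) :
    (f.prod g).app x v = pair (f.app x v) (g.app x v) := rfl
@[simp] lemma Hom.inl_app (x : Q) (v : L.V x) : (Hom.inl L M).app x v = pair v 0 := rfl
@[simp] lemma Hom.inr_app (x : Q) (v : M.V x) : (Hom.inr L M).app x v = pair 0 v := rfl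
@[simp] lemma pair_add {x : Q} (a a' : L.V x) (b b' : M.V x) :
    pair a b + pair a' b' = pair (a + a') (b + b') := rfl

/-- Indecomposability, expressed through idempotent endomorphisms. -/
def Indecomp (M : QRep k Q) : Prop :=
  (∃ (x : Q) (v : M.V x), v ≠ 0) ∧ ∀ e : Hom M M, (∀ x v, e.app x (e.app x v) = e.app x v) →
    (∀ x v, e.app x v = 0) ∨ (∀ x v, e.app x v = v)

end QRep

namespace QRep

variable {L M N X Y Z C : QRep k Q}

lemma Indecomp.of_isCompl (hM : M.Indecomp) (A B : Sub M)
    (h : ∀ x, IsCompl (A.S x) (B.S x)) :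
    (∀ x, A.S x = ⊥) ∨ (∀ x, B.S x = ⊥) := by
  let e : Hom M M := ⟨fun x => (A.S x).projection (B.S x) (h x), by
    intro x y α v
    have hv := Submodule.projection_add_projection_eq_self (h x) v
    have h1 := A.closed α _ (Submodule.projection_apply_mem (h x) v)
    have h2 := B.closed α _ (Submodule.projection_apply_mem (h x).symm v)
    conv_lhs => rw [← hv]
    rw [map_add, map_add, Submodule.projection_apply_of_mem_left _ h1,
      (Submodule.projection_apply_eq_zero_iff (h y)).2 h2, add_zero]⟩
  rcases hM.2 e (fun x v => Submodule.projection_apply_of_mem_left _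
    (Submodule.projection_apply_mem (h x) v)) with h0 | h1
  · left
    intro x
    rw [Submodule.eq_bot_iff]
    intro v hv
    rw [← Submodule.projection_apply_of_mem_left (h x) hv]
    exact h0 x v
  · right
    intro x
    rw [Submodule.eq_bot_iff]
    intro v hv
    rw [← h1 x v]
    exact (Submodule.projection_apply_eq_zero_iff (h x)).2 hv

lemma Hom.pow_comm (φ : Hom M M) (n : ℕ) {x y : Q} (α : x ⟶ y) (v : M.V x) :
    (φ.app y ^ n) (M.map α v) = M.map α ((φ.app x ^ n) v) := by
  induction n with
  | zero => rfl
  | succ n ih => rw [pow_succ', pow_succ', Module.End.mul_apply, Module.End.mul_apply, ih, φ.comm]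

lemma mem_iSup_ker_pow {V : Type} [AddCommGroup V] [Module k V] (f : Module.End k V) (v : V) :
    v ∈ (⨆ n : ℕ, LinearMap.ker (f ^ n)) ↔ ∃ n : ℕ, (f ^ n) v = 0 := by
  have h : Monotone fun n : ℕ => LinearMap.ker (f ^ n) := f.iterateKer.monotone
  rw [Submodule.mem_iSup_of_directed _ h.directed_le]
  rfl

lemma mem_iInf_range_pow {V : Type} [AddCommGroup V] [Module k V] (f : Module.End k V) (v : V) :
    v ∈ (⨅ n : ℕ, LinearMap.range (f ^ n)) ↔ ∀ n : ℕ, ∃ w, (f ^ n) w = v := by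
  simp [Submodule.mem_iInf]

lemma Indecomp.bij_or (hM : M.Indecomp) (φ : Hom M M) : φ.Bij ∨ (Hom.id M - φ).Bij := by
  let A : Sub M := ⟨fun x => ⨆ n : ℕ, LinearMap.ker (φ.app x ^ n), by
    intro x y α v hv
    rw [mem_iSup_ker_pow] at *
    obtain ⟨n, hn⟩ := hv
    exact ⟨n, by rw [φ.pow_comm, hn, map_zero]⟩⟩
  let B : Sub M := ⟨fun x => ⨅ n : ℕ, LinearMap.range (φ.app x ^ n), by
    intro x y α v hv
    rw [mem_iInf_range_pow] at *
    intro n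
    obtain ⟨w, hw⟩ := hv n
    exact ⟨M.map α w, by rw [φ.pow_comm, hw]⟩⟩
  have hc : ∀ x, IsCompl (A.S x) (B.S x) := fun x =>
    LinearMap.isCompl_iSup_ker_pow_iInf_range_pow (φ.app x)
  rcases hM.of_isCompl A B hc with h | h
  · left
    intro x
    have hinj : Function.Injective (φ.app x) := by
      rw [injective_iff_map_eq_zero]
      intro v hv
      have : v ∈ A.S x := (mem_iSup_ker_pow _ _).2 ⟨1, by simpa using hv⟩
      rw [h x] at this
      exact (Submodule.mem_bot k).1 this
    exact ⟨hinj, LinearMap.injective_iff_surjective.1 hinj⟩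
  · right
    intro x
    have hinj : Function.Injective ((Hom.id M - φ).app x) := by
      rw [injective_iff_map_eq_zero]
      intro v hv
      rw [Hom.sub_app, Hom.id_app, sub_eq_zero] at hv
      have hA : v ∈ A.S x := by
        have := hc x
        rw [h x] at this
        rw [eq_top_of_isCompl_bot this]
        trivial
      obtain ⟨n, hn⟩ := (mem_iSup_ker_pow _ _).1 hA
      have : ∀ n : ℕ, (φ.app x ^ n) v = v := by
        intro n
        induction n with
        | zero => rfl
        | succ n ih => rw [pow_succ', Module.End.mul_apply, ih, ← hv]
      rw [← this n, hn]
    exact ⟨hinj, LinearMap.injective_iff_surjective.1 hinj⟩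

lemma Indecomp.retract (hL : L.Indecomp) (e : Hom L N) (s : Hom N L)
    (h : ∀ x v, e.app x (s.app x v) = v) : (∀ x (v : N.V x), v = 0) ∨ e.Bij := by
  rcases hL.2 (s.comp e) (fun x v => by simp [h]) with h0 | h1
  · left
    intro x v
    have := h0 x (s.app x v)
    rw [Hom.comp_app, h] at this
    rw [← h x v, this, map_zero]
  · right
    exact fun x => Function.bijective_iff_has_inverse.2 ⟨s.app x, h1 x, h x⟩

namespace Hom

lemma Irr.inj_or_surj {f : Hom L M} (hf : f.Irr) : f.Inj ∨ f.Surj := by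
  obtain ⟨g, hg⟩ := exists_lift_of_inj f.range.incl f.range.incl_inj f
    (fun x v => ⟨f.range.elt (f.app x v) ⟨v, rfl⟩, rfl⟩)
  rcases hf.2.2 _ g f.range.incl hg with h | h
  · left
    intro x v w hvw
    apply h.inj x
    apply f.range.incl_inj x
    rw [hg, hg, hvw]
  · right
    intro x v
    obtain ⟨u, rfl⟩ := h.surj x v
    exact f.range.incl_mem u

lemma Irr.comp_bij {f : Hom L M} (hf : f.Irr) {e : Hom N L} (he : e.Bij) : (f.comp e).Irr := by
  obtain ⟨e', h1, h2⟩ := he.exists_inv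
  refine ⟨fun ⟨r, hr⟩ => hf.1 ⟨e.comp r, fun x v => ?_⟩,
    fun ⟨s, hs⟩ => hf.2.1 ⟨e.comp s, fun x v => hs x v⟩, fun X g h hgh => ?_⟩
  · have := hr x (e'.app x v)
    rw [comp_app, h2] at this
    rw [comp_app, this, h2]
  · rcases hf.2.2 X (g.comp e') h (fun x v => by simp [hgh, h2]) with ⟨r, hr⟩ | h
    · left
      refine ⟨e'.comp r, fun x v => ?_⟩
      have := hr x (e.app x v)
      rw [comp_app, h1] at this
      rw [comp_app, this, h1]
    · exact Or.inr h

lemma Irr.ar_mono {f : Hom L M} (hf : f.Irr) {π : Hom M C} (hs : π.Surj)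
    (hex : ExactAt f π) (h : Hom X C) :
    (∃ t : Hom X M, ∀ x v, π.app x (t.app x v) = h.app x v) ∨
      (∃ t : Hom M X, ∀ x v, h.app x (t.app x v) = π.app x v) := by
  let W : Sub (QRep.prod X M) := ker ((h.comp (fst X M)) - (π.comp (snd X M)))
  have hW : ∀ x (w : W.rep.V x), h.app x ((fst X M).app x (W.incl.app x w)) =
      π.app x ((snd X M).app x (W.incl.app x w)) := fun x w => sub_eq_zero.1 w.2
  have hf0 : ∀ x v, π.app x (f.app x v) = 0 := fun x v => (hex x _).2 ⟨v, rfl⟩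
  obtain ⟨g, hg⟩ := exists_lift_of_inj W.incl W.incl_inj ((inr X M).comp f)
    (fun x v => ⟨W.elt (pair 0 (f.app x v)) (by
      rw [mem_ker, sub_app, comp_app, comp_app, fst_pair, snd_pair, map_zero, hf0, sub_zero]), rfl⟩)
  rcases hf.2.2 _ g ((snd X M).comp W.incl) (fun x v => by
    rw [comp_app, hg, comp_app, inr_app, snd_pair]) with ⟨r, hr⟩ | ⟨s, hs⟩
  · left
    have hsurj : ((fst X M).comp W.incl).Surj := by
      intro x a
      obtain ⟨b, hb⟩ := hs x (h.app x a)
      refine ⟨W.elt (pair a b) ?_, ?_⟩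
      · rw [mem_ker, sub_app, comp_app, comp_app, fst_pair, snd_pair, hb, sub_self]
      · rw [comp_app, Sub.incl_elt, fst_pair]
    obtain ⟨t, ht⟩ := exists_desc_of_surj _ hsurj
      (((snd X M).comp W.incl) - (f.comp r)) (fun x w hw => by
        have h1 := hW x w
        rw [comp_app] at hw
        rw [hw, map_zero] at h1
        obtain ⟨u, hu⟩ := (hex x _).1 h1.symm
        have : g.app x u = w := by
          apply W.incl_inj x
          rw [hg, comp_app, hu, inr_app]
          rw [← hw, pair_eta]
        rw [sub_app, comp_app, comp_app, ← this, hr, hg, comp_app, inr_app, snd_pair, sub_self])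
    refine ⟨t, fun x a => ?_⟩
    obtain ⟨w, rfl⟩ := hsurj x a
    rw [ht, sub_app, map_sub, comp_app, comp_app, hf0, sub_zero, comp_app, hW]
  · right
    refine ⟨(fst X M).comp (W.incl.comp s), fun x b => ?_⟩
    have := hs x b
    rw [comp_app] at this
    rw [comp_app, comp_app, hW, this]

end Hom

lemma Indecomp.splitEpi_or (hM : M.Indecomp) {f : Hom L M} {g : Hom N M} {s : Hom M L}
    {t : Hom M N} (h : ∀ x v, f.app x (s.app x v) + g.app x (t.app x v) = v) :
    f.SplitEpi ∨ g.SplitEpi := by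
  rcases hM.bij_or (f.comp s) with h1 | h1
  · left
    obtain ⟨i, -, hi⟩ := h1.exists_inv
    exact ⟨s.comp i, hi⟩
  · right
    obtain ⟨i, -, hi⟩ := h1.exists_inv
    refine ⟨t.comp i, fun x v => ?_⟩
    have h1 := hi x v
    have h2 := h x (i.app x v)
    rw [Hom.sub_app, Hom.id_app, Hom.comp_app] at h1
    rw [Hom.comp_app, ← h1]
    exact eq_sub_of_add_eq' (by rw [h1]; exact h2)

lemma Indecomp.irr_coprod (hL : L.Indecomp) (hN : N.Indecomp) (hM : M.Indecomp)
    (hLN : ∀ a : Hom N L, ¬ a.Bij) {f : Hom L M} {g : Hom N M} (hf : f.Irr) (hg : g.Irr) :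
    (f.coprod g).Irr := by
  refine ⟨fun ⟨r, hr⟩ => hf.1 ⟨(Hom.fst L N).comp r, fun x v => ?_⟩, fun ⟨s, hs⟩ => ?_,
    fun X p q hpq => ?_⟩
  · have := hr x ((Hom.inl L N).app x v)
    rw [Hom.inl_app, Hom.coprod_pair, map_zero, add_zero] at this
    rw [Hom.comp_app, this, Hom.fst_pair]
  · rcases hM.splitEpi_or (f := f) (g := g) (s := (Hom.fst L N).comp s)
      (t := (Hom.snd L N).comp s) (fun x v => by
        rw [Hom.comp_app, Hom.comp_app, ← Hom.coprod_app]; exact hs x v) with h | h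
    · exact hf.2.1 h
    · exact hg.2.1 h
  · rcases hf.2.2 X (p.comp (Hom.inl L N)) q (fun x v => by
      rw [Hom.comp_app, hpq, Hom.inl_app, Hom.coprod_pair]; simp) with ⟨r₁, h₁⟩ | h
    · rcases hg.2.2 X (p.comp (Hom.inr L N)) q (fun x v => by
        rw [Hom.comp_app, hpq, Hom.inr_app, Hom.coprod_pair]; simp) with ⟨r₂, h₂⟩ | h
      · left
        let a : Hom N L := r₁.comp (p.comp (Hom.inr L N))
        let b : Hom L N := r₂.comp (p.comp (Hom.inl L N))
        rcases hN.bij_or (b.comp a) with h | h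
        · obtain ⟨i, hi, -⟩ := h.exists_inv
          rcases hL.retract (i.comp b) a hi with h0 | h0
          · obtain ⟨x, v, hv⟩ := hN.1
            exact absurd (h0 x v) hv
          · refine absurd (fun x => ?_) (hLN a)
            refine Function.bijective_iff_has_inverse.2 ⟨(i.comp b).app x, hi x, fun v => ?_⟩
            apply (h0 x).1
            exact hi x _
        · obtain ⟨τ, hτ, -⟩ := h.exists_inv
          let w : Hom X N := τ.comp (r₂ - b.comp r₁)
          refine ⟨(r₁ - a.comp w).prod w, fun x v => ?_⟩
          obtain ⟨u, v, rfl⟩ : ∃ a b, v = pair a b := ⟨_, _, (pair_eta v).symm⟩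
          have hp : p.app x (pair u v) = p.app x ((Hom.inl L N).app x u) +
              p.app x ((Hom.inr L N).app x v) := by
            rw [← map_add, Hom.inl_app, Hom.inr_app, pair_add, add_zero, zero_add]
          have h1 : r₁.app x (p.app x (pair u v)) = u + a.app x v := by
            rw [hp, map_add]; congr 1; exact h₁ x u
          have h2 : r₂.app x (p.app x (pair u v)) = b.app x u + v := by
            rw [hp, map_add]; congr 1; exact h₂ x v
          have hw : w.app x (p.app x (pair u v)) = v := by
            rw [Hom.comp_app, Hom.sub_app, Hom.comp_app, h1, h2, map_add]
            rw [← hτ x v]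
            congr 1
            rw [hτ, Hom.sub_app, Hom.comp_app, Hom.id_app]
            abel
          rw [Hom.prod_app, Hom.sub_app, Hom.comp_app, hw, h1, add_sub_cancel_right]
      · exact Or.inr h
    · exact Or.inr h

lemma Indecomp.irr_of_coprod (hL : L.Indecomp) (hM : M.Indecomp) {f : Hom L M} {g : Hom N M}
    (h : (f.coprod g).Irr) : f.Irr := by
  have hfe : ¬ f.SplitEpi := fun ⟨s, hs⟩ =>
    h.2.1 ⟨(Hom.inl L N).comp s, fun x v => by
      rw [Hom.comp_app, Hom.inl_app, Hom.coprod_pair, map_zero, add_zero, hs]⟩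
  have hge : ¬ g.SplitEpi := fun ⟨s, hs⟩ =>
    h.2.1 ⟨(Hom.inr L N).comp s, fun x v => by
      rw [Hom.comp_app, Hom.inr_app, Hom.coprod_pair, map_zero, zero_add, hs]⟩
  refine ⟨fun ⟨r, hr⟩ => ?_, hfe, fun X p q hpq => ?_⟩
  · rcases hM.retract r f hr with h0 | h0
    · obtain ⟨x, v, hv⟩ := hL.1
      exact hv (h0 x v)
    · exact hfe ⟨r, fun x v => (h0 x).1 (hr x _)⟩
  · rcases h.2.2 (QRep.prod X N) (((Hom.inl X N).comp (p.comp (Hom.fst L N))) +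
      ((Hom.inr X N).comp (Hom.snd L N))) (q.coprod g) (fun x v => by
        rw [Hom.add_app, map_add]
        simp only [Hom.comp_app, Hom.inl_app, Hom.inr_app, Hom.coprod_pair, map_zero, add_zero,
          zero_add]
        rw [hpq, Hom.coprod_app]) with ⟨r, hr⟩ | ⟨s, hs⟩
    · left
      refine ⟨(Hom.fst L N).comp (r.comp (Hom.inl X N)), fun x v => ?_⟩
      have := hr x ((Hom.inl L N).app x v)
      simp only [Hom.add_app, Hom.comp_app, Hom.fst_pair, Hom.snd_pair, Hom.inl_app,
        map_zero, add_zero] at this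
      rw [Hom.comp_app, Hom.comp_app, Hom.inl_app, this, Hom.fst_pair]
    · rcases hM.splitEpi_or (f := q) (g := g) (s := (Hom.fst X N).comp s)
        (t := (Hom.snd X N).comp s) (fun x v => by
          rw [Hom.comp_app, Hom.comp_app, ← Hom.coprod_app]; exact hs x v) with h' | h'
      · exact Or.inr h'
      · exact absurd h' hge

end QRep

namespace QRep

variable {L M N X Y Z C K : QRep k Q}

/-- Short exact sequences of representations. -/
structure Hom.SES (f : Hom L M) (g : Hom M N) : Prop where
  inj : f.Inj
  surj : g.Surj
  exact : Hom.ExactAt f g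

lemma Hom.SES.zero {f : Hom L M} {g : Hom M N} (h : Hom.SES f g) (x : Q) (v : L.V x) :
    g.app x (f.app x v) = 0 := (h.exact x _).2 ⟨v, rfl⟩

lemma Sub.ses (A : Sub M) : Hom.SES A.incl A.proj := ⟨A.incl_inj, A.proj_surj, A.exact⟩

lemma Hom.ses_ker {f : Hom L M} (hf : f.Surj) : Hom.SES f.ker.incl f :=
  ⟨f.ker.incl_inj, hf, fun _ v => ⟨fun h => ⟨f.ker.elt v h, rfl⟩, fun ⟨u, hu⟩ => hu ▸ u.2⟩⟩

lemma Hom.ses_range {f : Hom L M} (hf : f.Inj) : Hom.SES f f.range.proj :=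
  ⟨hf, f.range.proj_surj, fun _ _ => Sub.proj_eq_zero_iff _⟩

/-- The dual representation, over the opposite quiver. -/
def dual (M : QRep k Q) : QRep k Qᵒᵖ where
  V x := Module.Dual k (M.V x.unop)
  map α := (M.map α.unop).dualMap

/-- The predual of a representation of the opposite quiver. -/
def predual (M : QRep k Qᵒᵖ) : QRep k Q where
  V x := Module.Dual k (M.V (Opposite.op x))
  map α := (M.map α.op).dualMap

/-- The dual morphism. -/
def Hom.dual (f : Hom L M) : Hom M.dual L.dual where
  app x := (f.app x.unop).dualMap
  comm {x y} α ξ := by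
    apply LinearMap.ext
    intro v
    exact congrArg (DFunLike.coe (show Module.Dual k (M.V x.unop) from ξ)) (f.comm α.unop v).symm

lemma dual_sep {V : Type} [AddCommGroup V] [Module k V] {a b : V}
    (h : ∀ ξ : Module.Dual k V, ξ a = ξ b) : a = b := by
  rw [← sub_eq_zero, ← Module.forall_dual_apply_eq_zero_iff k]
  intro ξ
  rw [map_sub, h, sub_self]

/-- Evaluation of an element of the dual representation. -/
def ev {M : QRep k Q} {x : Qᵒᵖ} (ξ : M.dual.V x) (v : M.V x.unop) : k :=
  (show Module.Dual k (M.V x.unop) from ξ) v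

lemma ev_ext {x : Qᵒᵖ} {ξ η : M.dual.V x} (h : ∀ v, ev ξ v = ev η v) : ξ = η :=
  LinearMap.ext (f := (show Module.Dual k (M.V x.unop) from ξ)) h

lemma ev_sep {x : Qᵒᵖ} {v w : M.V x.unop} (h : ∀ ξ : M.dual.V x, ev ξ v = ev ξ w) : v = w :=
  dual_sep h

@[simp] lemma ev_dual (f : Hom L M) {x : Qᵒᵖ} (ξ : M.dual.V x) (v : L.V x.unop) :
    ev (f.dual.app x ξ) v = ev ξ (f.app x.unop v) := rfl
@[simp] lemma ev_map {x y : Qᵒᵖ} (α : x ⟶ y) (ξ : M.dual.V x) (v : M.V y.unop) :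
    ev (M.dual.map α ξ) v = ev ξ (M.map α.unop v) := rfl
@[simp] lemma ev_zero {x : Qᵒᵖ} (v : M.V x.unop) : ev (0 : M.dual.V x) v = 0 := rfl
@[simp] lemma ev_add {x : Qᵒᵖ} (ξ η : M.dual.V x) (v : M.V x.unop) :
    ev (ξ + η) v = ev ξ v + ev η v := rfl
@[simp] lemma ev_zero_right {x : Qᵒᵖ} (ξ : M.dual.V x) : ev ξ (0 : M.V x.unop) = 0 :=
  map_zero (show Module.Dual k (M.V x.unop) from ξ)

lemma Hom.exists_of_dual (φ : Hom M.dual L.dual) :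
    ∃ f : Hom L M, ∀ x ξ, f.dual.app x ξ = φ.app x ξ := by
  let F : ∀ x : Q, L.V x →ₗ[k] M.V x := fun x =>
    (Module.evalEquiv k (M.V x)).symm.toLinearMap ∘ₗ
      (LinearMap.dualMap (φ.app (Opposite.op x) :
        Module.Dual k (M.V x) →ₗ[k] Module.Dual k (L.V x))) ∘ₗ
      (Module.evalEquiv k (L.V x)).toLinearMap
  have hF : ∀ (x : Qᵒᵖ) (ξ : M.dual.V x) (v : L.V x.unop),
      ev ξ (F x.unop v) = ev (φ.app x ξ) v := by
    intro x ξ v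
    exact Module.apply_evalEquiv_symm_apply (R := k) (M := M.V x.unop)
      (show Module.Dual k (M.V x.unop) from ξ) _
  refine ⟨⟨F, fun {x y} α v => ?_⟩, fun x ξ => ev_ext fun v => ?_⟩
  · apply ev_sep (M := M) (x := Opposite.op y)
    intro ξ
    rw [hF (Opposite.op y) ξ (L.map α v)]
    have h1 := ev_map (M := M) α.op ξ (F x v)
    have h2 := ev_map (M := L) α.op (φ.app _ ξ) v
    have h3 := hF (Opposite.op x) (M.dual.map α.op ξ) v
    refine (h2.symm.trans ?_).trans (h3.symm.trans h1)
    rw [φ.comm]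
  · exact hF x ξ v

lemma exists_bij_dual (X : QRep k Qᵒᵖ) : ∃ f : Hom X X.predual.dual, f.Bij :=
  ⟨⟨fun x => (Module.evalEquiv k (X.V x)).toLinearMap, fun _ _ => rfl⟩,
    fun x => (Module.evalEquiv k (X.V x)).bijective⟩

lemma Indecomp.dual (hM : M.Indecomp) : M.dual.Indecomp := by
  refine ⟨?_, fun e he => ?_⟩
  · obtain ⟨x, v, hv⟩ := hM.1
    refine ⟨Opposite.op x, ?_⟩
    by_contra! h
    apply hv
    apply ev_sep (M := M) (x := Opposite.op x)
    intro ξ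
    rw [h ξ, ev_zero, ev_zero]
  · obtain ⟨f, hf⟩ := Hom.exists_of_dual e
    have h : ∀ x v, f.app x (f.app x v) = f.app x v := by
      intro x v
      apply ev_sep (M := M) (x := Opposite.op x)
      intro ξ
      have := congrArg (fun η => ev η v) (he (Opposite.op x) ξ)
      simp only [← hf, ev_dual] at this
      exact this
    rcases hM.2 f h with h0 | h1
    · left
      intro x ξ
      rw [← hf]
      apply ev_ext
      intro v
      rw [ev_dual, h0, ev_zero, ev_zero_right]
    · right
      intro x ξ
      rw [← hf]
      apply ev_ext
      intro v
      rw [ev_dual, h1]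

lemma Hom.Inj.dual {f : Hom L M} (hf : f.Inj) : f.dual.Surj := fun x =>
  LinearMap.dualMap_surjective_iff.2 (hf x.unop)

lemma Hom.Surj.dual {f : Hom L M} (hf : f.Surj) : f.dual.Inj := fun x =>
  LinearMap.dualMap_injective_iff.2 (hf x.unop)

lemma Hom.SES.dual {f : Hom L M} {g : Hom M N} (h : Hom.SES f g) : Hom.SES g.dual f.dual := by
  refine ⟨h.surj.dual, h.inj.dual, fun x ξ => ⟨fun h0 => ?_, ?_⟩⟩
  · have : (show Module.Dual k (M.V x.unop) from ξ) ∈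
        LinearMap.range (g.app x.unop).dualMap := by
      rw [LinearMap.range_dualMap_eq_dualAnnihilator_ker, Submodule.mem_dualAnnihilator]
      intro v hv
      obtain ⟨u, rfl⟩ := (h.exact _ _).1 hv
      exact congrArg (fun η => ev η u) h0
    exact this
  · rintro ⟨u, rfl⟩
    apply ev_ext
    intro v
    rw [ev_dual, ev_dual, h.zero, ev_zero, ev_zero_right]

lemma Hom.Irr.dual {f : Hom L M} (hf : f.Irr) : f.dual.Irr := by
  refine ⟨fun ⟨r, hr⟩ => ?_, fun ⟨s, hs⟩ => ?_, fun X g h hgh => ?_⟩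
  · obtain ⟨s, hs⟩ := Hom.exists_of_dual r
    refine hf.2.1 ⟨s, fun x v => ev_sep (M := M) (x := Opposite.op x) fun ξ => ?_⟩
    have := congrArg (fun η => ev η v) (hr (Opposite.op x) ξ)
    simp only [← hs, ev_dual] at this
    exact this
  · obtain ⟨r, hr⟩ := Hom.exists_of_dual s
    refine hf.1 ⟨r, fun x v => ev_sep (M := L) (x := Opposite.op x) fun ξ => ?_⟩
    have := congrArg (fun η => ev η v) (hs (Opposite.op x) ξ)
    simp only [← hr, ev_dual] at this
    exact this
  · obtain ⟨e, he⟩ := exists_bij_dual X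
    obtain ⟨e', h1, h2⟩ := he.exists_inv
    obtain ⟨h', hh'⟩ := Hom.exists_of_dual (h.comp e')
    obtain ⟨g', hg'⟩ := Hom.exists_of_dual (e.comp g)
    rcases hf.2.2 X.predual h' g' (fun x v => ev_sep (M := M) (x := Opposite.op x) fun ξ => by
      have := congrArg (fun η => ev η v) (hgh (Opposite.op x) ξ)
      simp only [ev_dual] at this
      refine Eq.trans ?_ this
      rw [← h1 _ (g.app _ ξ)]
      have h3 := hh' (Opposite.op x) (e.app _ (g.app _ ξ))
      have h4 := hg' (Opposite.op x) ξ
      rw [Hom.comp_app] at h3 h4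
      rw [← h3, ← h4]
      rfl) with ⟨r, hr⟩ | ⟨s, hs⟩
    · right
      refine ⟨e'.comp r.dual, fun x ξ => ?_⟩
      rw [Hom.comp_app]
      have h3 := hh' x (r.dual.app x ξ)
      rw [Hom.comp_app] at h3
      rw [← h3]
      apply ev_ext
      intro v
      rw [ev_dual, ev_dual, hr]
    · left
      refine ⟨s.dual.comp e, fun x ξ => ?_⟩
      have h3 := hg' x ξ
      rw [Hom.comp_app] at h3
      rw [Hom.comp_app, ← h3]
      apply ev_ext
      intro v
      rw [ev_dual, ev_dual, hs]

lemma Hom.Irr.ar_epi {f : Hom L M} (hf : f.Irr) {g : Hom K L} (h : Hom.SES g f) (φ : Hom K X) :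
    (∃ t : Hom L X, ∀ x v, t.app x (g.app x v) = φ.app x v) ∨
      (∃ t : Hom X L, ∀ x v, t.app x (φ.app x v) = g.app x v) := by
  rcases hf.dual.ar_mono h.dual.surj h.dual.exact φ.dual with ⟨t, ht⟩ | ⟨t, ht⟩
  · left
    obtain ⟨t', ht'⟩ := Hom.exists_of_dual t
    refine ⟨t', fun x v => ev_sep (M := X) (x := Opposite.op x) fun ξ => ?_⟩
    have := congrArg (fun η => ev η v) (ht (Opposite.op x) ξ)
    simp only [← ht', ev_dual] at this
    exact this
  · right
    obtain ⟨t', ht'⟩ := Hom.exists_of_dual t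
    refine ⟨t', fun x v => ev_sep (M := L) (x := Opposite.op x) fun ξ => ?_⟩
    have := congrArg (fun η => ev η v) (ht (Opposite.op x) ξ)
    simp only [← ht', ev_dual] at this
    exact this

end QRep

/-- Strong local finiteness as a class. -/
class SLF (Q : Type) [Quiver.{0} Q] : Prop where
  out : ∀ x : Q, Finite (Σ y : Q, x ⟶ y)
  inn : ∀ x : Q, Finite (Σ y : Q, y ⟶ x)
  path : ∀ x y : Q, Finite (Quiver.Path x y)

section PathOp

/-- The opposite of a path. -/
def pathOp {x : Q} : ∀ {y : Q}, Quiver.Path x y → Quiver.Path (Opposite.op y) (Opposite.op x)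
  | _, .nil => .nil
  | _, .cons p e => (Quiver.Hom.toPath e.op).comp (pathOp p)

/-- The path of which a path in the opposite quiver is the opposite. -/
def pathUnop {x : Qᵒᵖ} : ∀ {y : Qᵒᵖ}, Quiver.Path x y → Quiver.Path y.unop x.unop
  | _, .nil => .nil
  | _, .cons p e => (Quiver.Hom.toPath e.unop).comp (pathUnop p)

lemma pathOp_comp {x y z : Q} (p : Quiver.Path x y) (q : Quiver.Path y z) :
    pathOp (p.comp q) = (pathOp q).comp (pathOp p) := by
  induction q with
  | nil => simp [pathOp]
  | cons q e ih => simp [pathOp, ih]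

lemma pathUnop_comp {x y z : Qᵒᵖ} (p : Quiver.Path x y) (q : Quiver.Path y z) :
    pathUnop (p.comp q) = (pathUnop q).comp (pathUnop p) := by
  induction q with
  | nil => simp [pathUnop]
  | cons q e ih => simp [pathUnop, ih]

lemma pathUnop_pathOp {x y : Q} (p : Quiver.Path x y) : pathUnop (pathOp p) = p := by
  induction p with
  | nil => rfl
  | cons p e ih => rw [pathOp, pathUnop_comp, ih]; rfl

lemma pathOp_pathUnop {x y : Qᵒᵖ} (p : Quiver.Path x y) : pathOp (pathUnop p) = p := by
  induction p with
  | nil => rfl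
  | cons p e ih => rw [pathUnop, pathOp_comp, ih]; rfl

/-- Paths in the opposite quiver. -/
def pathOpEquiv (x y : Q) : Quiver.Path x y ≃ Quiver.Path (Opposite.op y) (Opposite.op x) :=
  ⟨pathOp, pathUnop, pathUnop_pathOp, pathOp_pathUnop⟩

end PathOp

instance [SLF Q] : SLF Qᵒᵖ where
  out x := by
    have := SLF.inn x.unop
    exact Finite.of_injective
      (fun a : (Σ y : Qᵒᵖ, x ⟶ y) => (⟨a.1.unop, a.2.unop⟩ : Σ y : Q, y ⟶ x.unop)) (by
        rintro ⟨⟨y⟩, a⟩ ⟨⟨z⟩, b⟩ h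
        obtain ⟨h1, h2⟩ := Sigma.mk.inj h
        change y = z at h1
        subst h1
        exact congrArg _ (Quiver.Hom.unop_inj (eq_of_heq h2)))
  inn x := by
    have := SLF.out x.unop
    exact Finite.of_injective
      (fun a : (Σ y : Qᵒᵖ, y ⟶ x) => (⟨a.1.unop, a.2.unop⟩ : Σ y : Q, x.unop ⟶ y)) (by
        rintro ⟨⟨y⟩, a⟩ ⟨⟨z⟩, b⟩ h
        obtain ⟨h1, h2⟩ := Sigma.mk.inj h
        change y = z at h1
        subst h1
        exact congrArg _ (Quiver.Hom.unop_inj (eq_of_heq h2)))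
  path x y := by
    have := SLF.path y.unop x.unop
    exact Finite.of_equiv _ (pathOpEquiv y.unop x.unop)

/-- The vertices reachable from a set. -/
def succs (A : Set Q) : Set Q := {y | ∃ a ∈ A, Nonempty (Quiver.Path a y)}

/-- The vertices from which a set can be reached. -/
def preds (A : Set Q) : Set Q := {y | ∃ a ∈ A, Nonempty (Quiver.Path y a)}

lemma subset_succs (A : Set Q) : A ⊆ succs A := fun a ha => ⟨a, ha, ⟨.nil⟩⟩
lemma subset_preds (A : Set Q) : A ⊆ preds A := fun a ha => ⟨a, ha, ⟨.nil⟩⟩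
lemma succs_mono {A B : Set Q} (h : A ⊆ B) : succs A ⊆ succs B :=
  fun _ ⟨a, ha, p⟩ => ⟨a, h ha, p⟩
lemma succs_step {A : Set Q} {x y : Q} (α : x ⟶ y) (h : x ∈ succs A) : y ∈ succs A :=
  let ⟨a, ha, ⟨p⟩⟩ := h
  ⟨a, ha, ⟨p.cons α⟩⟩
lemma preds_step {A : Set Q} {x y : Q} (α : x ⟶ y) (h : y ∈ preds A) : x ∈ preds A :=
  let ⟨a, ha, ⟨p⟩⟩ := h
  ⟨a, ha, ⟨(Quiver.Hom.toPath α).comp p⟩⟩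

lemma unop_mem_preds {A : Set Qᵒᵖ} {x : Qᵒᵖ} (h : x ∈ succs A) :
    x.unop ∈ preds (Opposite.op ⁻¹' A) :=
  let ⟨a, ha, ⟨p⟩⟩ := h
  ⟨a.unop, ha, ⟨pathUnop p⟩⟩

/-- The maximal length of a path from `A` to `y`. -/
noncomputable def ht (A : Set Q) (y : Q) : ℕ :=
  sSup {n | ∃ a ∈ A, ∃ p : Quiver.Path a y, p.length = n}

lemma path_lengths_finite [SLF Q] {A : Set Q} (hA : A.Finite) (y : Q) :
    {n | ∃ a ∈ A, ∃ p : Quiver.Path a y, p.length = n}.Finite := by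
  have : {n | ∃ a ∈ A, ∃ p : Quiver.Path a y, p.length = n} =
      ⋃ a ∈ A, Set.range fun p : Quiver.Path a y => p.length := by
    ext n; simp
  rw [this]
  refine hA.biUnion fun a _ => ?_
  have := SLF.path a y
  exact Set.finite_range _

lemma ht_lt [SLF Q] {A : Set Q} (hA : A.Finite) {x y : Q} (hx : x ∈ succs A) (α : x ⟶ y) :
    ht A x < ht A y := by
  obtain ⟨a, ha, ⟨p⟩⟩ := hx
  obtain ⟨b, hb, q, hq⟩ := Nat.sSup_mem (s := {n | ∃ a ∈ A, ∃ p : Quiver.Path a x, p.length = n})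
    ⟨_, a, ha, p, rfl⟩ (path_lengths_finite hA x).bddAbove
  have : ht A x + 1 ≤ ht A y :=
    le_csSup (path_lengths_finite hA y).bddAbove ⟨b, hb, q.cons α, by simp [hq, ht]⟩
  exact this

lemma wf_arr [SLF Q] {A : Set Q} (hA : A.Finite) :
    WellFounded fun x y : Q => x ∈ succs A ∧ Nonempty (x ⟶ y) :=
  Subrelation.wf (r := InvImage (· < ·) (ht A)) (fun ⟨hx, ⟨α⟩⟩ => ht_lt hA hx α)
    (InvImage.wf _ wellFounded_lt)

lemma preds_inter_succs_finite [SLF Q] {A B : Set Q} (hA : A.Finite) (hB : B.Finite) :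
    (preds B ∩ succs A).Finite := by
  have : preds B ∩ succs A ⊆ ⋃ a ∈ A, ⋃ b ∈ B, ⋃ p : Quiver.Path a b, {v | v ∈ p.vertices} := by
    rintro x ⟨⟨b, hb, ⟨q⟩⟩, ⟨a, ha, ⟨p⟩⟩⟩
    simp only [Set.mem_iUnion, Set.mem_ofPred_eq]
    exact ⟨a, ha, b, hb, p.comp q, by
      rw [Quiver.Path.vertices_comp]
      exact List.mem_append_right _ q.start_mem_vertices⟩
  refine Set.Finite.subset (hA.biUnion fun a _ => hB.biUnion fun b _ => ?_) this
  have := SLF.path a b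
  exact Set.finite_iUnion fun p => List.finite_toSet _

/-- The arrows ending at a vertex. -/
abbrev InArr (y : Q) : Type := Σ x : Q, x ⟶ y

noncomputable instance [SLF Q] (y : Q) : Fintype (InArr y) :=
  @Fintype.ofFinite _ (SLF.inn y)

namespace QRep

variable {L M N X Y Z C K R P : QRep k Q}

/-- A morphism can be built locally: if on each finite set of vertices there are linear maps
compatible with the arrows and satisfying given affine conditions, then there is a morphism
satisfying all the conditions. -/
theorem exists_hom_of_local (X Y : QRep k Q) {W : Q → Type} [∀ x, AddCommGroup (W x)]
    [∀ x, Module k (W x)] (T : ∀ x, (X.V x →ₗ[k] Y.V x) →ₗ[k] W x) (b : ∀ x, W x)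
    (h : ∀ G : Set Q, G.Finite → ∃ φ : ∀ x, X.V x →ₗ[k] Y.V x,
      (∀ x ∈ G, T x (φ x) = b x) ∧
      ∀ x ∈ G, ∀ y ∈ G, ∀ (α : x ⟶ y) (u : X.V x), φ y (X.map α u) = Y.map α (φ x u)) :
    ∃ φ : Hom X Y, ∀ x, T x (φ.app x) = b x := by
  obtain ⟨φ, hφ⟩ := exists_family_of_finite (k := k) (E := fun x => X.V x →ₗ[k] Y.V x)
    (I := (Σ x, Module.Dual k (W x)) ⊕
      Σ (x y : Q) (_ : x ⟶ y) (_ : X.V x), Module.Dual k (Y.V y))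
    (Sum.elim (fun i => i.1) (fun i => i.2.1)) (Sum.elim (fun i => i.1) (fun i => i.1))
    (Sum.rec (fun i => i.2 ∘ₗ T i.1)
      (fun i => i.2.2.2.2 ∘ₗ LinearMap.applyₗ (X.map i.2.2.1 i.2.2.2.1)))
    (Sum.rec (fun _ => 0)
      (fun i => (i.2.2.2.2 ∘ₗ Y.map i.2.2.1) ∘ₗ LinearMap.applyₗ i.2.2.2.1))
    (Sum.elim (fun i => i.2 (b i.1)) (fun _ => 0)) (by
      intro G hG
      obtain ⟨φ, h1, h2⟩ := h G hG
      refine ⟨φ, ?_⟩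
      rintro (⟨x, ω⟩ | ⟨x, y, α, u, η⟩) hx hy
      · change ω (T x (φ x)) - 0 = ω (b x)
        rw [h1 x hx, sub_zero]
      · change η (φ y (X.map α u)) - η (Y.map α (φ x u)) = 0
        rw [h2 x hy y hx, sub_self])
  refine ⟨⟨φ, fun {x y} α u => dual_sep (k := k) fun η => ?_⟩,
    fun x => dual_sep (k := k) fun ω => ?_⟩
  · exact sub_eq_zero.1 (hφ (Sum.inr ⟨x, y, α, u, η⟩))
  · have h0 : ω (T x (φ x)) - 0 = ω (b x) := hφ (Sum.inl ⟨x, ω⟩)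
    rwa [sub_zero] at h0

end QRep

namespace QRep

variable {L M N X Y Z C K R P : QRep k Q}

/-- The map induced on the sources of the arrows ending at a vertex. -/
def Hom.pi (f : Hom L M) (y : Q) : (∀ α : InArr y, L.V α.1) →ₗ[k] (∀ α : InArr y, M.V α.1) :=
  LinearMap.pi fun α => f.app α.1 ∘ₗ LinearMap.proj α

@[simp] lemma Hom.pi_apply (f : Hom L M) {y : Q} (v : ∀ α : InArr y, L.V α.1) (α : InArr y) :
    f.pi y v α = f.app α.1 (v α) := rfl

lemma Hom.Inj.pi {f : Hom L M} (hf : f.Inj) (y : Q) : Function.Injective (f.pi y) :=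
  fun _ _ h => funext fun α => hf _ (congrFun h α)

lemma Hom.Surj.pi {f : Hom L M} (hf : f.Surj) (y : Q) : Function.Surjective (f.pi y) := by
  intro v
  choose u hu using fun α : InArr y => hf α.1 (v α)
  exact ⟨u, funext hu⟩

lemma Hom.SES.pi_zero {f : Hom L M} {g : Hom M N} (h : Hom.SES f g) (y : Q)
    (v : ∀ α : InArr y, L.V α.1) : g.pi y (f.pi y v) = 0 :=
  funext fun α => h.zero _ (v α)

lemma Hom.SES.pi_exact {f : Hom L M} {g : Hom M N} (h : Hom.SES f g) (y : Q)
    (v : ∀ α : InArr y, M.V α.1) (hv : g.pi y v = 0) : ∃ u, f.pi y u = v := by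
  choose u hu using fun α : InArr y => (h.exact α.1 (v α)).1 (congrFun hv α)
  exact ⟨u, funext hu⟩

section InArrows

variable [SLF Q]

/-- The sum of the maps along the arrows ending at a vertex. -/
noncomputable def cmap (M : QRep k Q) (y : Q) : (∀ α : InArr y, M.V α.1) →ₗ[k] M.V y :=
  ∑ α : InArr y, M.map α.2 ∘ₗ LinearMap.proj α

lemma cmap_apply {y : Q} (v : ∀ α : InArr y, M.V α.1) :
    M.cmap y v = ∑ α : InArr y, M.map α.2 (v α) := by
  simp [cmap]

lemma cmap_single [∀ y : Q, DecidableEq (InArr y)] {y : Q} (α : InArr y) (u : M.V α.1) :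
    M.cmap y (Pi.single α u) = M.map α.2 u := by
  rw [cmap_apply, Finset.sum_eq_single α]
  · rw [Pi.single_eq_same]
  · intro β _ h
    rw [Pi.single_eq_of_ne h, map_zero]
  · intro h
    exact absurd (Finset.mem_univ _) h

lemma Hom.app_cmap (f : Hom L M) {y : Q} (v : ∀ α : InArr y, L.V α.1) :
    f.app y (L.cmap y v) = M.cmap y (f.pi y v) := by
  simp [cmap_apply, f.comm]

lemma Hom.SES.cmap_inj_mid {f : Hom L M} {g : Hom M N} (h : Hom.SES f g) {y : Q}
    (h₁ : Function.Injective (L.cmap y)) (h₂ : Function.Injective (N.cmap y)) :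
    Function.Injective (M.cmap y) :=
  five_mid_inj (h.inj y) (h.pi_exact y) (fun v => (f.app_cmap v).symm)
    (fun v => (g.app_cmap v).symm) h₁ h₂

lemma Hom.SES.cmap_surj_mid {f : Hom L M} {g : Hom M N} (h : Hom.SES f g) {y : Q}
    (h₁ : Function.Surjective (L.cmap y)) (h₂ : Function.Surjective (N.cmap y)) :
    Function.Surjective (M.cmap y) :=
  five_mid_surj (h.surj.pi y) (fun v => (h.exact y v).1) (fun v => (f.app_cmap v).symm)
    (fun v => (g.app_cmap v).symm) h₁ h₂

lemma Hom.SES.cmap_inj_right {f : Hom L M} {g : Hom M N} (h : Hom.SES f g) {y : Q}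
    (h₁ : Function.Surjective (L.cmap y)) (h₂ : Function.Injective (M.cmap y)) :
    Function.Injective (N.cmap y) :=
  five_right_inj (h.surj.pi y) (h.pi_zero y) (fun v => (h.exact y v).1)
    (fun v => (f.app_cmap v).symm) (fun v => (g.app_cmap v).symm) h₁ h₂

lemma Hom.Surj.cmap_surj {g : Hom M N} (h : g.Surj) {y : Q}
    (h₂ : Function.Surjective (M.cmap y)) : Function.Surjective (N.cmap y) :=
  five_right_surj (h y) (fun v => (g.app_cmap v).symm) h₂

lemma Hom.Inj.cmap_inj {f : Hom L M} (h : f.Inj) {y : Q}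
    (h₂ : Function.Injective (M.cmap y)) : Function.Injective (L.cmap y) :=
  five_left_inj (h.pi y) (fun v => (f.app_cmap v).symm) h₂

lemma Hom.SES.cmap_surj_left {f : Hom L M} {g : Hom M N} (h : Hom.SES f g) {y : Q}
    (h₁ : Function.Surjective (M.cmap y)) (h₂ : Function.Injective (N.cmap y)) :
    Function.Surjective (L.cmap y) :=
  five_left_surj (h.inj y) (h.pi_exact y) (h.zero y) (fun v => (f.app_cmap v).symm)
    (fun v => (g.app_cmap v).symm) h₁ h₂

end InArrows

/-- The support is contained in the set of successors of `A`. -/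
def Bdd (A : Set Q) (M : QRep k Q) : Prop := ∀ x (v : M.V x), v ≠ 0 → x ∈ succs A

lemma Bdd.eq_zero {A : Set Q} (h : Bdd A M) {x : Q} (hx : x ∉ succs A) (v : M.V x) : v = 0 :=
  by_contra fun hv => hx (h x v hv)

lemma Bdd.mono {A B : Set Q} (h : Bdd A M) (hAB : A ⊆ B) : Bdd B M :=
  fun x v hv => succs_mono hAB (h x v hv)

lemma Bdd.of_inj {A : Set Q} {f : Hom L M} (hf : f.Inj) (h : Bdd A M) : Bdd A L :=
  fun x v hv => h x (f.app x v) fun h0 => hv (hf x (h0.trans (map_zero _).symm))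

lemma Bdd.of_surj {A : Set Q} {f : Hom L M} (hf : f.Surj) (h : Bdd A L) : Bdd A M := by
  intro x v hv
  obtain ⟨u, rfl⟩ := hf x v
  exact h x u fun h0 => hv (by rw [h0, map_zero])

lemma Bdd.mid {A : Set Q} {f : Hom L M} {g : Hom M N} (h : Hom.SES f g) (h₁ : Bdd A L)
    (h₂ : Bdd A N) : Bdd A M := by
  intro x v hv
  by_cases h0 : g.app x v = 0
  · obtain ⟨u, rfl⟩ := (h.exact x v).1 h0
    exact h₁ x u fun h0 => hv (by rw [h0, map_zero])
  · exact h₂ x _ h0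

section FP

variable [SLF Q]

/-- A pointwise form of finite presentation. -/
def FPc (M : QRep k Q) : Prop :=
  ∃ A : Set Q, A.Finite ∧ Bdd A M ∧ ∃ G : Set Q, G.Finite ∧ ∀ y ∉ G,
    Function.Bijective (M.cmap y)

/-- A pointwise form of finite co-presentation. -/
def FCPc (M : QRep k Q) : Prop := FPc M.dual

lemma FPc.mid {f : Hom L M} {g : Hom M N} (h : Hom.SES f g) (h₁ : FPc L) (h₂ : FPc N) :
    FPc M := by
  obtain ⟨A, hA, hAL, G, hG, hGL⟩ := h₁
  obtain ⟨B, hB, hBN, H, hH, hHN⟩ := h₂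
  refine ⟨A ∪ B, hA.union hB, Bdd.mid h (hAL.mono Set.subset_union_left)
    (hBN.mono Set.subset_union_right), G ∪ H, hG.union hH, fun y hy => ?_⟩
  have hL := hGL y fun h => hy (Or.inl h)
  have hN := hHN y fun h => hy (Or.inr h)
  exact ⟨h.cmap_inj_mid hL.1 hN.1, h.cmap_surj_mid hL.2 hN.2⟩

lemma FPc.right {f : Hom L M} {g : Hom M N} (h : Hom.SES f g) (h₁ : FPc L) (h₂ : FPc M) :
    FPc N := by
  obtain ⟨A, hA, hAL, G, hG, hGL⟩ := h₁
  obtain ⟨B, hB, hBN, H, hH, hHN⟩ := h₂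
  refine ⟨B, hB, hBN.of_surj h.surj, G ∪ H, hG.union hH, fun y hy => ?_⟩
  have hL := hGL y fun h => hy (Or.inl h)
  have hN := hHN y fun h => hy (Or.inr h)
  exact ⟨h.cmap_inj_right hL.2 hN.1, h.surj.cmap_surj hN.2⟩

lemma FPc.left {f : Hom L M} {g : Hom M N} (h : Hom.SES f g) (h₁ : FPc M) (h₂ : FPc N) :
    FPc L := by
  obtain ⟨A, hA, hAL, G, hG, hGL⟩ := h₁
  obtain ⟨B, hB, hBN, H, hH, hHN⟩ := h₂
  refine ⟨A, hA, hAL.of_inj h.inj, G ∪ H, hG.union hH, fun y hy => ?_⟩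
  have hL := hGL y fun h => hy (Or.inl h)
  have hN := hHN y fun h => hy (Or.inr h)
  exact ⟨h.inj.cmap_inj hL.1, h.cmap_surj_left hL.2 hN.1⟩

lemma FPc.of_decomp {ι : Type} [Fintype ι] {T : ι → QRep k Q} (i : ∀ j, Hom (T j) M)
    (p : ∀ j, Hom M (T j)) (hip : ∀ x v, ∑ j, (i j).app x ((p j).app x v) = v)
    (h : ∀ j, FPc (T j)) : FPc M := by
  choose A hA hAT G hG hGT using h
  refine ⟨⋃ j, A j, Set.finite_iUnion hA, ?_, ⋃ j, G j, Set.finite_iUnion hG, fun y hy => ?_⟩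
  · intro x v hv
    by_contra hx
    apply hv
    rw [← hip x v]
    refine Finset.sum_eq_zero fun j _ => ?_
    rw [(hAT j).eq_zero (fun h => hx (succs_mono (Set.subset_iUnion A j) h)) ((p j).app x v),
      map_zero]
  · have hj := fun j => hGT j y fun h => hy (Set.mem_iUnion.2 ⟨j, h⟩)
    constructor
    · rw [injective_iff_map_eq_zero]
      intro v hv
      funext α
      rw [← hip α.1 (v α)]
      refine Finset.sum_eq_zero fun j _ => ?_
      have : (p j).pi y v = 0 := (hj j).1 (by rw [← Hom.app_cmap, hv, map_zero, map_zero])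
      rw [← Hom.pi_apply, this]
      exact map_zero _
    · intro w
      choose u hu using fun j => (hj j).2 ((p j).app y w)
      refine ⟨∑ j, (i j).pi y (u j), ?_⟩
      rw [map_sum]
      simp only [← Hom.app_cmap, hu, hip]

lemma FPc.of_bij {f : Hom L M} (hf : f.Bij) (h : FPc L) : FPc M := by
  obtain ⟨g, -, hg⟩ := hf.exists_inv
  exact FPc.of_decomp (ι := Unit) (fun _ => f) (fun _ => g) (by simpa using hg) fun _ => h

lemma targets_finite {S : Set Q} (hS : S.Finite) : {y | ∃ x ∈ S, Nonempty (x ⟶ y)}.Finite := by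
  have : {y | ∃ x ∈ S, Nonempty (x ⟶ y)} = ⋃ x ∈ S, Set.range fun i : Σ y : Q, x ⟶ y => i.1 := by
    ext y
    simp only [Set.mem_iUnion, Set.mem_range]
    exact ⟨fun ⟨x, hx, ⟨α⟩⟩ => ⟨x, hx, ⟨y, α⟩, rfl⟩, fun ⟨x, hx, ⟨z, α⟩, h⟩ =>
      ⟨x, hx, by cases h; exact ⟨α⟩⟩⟩
  rw [this]
  refine hS.biUnion fun x _ => ?_
  have := SLF.out x
  exact Set.finite_range _

lemma FPc.of_finite {S : Set Q} (hS : S.Finite) (h : ∀ x ∉ S, ∀ v : M.V x, v = 0) : FPc M := by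
  refine ⟨S, hS, fun x v hv => subset_succs _ (by_contra fun hx => hv (h x hx v)),
    S ∪ {y | ∃ x ∈ S, Nonempty (x ⟶ y)}, hS.union (targets_finite hS), fun y hy => ⟨?_, ?_⟩⟩
  · intro v w _
    funext α
    have hα : α.1 ∉ S := fun hα => hy (Or.inr ⟨α.1, hα, ⟨α.2⟩⟩)
    rw [h _ hα (v α), h _ hα (w α)]
  · exact fun v => ⟨0, by rw [map_zero, h y (fun h => hy (Or.inl h)) v]⟩

lemma FPc.of_zero (h : ∀ x (v : M.V x), v = 0) : FPc M :=
  FPc.of_finite Set.finite_empty fun x _ => h x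

end FP

/-- The subrepresentation generated by the restriction of `K` to `H`. -/
def gen (H : Set Q) (K : Sub P) : Sub P where
  S x := ⨅ N : {N : Sub P // ∀ y ∈ H, K.S y ≤ N.S y}, N.1.S x
  closed α v hv := by
    rw [Submodule.mem_iInf] at *
    exact fun N => N.1.closed α v (hv N)

section Gen

variable {H G : Set Q} {K : Sub P}

lemma gen_min {N : Sub P} (h : ∀ y ∈ H, K.S y ≤ N.S y) (x : Q) : (gen H K).S x ≤ N.S x :=
  iInf_le (fun N : {N : Sub P // ∀ y ∈ H, K.S y ≤ N.S y} => N.1.S x) ⟨N, h⟩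

lemma le_gen {y : Q} (hy : y ∈ H) : K.S y ≤ (gen H K).S y := le_iInf fun N => N.2 y hy

lemma gen_le (x : Q) : (gen H K).S x ≤ K.S x := gen_min (fun _ _ => le_rfl) x

lemma gen_bdd : Bdd H (gen H K).rep := by
  classical
  intro y v hv
  by_contra hy
  let N : Sub P := ⟨fun x => if x ∈ succs H then ⊤ else ⊥, fun {a b} α v hv => by
    by_cases ha : a ∈ succs H
    · rw [if_pos (succs_step α ha)]; trivial
    · rw [if_neg ha, Submodule.mem_bot] at hv
      rw [hv, map_zero]; exact zero_mem _⟩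
  have h1 : (gen H K).S y ≤ N.S y :=
    gen_min (fun z hz => by simp only [N, if_pos (subset_succs _ hz)]; exact le_top) y
  simp only [N, if_neg hy] at h1
  exact hv (Subtype.ext ((Submodule.mem_bot k).1 (h1 ((gen H K).incl_mem v))))

variable [SLF Q]

lemma gen_range {y : Q} (hy : y ∉ H) {v : P.V y} (hv : v ∈ (gen H K).S y) :
    ∃ u : ∀ α : InArr y, P.V α.1, (∀ α, u α ∈ (gen H K).S α.1) ∧ P.cmap y u = v := by
  classical
  let N : Sub P := ⟨fun x => (gen H K).S x ⊓ if x ∈ H then ⊤ else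
      (Submodule.pi Set.univ fun α : InArr x => (gen H K).S α.1).map (P.cmap x),
    fun {a b} α v hv => by
      refine ⟨(gen H K).closed α v hv.1, ?_⟩
      by_cases hb : b ∈ H
      · rw [if_pos hb]; trivial
      · rw [if_neg hb]
        refine ⟨Pi.single (⟨a, α⟩ : InArr b) v, fun β _ => ?_, cmap_single (⟨a, α⟩ : InArr b) v⟩
        by_cases hβ : β = ⟨a, α⟩
        · subst hβ; rw [Pi.single_eq_same]; exact hv.1
        · rw [Pi.single_eq_of_ne hβ]; exact zero_mem _⟩
  have h1 : (gen H K).S y ≤ N.S y :=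
    gen_min (fun z hz => le_inf (le_gen hz) (by rw [if_pos hz]; exact le_top)) y
  have h2 := (h1 hv).2
  rw [if_neg hy] at h2
  obtain ⟨u, hu, rfl⟩ := h2
  exact ⟨u, fun α => hu α (Set.mem_univ _), rfl⟩

/-- The whole representation, as a subrepresentation. -/
def Sub.top (P : QRep k Q) : Sub P := ⟨fun _ => ⊤, fun _ _ _ => trivial⟩

lemma gen_top_of_surj {A : Set Q} (hA : A.Finite) (hP : Bdd A P)
    (h : ∀ y ∉ H, Function.Surjective (P.cmap y)) (y : Q) (v : P.V y) :
    v ∈ (gen H (Sub.top P)).S y := by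
  classical
  induction y using (wf_arr hA).induction with
  | _ y ih =>
    by_cases hy : y ∈ H
    · exact le_gen hy trivial
    · obtain ⟨u, rfl⟩ := h y hy v
      rw [cmap_apply]
      refine Submodule.sum_mem _ fun α _ => (gen H (Sub.top P)).closed α.2 _ ?_
      by_cases hα : α.1 ∈ succs A
      · exact ih α.1 ⟨hα, ⟨α.2⟩⟩ (u α)
      · rw [hP.eq_zero hα (u α)]; exact zero_mem _

/-- A bounded representation with injective sums of incoming maps is projective. -/
theorem Bdd.exists_lift {A : Set Q} (hA : A.Finite) (hR : Bdd A R)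
    (hc : ∀ y, Function.Injective (R.cmap y)) {e : Hom L N} (he : e.Surj) (h : Hom R N) :
    ∃ s : Hom R L, ∀ x v, e.app x (s.app x v) = h.app x v := by
  classical
  obtain ⟨φ, hφ⟩ := exists_rec_family (C := fun x => R.V x →ₗ[k] L.V x) (wf_arr hA)
    (fun x φ => ∀ v, e.app x (φ v) = h.app x v)
    (fun x y φ ψ => ∀ (α : x ⟶ y) u, ψ (R.map α u) = L.map α (φ u)) (by
      intro y φ hφ
      obtain ⟨s, hs, hs'⟩ := exists_lift_extending (e.app y) (he y) (h.app y) (R.cmap y) (hc y)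
        (∑ α : InArr y, L.map α.2 ∘ₗ φ α.1 ∘ₗ LinearMap.proj α) (by
          intro w
          rw [h.app_cmap, cmap_apply, LinearMap.sum_apply, map_sum]
          refine Finset.sum_congr rfl fun α _ => ?_
          simp only [LinearMap.comp_apply, LinearMap.proj_apply, Hom.pi_apply]
          rw [e.comm]
          by_cases hα : α.1 ∈ succs A
          · rw [hφ α.1 ⟨hα, ⟨α.2⟩⟩]
          · rw [hR.eq_zero hα (w α)]; simp only [map_zero])
      refine ⟨s, hs, fun x hx α u => ?_⟩
      have := hs' (Pi.single (⟨x, α⟩ : InArr y) u)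
      rw [cmap_single (⟨x, α⟩ : InArr y) u] at this
      rw [this, LinearMap.sum_apply, Finset.sum_eq_single (⟨x, α⟩ : InArr y)]
      · simp only [LinearMap.comp_apply, LinearMap.proj_apply, Pi.single_eq_same]
      · intro β _ hβ
        simp only [LinearMap.comp_apply, LinearMap.proj_apply, Pi.single_eq_of_ne hβ, map_zero]
      · intro h0
        exact absurd (Finset.mem_univ _) h0)
  refine ⟨⟨φ, fun {x y} α u => ?_⟩, fun x => (hφ x).1⟩
  by_cases hx : x ∈ succs A
  · exact (hφ y).2 x ⟨hx, ⟨α⟩⟩ α u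
  · rw [hR.eq_zero hx u]; simp only [map_zero]

lemma cmap_inj_of_gen (hc : ∀ y ∉ H, Function.Injective (P.cmap y))
    (hH : ∀ x y, (x ⟶ y) → y ∈ H → x ∈ H ∨ ∀ v : P.V x, v = 0)
    {i : Hom X P} (hi : ∀ x v, i.app x v ∈ K.S x) {p : Hom X R} (hp : p.Surj)
    (hip : ∀ x v, p.app x v = 0 ↔ i.app x v ∈ (gen H K).S x) (y : Q) :
    Function.Injective (R.cmap y) := by
  rw [injective_iff_map_eq_zero]
  intro w hw
  obtain ⟨v, rfl⟩ := hp.pi y w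
  rw [← Hom.app_cmap, hip, Hom.app_cmap] at hw
  funext α
  refine (hip _ (v α)).2 ?_
  by_cases hy : y ∈ H
  · rcases hH α.1 y α.2 hy with h | h
    · exact le_gen h (hi _ _)
    · rw [h (i.app α.1 (v α))]; exact zero_mem _
  · obtain ⟨u, hu, hu'⟩ := gen_range hy hw
    have := congrFun (hc y hy hu') α
    rw [Hom.pi_apply] at this
    rw [← this]
    exact hu α

/-- The predecessors of a finite set within the successors of another one. -/
lemma exists_pred_closed {A G : Set Q} (hA : A.Finite) (hG : G.Finite) :
    ∃ H : Set Q, H.Finite ∧ G ⊆ H ∧ ∀ x y, (x ⟶ y) → y ∈ H → x ∈ H ∨ x ∉ succs A := by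
  refine ⟨preds G ∩ succs A ∪ G, (preds_inter_succs_finite hA hG).union hG,
    Set.subset_union_right, fun x y α hy => ?_⟩
  have hy' : y ∈ preds G := hy.elim (fun h => h.1) fun h => subset_preds _ h
  by_cases hx : x ∈ succs A
  · exact Or.inl (Or.inl ⟨preds_step α hy', hx⟩)
  · exact Or.inr hx

theorem Indecomp.fpc (hL : L.Indecomp) {A : Set Q} (hA : A.Finite) (hLA : Bdd A L) {G : Set Q}
    (hG : G.Finite) (hc : ∀ y ∉ G, Function.Injective (L.cmap y)) : FPc L := by
  obtain ⟨x₀, v₀, hv₀⟩ := hL.1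
  obtain ⟨H, hH, hGH, hpred⟩ := exists_pred_closed hA (hG.union (Set.finite_singleton x₀))
  have hc' : ∀ y ∉ H, Function.Injective (L.cmap y) :=
    fun y hy => hc y fun h => hy (hGH (Or.inl h))
  let W := gen H (Sub.top L)
  have hR : ∀ y, Function.Injective (W.quot.cmap y) :=
    cmap_inj_of_gen hc' (fun x y α hy => (hpred x y α hy).imp_right fun h v => hLA.eq_zero h v)
      (i := Hom.id L) (K := Sub.top L) (fun _ _ => trivial) W.proj_surj
      (fun _ _ => W.proj_eq_zero_iff)
  obtain ⟨s, hs⟩ := (hLA.of_surj W.proj_surj).exists_lift hA hR W.proj_surj (Hom.id _)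
  have hs' : ∀ x v, W.proj.app x (s.app x v) = v := hs
  rcases hL.2 (s.comp W.proj) (fun x v => by simp [hs']) with h | h
  · have htop : ∀ y v, v ∈ W.S y := by
      intro y v
      rw [← W.proj_eq_zero_iff, ← hs' y (W.proj.app y v)]
      have := h y v
      rw [Hom.comp_app] at this
      rw [this, map_zero]
    refine ⟨A, hA, hLA, H, hH, fun y hy => ⟨hc' y hy, fun v => ?_⟩⟩
    obtain ⟨u, -, hu⟩ := gen_range hy (htop y v)
    exact ⟨u, hu⟩
  · exfalso
    apply hv₀
    rw [← h x₀ v₀, Hom.comp_app, W.proj_eq_zero_iff.2 (le_gen (hGH (Or.inr rfl)) trivial),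
      map_zero]

end Gen

end QRep

namespace QRep

variable {L M N X Y Z C K R P : QRep k Q}

/-- The map of a representation along a path. -/
def pmap (M : QRep k Q) {x : Q} : ∀ {y : Q}, Quiver.Path x y → M.V x →ₗ[k] M.V y
  | _, .nil => LinearMap.id
  | _, .cons p α => M.map α ∘ₗ M.pmap p

section Free

variable [SLF Q] {ι : Type} [Finite ι]

instance (x y : Q) : Finite (Quiver.Path x y) := SLF.path x y

/-- The free representation on finitely many generators placed at the given vertices. -/
noncomputable def free (k : Type) [Field k] (a : ι → Q) : QRep k Q where
  V x := (Σ i, Quiver.Path (a i) x) →₀ k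
  map α := Finsupp.lmapDomain k k fun p => ⟨p.1, p.2.cons α⟩

/-- The basis vector of a free representation given by a path. -/
noncomputable def fsingle {a : ι → Q} {x : Q} (i : ι) (p : Quiver.Path (a i) x) :
    (free k a).V x := Finsupp.single (⟨i, p⟩ : Σ i, Quiver.Path (a i) x) (1 : k)

/-- The coefficient at a path. -/
noncomputable def fcoeff {a : ι → Q} {x : Q} (v : (free k a).V x) (i : ι)
    (p : Quiver.Path (a i) x) : k :=
  (show (Σ i, Quiver.Path (a i) x) →₀ k from v) ⟨i, p⟩

lemma free_ext {a : ι → Q} {x : Q} {v w : (free k a).V x} (h : ∀ i p, fcoeff v i p = fcoeff w i p) :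
    v = w := by
  refine Finsupp.ext (f := (show (Σ i, Quiver.Path (a i) x) →₀ k from v)) ?_
  rintro ⟨i, p⟩
  exact h i p

lemma free_map_single {a : ι → Q} {x y : Q} (α : x ⟶ y) (i : ι) (p : Quiver.Path (a i) x) :
    (free k a).map α (fsingle i p) = fsingle i (p.cons α) :=
  Finsupp.mapDomain_single

lemma free_mem_of_single {a : ι → Q} {x : Q} (S : Submodule k ((free k a).V x))
    (h : ∀ i p, fsingle i p ∈ S) (v : (free k a).V x) : v ∈ S := by
  refine Finsupp.induction_linear (motive := fun v => v ∈ S)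
    (show (Σ i, Quiver.Path (a i) x) →₀ k from v) (zero_mem S) (fun v w hv hw => S.add_mem hv hw) ?_
  rintro ⟨i, p⟩ c
  have h2 : Finsupp.single (⟨i, p⟩ : Σ i, Quiver.Path (a i) x) c =
      c • Finsupp.single (⟨i, p⟩ : Σ i, Quiver.Path (a i) x) (1 : k) := by
    rw [Finsupp.smul_single, smul_eq_mul, mul_one]
  exact Set.mem_of_eq_of_mem (s := (S : Set ((free k a).V x))) h2 (S.smul_mem c (h i p))

/-- The components of the morphism from a free representation given by a choice of vectors. -/
noncomputable def freeApp {a : ι → Q} (n : ∀ i, M.V (a i)) (x : Q) :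
    (free k a).V x →ₗ[k] M.V x :=
  Finsupp.linearCombination k fun p : Σ i, Quiver.Path (a i) x => M.pmap p.2 (n p.1)

lemma freeApp_single {a : ι → Q} (n : ∀ i, M.V (a i)) {x : Q} (i : ι) (p : Quiver.Path (a i) x) :
    freeApp n x (fsingle i p) = M.pmap p (n i) := by
  change Finsupp.linearCombination k _ (Finsupp.single _ _) = _
  rw [Finsupp.linearCombination_single, one_smul]

/-- The morphism from a free representation given by a choice of vectors. -/
noncomputable def freeHom {a : ι → Q} (n : ∀ i, M.V (a i)) : Hom (free k a) M where
  app := freeApp n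
  comm {x y} α v := by
    refine free_mem_of_single
      (LinearMap.eqLocus (freeApp n y ∘ₗ (free k a).map α) (M.map α ∘ₗ freeApp n x))
      (fun i p => ?_) v
    rw [LinearMap.mem_eqLocus, LinearMap.comp_apply, LinearMap.comp_apply, free_map_single,
      freeApp_single, freeApp_single]
    rfl

lemma freeHom_single {a : ι → Q} (n : ∀ i, M.V (a i)) {x : Q} (i : ι) (p : Quiver.Path (a i) x) :
    (freeHom n).app x (fsingle i p) = M.pmap p (n i) := freeApp_single n i p

lemma free_bdd {a : ι → Q} {A : Set Q} (h : ∀ i, a i ∈ A) : Bdd A (free k a) := by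
  intro x v hv
  by_contra hx
  exact hv (free_ext fun i p => absurd ⟨a i, h i, ⟨p⟩⟩ hx)

lemma fcoeff_cmap {a : ι → Q} {y : Q} (v : ∀ α : InArr y, (free k a).V α.1) (α : InArr y) (i : ι)
    (p : Quiver.Path (a i) α.1) :
    fcoeff ((free k a).cmap y v) i (p.cons α.2) = fcoeff (v α) i p := by
  rw [cmap_apply]
  change (∑ β : InArr y, Finsupp.mapDomain
    (fun p : Σ i, Quiver.Path (a i) β.1 => (⟨p.1, p.2.cons β.2⟩ : Σ i, Quiver.Path (a i) y))
    (show (Σ i, Quiver.Path (a i) β.1) →₀ k from v β)) ⟨i, p.cons α.2⟩ = _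
  rw [Finsupp.finsetSum_apply, Finset.sum_eq_single α]
  · refine Finsupp.mapDomain_apply (f := fun p : Σ i, Quiver.Path (a i) α.1 =>
      (⟨p.1, p.2.cons α.2⟩ : Σ i, Quiver.Path (a i) y)) ?_ _ ⟨i, p⟩
    rintro ⟨i, p⟩ ⟨j, q⟩ h
    simp only [Sigma.mk.injEq] at h
    obtain ⟨rfl, h⟩ := h
    rw [heq_eq_eq, Quiver.Path.cons.injEq] at h
    rw [eq_of_heq h.2.1]
  · intro β _ hβ
    refine Finsupp.mapDomain_of_notMem_range _ _ ?_
    rintro ⟨⟨j, q⟩, h⟩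
    apply hβ
    simp only [Sigma.mk.injEq] at h
    obtain ⟨rfl, h⟩ := h
    rw [heq_eq_eq, Quiver.Path.cons.injEq] at h
    exact Sigma.ext h.1 h.2.2
  · intro h
    exact absurd (Finset.mem_univ _) h

lemma free_cmap_inj {a : ι → Q} (y : Q) : Function.Injective ((free k a).cmap y) := by
  intro v w h
  funext α
  refine free_ext fun i p => ?_
  rw [← fcoeff_cmap, h, fcoeff_cmap]

lemma free_cmap_surj {a : ι → Q} {y : Q} (h : ∀ i, a i ≠ y) :
    Function.Surjective ((free k a).cmap y) := by
  classical
  intro v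
  refine free_mem_of_single (LinearMap.range ((free k a).cmap y)) (fun i p => ?_) v
  cases p with
  | nil => exact absurd rfl (h i)
  | cons p α =>
    refine ⟨Pi.single ⟨_, α⟩ (fsingle i p), ?_⟩
    rw [cmap_single, free_map_single]

lemma free_fpc (a : ι → Q) : FPc (free k a) :=
  ⟨Set.range a, Set.finite_range a, free_bdd fun i => ⟨i, rfl⟩, Set.range a, Set.finite_range a,
    fun y hy => ⟨free_cmap_inj y, free_cmap_surj fun i h => hy ⟨i, h⟩⟩⟩

lemma exists_free_surj {G : Set Q} (hG : G.Finite) (h : ∀ y v, v ∈ (gen G (Sub.top M)).S y) :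
    ∃ (r : ℕ) (a : Fin r → Q) (n : ∀ i, M.V (a i)), (∀ i, a i ∈ G) ∧ (freeHom n).Surj := by
  have := hG.to_subtype
  let J := Σ x : G, Fin (Module.finrank k (M.V x))
  obtain ⟨r, ⟨e⟩⟩ := Finite.exists_equiv_fin J
  refine ⟨r, fun i => (e.symm i).1, fun i => Module.finBasis k (M.V (e.symm i).1) (e.symm i).2,
    fun i => (e.symm i).1.2, fun y v => ?_⟩
  refine gen_min (N := Hom.range (freeHom _)) (fun x hx v _ => ?_) y (h y v)
  rw [← (Module.finBasis k (M.V x)).sum_repr v]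
  refine Submodule.sum_mem _ fun j _ => Submodule.smul_mem _ _ ?_
  have h1 := freeHom_single (M := M) (a := fun i => ((e.symm i).1 : Q))
    (fun i => Module.finBasis k (M.V (e.symm i).1) (e.symm i).2) (e ⟨⟨x, hx⟩, j⟩) .nil
  have h2 : e.symm (e ⟨⟨x, hx⟩, j⟩) = ⟨⟨x, hx⟩, j⟩ := e.symm_apply_apply _
  generalize e ⟨⟨x, hx⟩, j⟩ = i at h1 h2
  have key : ∀ z : J, (∃ u, (freeHom (M := M) (a := fun i => ((e.symm i).1 : Q))
    (fun i => Module.finBasis k (M.V (e.symm i).1) (e.symm i).2)).app (z.1 : Q) u =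
      Module.finBasis k (M.V z.1) z.2) → z = ⟨⟨x, hx⟩, j⟩ →
      ∃ u, (freeHom (M := M) (a := fun i => ((e.symm i).1 : Q))
    (fun i => Module.finBasis k (M.V (e.symm i).1) (e.symm i).2)).app x u =
      Module.finBasis k (M.V x) j := by
    rintro z hz rfl
    exact hz
  exact key _ ⟨_, h1⟩ h2

end Free

lemma exists_local_section {i : Hom X C} {G : Set Q}
    (hi : ∀ x ∈ G, Function.Bijective (i.app x)) :
    ∃ σ : ∀ x, C.V x →ₗ[k] X.V x, (∀ x ∈ G, ∀ v, σ x (i.app x v) = v) ∧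
      ∀ x ∈ G, ∀ y ∈ G, ∀ (α : x ⟶ y) u, σ y (C.map α u) = X.map α (σ x u) := by
  classical
  let σ : ∀ x, C.V x →ₗ[k] X.V x := fun x =>
    if h : Function.Bijective (i.app x) then (LinearEquiv.ofBijective _ h).symm.toLinearMap else 0
  have hσ : ∀ x ∈ G, ∀ v, σ x (i.app x v) = v := by
    intro x hx v
    simp only [σ, dif_pos (hi x hx)]
    exact (LinearEquiv.ofBijective (i.app x) (hi x hx)).symm_apply_apply v
  refine ⟨σ, hσ, fun x hx y hy α u => ?_⟩
  obtain ⟨v, rfl⟩ := (hi x hx).2 u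
  rw [← i.comm, hσ x hx, hσ y hy]

/-- Compactness: a morphism with prescribed affine conditions exists if it exists after
replacing the source by representations that agree with it on finite sets of vertices. -/
theorem exists_hom_of_approx (X Y : QRep k Q) {W : Q → Type} [∀ x, AddCommGroup (W x)]
    [∀ x, Module k (W x)] (T : ∀ x, (X.V x →ₗ[k] Y.V x) →ₗ[k] W x) (b : ∀ x, W x)
    (h : ∀ G : Set Q, G.Finite → ∃ (Z : QRep k Q) (i : Hom Z X) (t : Hom Z Y),
      (∀ x ∈ G, Function.Bijective (i.app x)) ∧
      ∀ x ∈ G, ∀ ψ : X.V x →ₗ[k] Y.V x, (∀ w, ψ (i.app x w) = t.app x w) → T x ψ = b x) :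
    ∃ φ : Hom X Y, ∀ x, T x (φ.app x) = b x := by
  refine exists_hom_of_local X Y T b fun G hG => ?_
  obtain ⟨Z, i, t, hi, ht⟩ := h G hG
  obtain ⟨σ, hσ, hσ'⟩ := exists_local_section hi
  refine ⟨fun x => t.app x ∘ₗ σ x, fun x hx => ht x hx _ fun w => ?_, fun x hx y hy α u => ?_⟩
  · rw [LinearMap.comp_apply, hσ x hx]
  · rw [LinearMap.comp_apply, LinearMap.comp_apply, hσ' x hx y hy, t.comm]

lemma exists_section_of_approx {π : Hom M C}
    (h : ∀ G : Set Q, G.Finite → ∃ (Z : QRep k Q) (i : Hom Z C) (t : Hom Z M),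
      (∀ x ∈ G, Function.Bijective (i.app x)) ∧ ∀ x v, π.app x (t.app x v) = i.app x v) :
    ∃ s : Hom C M, ∀ x v, π.app x (s.app x v) = v := by
  obtain ⟨s, hs⟩ := exists_hom_of_approx C M (W := fun x => C.V x →ₗ[k] C.V x)
    (fun x => LinearMap.compRight k (π.app x)) (fun x => LinearMap.id) (by
      intro G hG
      obtain ⟨Z, i, t, hi, ht⟩ := h G hG
      refine ⟨Z, i, t, hi, fun x hx ψ hψ => LinearMap.ext fun v => ?_⟩
      obtain ⟨w, rfl⟩ := (hi x hx).2 v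
      change π.app x (ψ _) = _
      rw [hψ, ht]
      rfl)
  exact ⟨s, fun x v => LinearMap.congr_fun (hs x) v⟩

lemma Hom.SES.splitMono {f : Hom L M} {g : Hom M N} (h : Hom.SES f g)
    (hs : g.SplitEpi) : f.SplitMono := by
  obtain ⟨s, hs⟩ := hs
  obtain ⟨r, hr⟩ := Hom.exists_lift_of_inj f h.inj (Hom.id M - s.comp g) (fun x v =>
    (h.exact x _).1 (by simp [hs]))
  refine ⟨r, fun x v => h.inj x ?_⟩
  rw [hr]
  simp [h.zero]

lemma Hom.Irr.exists_gen {f : Hom L M} {π : Hom M C} (hf : f.Irr) (h : Hom.SES f π) :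
    ∃ G : Set Q, G.Finite ∧ ∀ y v, v ∈ (gen G (Sub.top C)).S y := by
  by_contra! hG
  refine hf.1 (h.splitMono (exists_section_of_approx fun G hGf => ?_))
  rcases hf.ar_mono h.surj h.exact (gen G (Sub.top C)).incl with ⟨t, ht⟩ | ⟨t, ht⟩
  · refine ⟨_, (gen G (Sub.top C)).incl, t, fun x hx => ⟨Sub.incl_inj _ x, fun v => ?_⟩, ht⟩
    exact ⟨Sub.elt _ v (le_gen hx trivial), rfl⟩
  · exfalso
    obtain ⟨y, v, hv⟩ := hG G hGf
    obtain ⟨m, rfl⟩ := h.surj y v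
    exact hv (ht y m ▸ Sub.incl_mem _ _)

variable [SLF Q]

/-- The cokernel of an irreducible monomorphism with indecomposable source is finitely
presented. -/
theorem Hom.Irr.fpc_coker {f : Hom L M} {π : Hom M C} (hf : f.Irr) (hL : L.Indecomp)
    (h : Hom.SES f π) : FPc C := by
  obtain ⟨G, hG, hgen⟩ := hf.exists_gen h
  obtain ⟨r, a, n, ha, hq⟩ := exists_free_surj hG hgen
  set q := freeHom n
  let P := free k a
  have hPb : Bdd G P := free_bdd ha
  let K := q.ker
  have hd : ∀ H : Set Q, ∃ i : Hom (gen H K).quot C,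
      ∀ x v, i.app x ((gen H K).proj.app x v) = q.app x v := fun H =>
    Hom.exists_desc_of_surj _ (Sub.proj_surj _) q fun x v hv =>
      gen_le x ((gen H K).proj_eq_zero_iff.1 hv)
  choose i hi using hd
  have hbij : ∀ H : Set Q, ∀ x ∈ H, Function.Bijective ((i H).app x) := by
    intro H x hx
    constructor
    · rw [injective_iff_map_eq_zero]
      intro w hw
      obtain ⟨v, rfl⟩ := Sub.proj_surj _ x w
      rw [hi] at hw
      exact (gen H K).proj_eq_zero_iff.2 (le_gen hx hw)
    · intro v
      obtain ⟨u, rfl⟩ := hq x v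
      exact ⟨_, hi H x u⟩
  have hex : ∃ H : Set Q, H.Finite ∧ G ⊆ H ∧ (∀ x y, (x ⟶ y) → y ∈ H → x ∈ H ∨ x ∉ succs G) ∧
      ∃ t : Hom M (gen H K).quot, ∀ x v, (i H).app x (t.app x v) = π.app x v := by
    by_contra! hno
    refine hf.1 (h.splitMono (exists_section_of_approx fun S hS => ?_))
    obtain ⟨H, hH, hGH, hp⟩ := exists_pred_closed hG (hG.union hS)
    rcases hf.ar_mono h.surj h.exact (i H) with ⟨t, ht⟩ | ⟨t, ht⟩
    · exact ⟨_, i H, t, fun x hx => hbij H x (hGH (Or.inr hx)), ht⟩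
    · obtain ⟨x, v, hv⟩ := hno H hH (fun x hx => hGH (Or.inl hx)) hp t
      exact absurd (ht x v) hv
  obtain ⟨H, hH, hGH, hp, t, ht⟩ := hex
  let K' := gen H K
  have ht_surj : t.Surj := by
    let N : Sub P := ⟨fun x => (t.range.S x).comap (K'.proj.app x), fun α v hv => by
      rw [Submodule.mem_comap] at *
      rw [Hom.comm]
      exact t.range.closed α _ hv⟩
    intro x w
    obtain ⟨v, rfl⟩ := K'.proj_surj x w
    refine gen_min (N := N) (fun y hy v _ => ?_) x (gen_top_of_surj (H := G) hG hPb
      (fun y hy => free_cmap_surj fun i h => hy (h ▸ ha i)) x v)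
    obtain ⟨m, hm⟩ := h.surj y ((i H).app y (K'.proj.app y v))
    exact ⟨m, (hbij H y (hGH hy)).1 (by rw [ht, hm])⟩
  let R := (i H).ker
  have hiS : (i H).Surj := fun x v => by
    obtain ⟨u, rfl⟩ := hq x v
    exact ⟨_, hi H x u⟩
  have hRb : Bdd G R.rep := (hPb.of_surj K'.proj_surj).of_inj R.incl_inj
  have hRc : ∀ y, Function.Injective (R.rep.cmap y) := by
    obtain ⟨p, hp'⟩ := Hom.exists_lift_of_inj R.incl R.incl_inj (K'.proj.comp K.incl) (fun x v =>
      ⟨R.elt (K'.proj.app x (K.incl.app x v)) ((hi H x _).trans v.2), rfl⟩)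
    refine cmap_inj_of_gen (K := K) (H := H) (fun y _ => free_cmap_inj y)
      (fun x y α hy => (hp x y α hy).imp_right fun hx v => hPb.eq_zero hx v)
      (i := K.incl) (p := p) (fun x v => v.2) ?_ ?_
    · intro x w
      obtain ⟨v, hv⟩ := K'.proj_surj x (R.incl.app x w)
      refine ⟨K.elt v ?_, R.incl_inj x ?_⟩
      · have : (i H).app x (R.incl.app x w) = 0 := w.2
        rwa [← hv, hi] at this
      · rw [hp']; exact hv
    · intro x v
      rw [← K'.proj_eq_zero_iff, ← Hom.comp_app, ← hp']
      exact ⟨fun h0 => by rw [h0, map_zero], fun h0 => R.incl_inj x (h0.trans (map_zero _).symm)⟩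
  have hRf : FPc R.rep := by
    obtain ⟨e, he⟩ := Hom.exists_lift_of_inj R.incl R.incl_inj (t.comp f) (fun x v =>
      ⟨R.elt (t.app x (f.app x v)) ((ht x _).trans (h.zero x v)), rfl⟩)
    have hes : e.Surj := by
      intro x w
      obtain ⟨m, hm⟩ := ht_surj x (R.incl.app x w)
      have h0 : π.app x m = 0 := by
        rw [← ht, hm]; exact w.2
      obtain ⟨l, rfl⟩ := (h.exact x m).1 h0
      exact ⟨l, R.incl_inj x ((he x l).trans hm)⟩
    obtain ⟨s, hs⟩ := hRb.exists_lift hG hRc hes (Hom.id _)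
    rcases hL.retract e s hs with h0 | hb
    · exact FPc.of_zero h0
    · have hei : e.Inj := fun x => (hb x).1
      exact (hL.fpc hG (hRb.of_inj hei) Set.finite_empty
        fun y _ => hei.cmap_inj (hRc y)).of_bij hb
  have hK' : FPc K'.rep := by
    refine ⟨G, hG, hPb.of_inj K'.incl_inj, H, hH, fun y hy =>
      ⟨K'.incl_inj.cmap_inj (free_cmap_inj y), fun v => ?_⟩⟩
    obtain ⟨u, hu, hv⟩ := gen_range hy (K'.incl_mem v)
    refine ⟨fun α => K'.elt (u α) (hu α), K'.incl_inj y ?_⟩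
    rw [Hom.app_cmap, ← hv]
    rfl
  exact hRf.right (Hom.ses_ker hiS) (hK'.right K'.ses (free_fpc a))

theorem Hom.Irr.fcpc_ker {f : Hom L M} {g : Hom K L} (hf : f.Irr) (hM : M.Indecomp)
    (h : Hom.SES g f) : FCPc K := hf.dual.fpc_coker hM.dual h.dual

end QRep

namespace QRep

variable {L M N X Y Z C K R P : QRep k Q}

/-- An irreducible epimorphism to an indecomposable representation does not lift a nonzero
subrepresentation `C` of its target, if every morphism to the quotient by `C` lifts to an
endomorphism and the quotient by `C` is not generated by finitely many vertices. -/
theorem Hom.Irr.false_of_sub_lift {f : Hom L M} (hf : f.Irr) (hs : f.Surj) (hM : M.Indecomp)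
    {C : Sub M} (hC : ∃ (x : Q) (v : C.rep.V x), v ≠ 0) (j : Hom C.rep L)
    (hj : ∀ x v, f.app x (j.app x v) = C.incl.app x v)
    (hlift : ∀ v : Hom M C.quot, ∃ w : Hom M M, ∀ x m, C.proj.app x (w.app x m) = v.app x m)
    (hgen : ∀ G : Set Q, G.Finite → ∃ y v, v ∉ (gen G (Sub.top C.quot)).S y) : False := by
  set J := j.range
  have hpj : ∀ x c, J.proj.app x (j.app x c) = 0 := fun x c =>
    J.proj_eq_zero_iff.2 ⟨c, rfl⟩
  have hp0 : ∀ x l, J.proj.app x l = 0 → ∃ c, j.app x c = l := fun x l h =>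
    J.proj_eq_zero_iff.1 h
  obtain ⟨fb, hfb⟩ := Hom.exists_desc_of_surj J.proj J.proj_surj (C.proj.comp f) (fun x v hv => by
    obtain ⟨c, rfl⟩ := hp0 x v hv
    rw [comp_app, hj]
    exact C.proj_eq_zero_iff.2 (C.incl_mem c))
  have hfix : ∀ x l m, C.proj.app x (f.app x l) = C.proj.app x m →
      ∃ c, f.app x (l - j.app x c) = m := by
    intro x l m h
    refine ⟨C.elt (f.app x l - m) (C.proj_eq_zero_iff.1 (by rw [map_sub, h, sub_self])), ?_⟩
    rw [map_sub, hj, Sub.incl_elt, sub_sub_cancel]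
  have hK := Hom.ses_ker hs
  set K := f.ker
  by_cases hcase : ∃ G : Set Q, G.Finite ∧ ∃ ℓ : Hom L J.quot,
      (∀ x v, ℓ.app x (K.incl.app x v) = J.proj.app x (K.incl.app x v)) ∧
      ∀ x v, fb.app x (ℓ.app x v) ∈ (gen G (Sub.top C.quot)).S x
  · obtain ⟨G, hG, ℓ, hℓ, hℓW⟩ := hcase
    obtain ⟨u, hu⟩ := Hom.exists_desc_of_surj f hs (J.proj - ℓ) (fun x v hv => by
      obtain ⟨w, rfl⟩ := (hK.exact x v).1 hv
      rw [sub_app, hℓ, sub_self])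
    obtain ⟨w, hw⟩ := hlift (C.proj - fb.comp u)
    rcases hM.bij_or w with hb | hb
    · obtain ⟨y, v, hv⟩ := hgen G hG
      obtain ⟨m, rfl⟩ := C.proj_surj y v
      obtain ⟨m, rfl⟩ := (hb y).2 m
      refine hv ?_
      obtain ⟨l, rfl⟩ := hs y m
      rw [hw, sub_app, comp_app, hu, sub_app, map_sub, hfb, comp_app, sub_sub_cancel]
      exact hℓW y l
    · obtain ⟨τ, -, hτ⟩ := hb.exists_inv
      have ha : ∀ x m, fb.app x (u.app x (τ.app x m)) = C.proj.app x m := by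
        intro x m
        conv_rhs => rw [← hτ x m, sub_app, map_sub, hw]
        simp
      obtain ⟨s, hs'⟩ := Hom.exists_lift_of_inj (J.proj.prod f) (fun x => by
          rw [injective_iff_map_eq_zero]
          intro l hl
          obtain ⟨c, rfl⟩ := hp0 x l (by rw [← fst_pair (J.proj.app x l) (f.app x l),
            ← prod_app, hl, map_zero])
          have : C.incl.app x c = 0 := by
            rw [← hj, ← snd_pair (J.proj.app x (j.app x c)) (f.app x (j.app x c)),
              ← prod_app, hl, map_zero]
          rw [C.incl_inj x (this.trans (map_zero _).symm), map_zero])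
        ((u.comp τ).prod (Hom.id M)) (fun x m => by
          obtain ⟨l, hl⟩ := J.proj_surj x (u.app x (τ.app x m))
          obtain ⟨c, hc⟩ := hfix x l m (by
            rw [← comp_app, ← hfb, hl, ha])
          refine ⟨l - j.app x c, ?_⟩
          rw [prod_app, prod_app, hc, map_sub, hl, hpj, sub_zero]
          rfl)
      refine hf.2.1 ⟨s, fun x m => ?_⟩
      have := congrArg ((Hom.snd J.quot M).app x) (hs' x m)
      rwa [prod_app, prod_app, snd_pair, snd_pair] at this
  · have hθ : ∃ θ : Hom J.quot L, ∀ x,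
        θ.app x ∘ₗ (J.proj.comp K.incl).app x = K.incl.app x := by
      refine exists_hom_of_approx J.quot L
        (fun x => LinearMap.lcomp k (L.V x) ((J.proj.comp K.incl).app x))
        (fun x => K.incl.app x) fun G hG => ?_
      let W := gen G (Sub.top C.quot)
      let X : Sub J.quot := ⟨fun x => (W.S x).comap (fb.app x), fun α v hv => by
        rw [Submodule.mem_comap] at *
        rw [Hom.comm]
        exact W.closed α _ hv⟩
      obtain ⟨h, hh⟩ := Hom.exists_lift_of_inj X.incl X.incl_inj (J.proj.comp K.incl)
        (fun x v => ⟨X.elt (J.proj.app x (K.incl.app x v)) (by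
          change fb.app x _ ∈ W.S x
          rw [hfb, comp_app, hK.zero, map_zero]
          exact zero_mem _), rfl⟩)
      rcases hf.ar_epi hK h with ⟨ℓ, hℓ⟩ | ⟨θ, hθ⟩
      · refine absurd ⟨G, hG, X.incl.comp ℓ, fun x v => ?_, fun x v => X.incl_mem (ℓ.app x v)⟩ hcase
        rw [comp_app, hℓ, hh]
        rfl
      · refine ⟨X.rep, X.incl, θ, fun x hx => ⟨X.incl_inj x, fun v =>
          ⟨X.elt v (le_gen hx trivial), rfl⟩⟩, fun x hx ψ hψ => LinearMap.ext fun v => ?_⟩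
        change ψ ((J.proj.comp K.incl).app x v) = K.incl.app x v
        rw [← hh, hψ, hθ]
    obtain ⟨θ, hθ⟩ := hθ
    replace hθ : ∀ x v, θ.app x (J.proj.app x (K.incl.app x v)) = K.incl.app x v :=
      fun x v => LinearMap.congr_fun (hθ x) v
    obtain ⟨u, hu⟩ := Hom.exists_desc_of_surj f hs (Hom.id L - θ.comp J.proj) (fun x v hv => by
      obtain ⟨w, rfl⟩ := (hK.exact x v).1 hv
      rw [sub_app, comp_app, hθ, id_app, sub_self])
    obtain ⟨w, hw⟩ := Hom.exists_desc_of_surj f hs (f.comp (θ.comp J.proj)) (fun x v hv => by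
      obtain ⟨w, rfl⟩ := (hK.exact x v).1 hv
      rw [comp_app, comp_app, hθ, hK.zero])
    rcases hM.bij_or w with hb | hb
    · obtain ⟨x, c, hc⟩ := hC
      refine hc (C.incl_inj x ((hb x).1 ?_))
      rw [← hj, hw, comp_app, comp_app, hpj]
      simp only [map_zero]
    · obtain ⟨τ, -, hτ⟩ := hb.exists_inv
      refine hf.2.1 ⟨u.comp τ, fun x m => ?_⟩
      rw [comp_app]
      conv_rhs => rw [← hτ x m]
      obtain ⟨l, hl⟩ := hs x (τ.app x m)
      rw [← hl, hu, sub_app, sub_app, id_app, id_app, hw, map_sub]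
      rfl

lemma ses_inl_snd (L N : QRep k Q) : Hom.SES (Hom.inl L N) (Hom.snd L N) where
  inj x := by
    intro u v h
    rw [Hom.inl_app, Hom.inl_app] at h
    rw [← Hom.fst_pair u (0 : N.V x), h, Hom.fst_pair]
  surj x v := ⟨pair 0 v, Hom.snd_pair _ _⟩
  exact x v := by
    constructor
    · intro h
      exact ⟨(Hom.fst L N).app x v, prod_ext (by rw [Hom.inl_app, Hom.fst_pair])
        (by rw [Hom.inl_app, Hom.snd_pair, h])⟩
    · rintro ⟨u, rfl⟩
      rw [Hom.inl_app, Hom.snd_pair]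

section Main

variable [SLF Q]

/-- A criterion for lifting morphisms to the quotient by a subrepresentation which, at every
vertex, is either zero or everything. -/
theorem exists_endo_lift {A : Set Q} (hA : A.Finite) {K C : Sub M} {U : Set Q}
    (hU : ∀ x ∈ U, C.S x = ⊤) (hU' : ∀ x ∉ U, C.S x = ⊥) (hAK : Bdd A K.quot)
    (hc : ∀ y ∈ U, Function.Bijective (K.quot.cmap y))
    (hα : ∀ x, ∀ y ∈ U, ∀ α : x ⟶ y, ∀ u ∈ K.S x, u = 0 ∨ ∀ v, M.map α v = 0)
    (v : Hom M C.quot) : ∃ w : Hom M M, ∀ x m, C.proj.app x (w.app x m) = v.app x m := by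
  classical
  have hcomm : ∀ {x y : Q} (α : x ⟶ y) (φ : M.V x →ₗ[k] M.V x) (ψ : M.V y →ₗ[k] M.V y), y ∉ U →
      (∀ m, C.proj.app x (φ m) = v.app x m) → (∀ m, C.proj.app y (ψ m) = v.app y m) →
      ∀ u, ψ (M.map α u) = M.map α (φ u) := by
    intro x y α φ ψ hy hφ hψ u
    rw [← sub_eq_zero, ← Submodule.mem_bot k, ← hU' y hy, ← C.proj_eq_zero_iff, map_sub, hψ,
      Hom.comm, Hom.comm, hφ, sub_self]
  obtain ⟨φ, hφ⟩ := exists_rec_family (C := fun x => M.V x →ₗ[k] M.V x) (wf_arr hA)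
    (fun x φ => ∀ m, C.proj.app x (φ m) = v.app x m)
    (fun x y φ ψ => ∀ (α : x ⟶ y) u, ψ (M.map α u) = M.map α (φ u)) (by
      intro y φ hφ
      by_cases hy : y ∈ U
      · have hD : ∀ α : InArr y, ∃ D : K.quot.V α.1 →ₗ[k] M.V y,
            ∀ u, D (K.proj.app α.1 u) = M.map α.2 (φ α.1 u) := fun α =>
          ⟨(K.S α.1).liftQ (M.map α.2 ∘ₗ φ α.1) (fun u hu => by
            rw [LinearMap.mem_ker, LinearMap.comp_apply]
            rcases hα α.1 y hy α.2 u hu with h | h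
            · rw [h, map_zero, map_zero]
            · exact h _), fun u => rfl⟩
        choose D hD using hD
        let e := LinearEquiv.ofBijective (K.quot.cmap y) (hc y hy)
        refine ⟨(∑ α : InArr y, D α ∘ₗ LinearMap.proj α) ∘ₗ e.symm.toLinearMap ∘ₗ K.proj.app y,
          fun m => ?_, fun x hx α u => ?_⟩
        · have h0 : ∀ w : C.quot.V y, w = 0 := fun w => by
            obtain ⟨m, rfl⟩ := C.proj_surj y w
            rw [C.proj_eq_zero_iff, hU y hy]
            trivial
          rw [h0 (v.app y m)]
          exact h0 _
        · have h1 : e.symm (K.proj.app y (M.map α u)) =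
              Pi.single (⟨x, α⟩ : InArr y) (K.proj.app x u) := by
            rw [LinearEquiv.symm_apply_eq]
            change _ = K.quot.cmap y _
            rw [cmap_single (⟨x, α⟩ : InArr y) (K.proj.app x u), K.proj.comm]
          rw [LinearMap.comp_apply, LinearMap.comp_apply, LinearEquiv.coe_coe, h1,
            LinearMap.sum_apply, Finset.sum_eq_single (⟨x, α⟩ : InArr y)]
          · rw [LinearMap.comp_apply, LinearMap.proj_apply, Pi.single_eq_same]
            exact hD ⟨x, α⟩ u
          · intro β _ hβ
            rw [LinearMap.comp_apply, LinearMap.proj_apply, Pi.single_eq_of_ne hβ, map_zero]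
          · intro h0
            exact absurd (Finset.mem_univ _) h0
      · have hb : Function.Bijective (C.proj.app y) :=
          ⟨by
            rw [injective_iff_map_eq_zero]
            intro m hm
            rwa [C.proj_eq_zero_iff, hU' y hy, Submodule.mem_bot] at hm, C.proj_surj y⟩
        have hψ : ∀ m, C.proj.app y (((LinearEquiv.ofBijective _ hb).symm.toLinearMap ∘ₗ
            v.app y) m) = v.app y m := fun m =>
          (LinearEquiv.ofBijective _ hb).apply_symm_apply (v.app y m)
        exact ⟨_, hψ, fun x hx α u => hcomm α _ _ hy (hφ x hx) hψ u⟩)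
  refine ⟨⟨φ, fun {x y} α u => ?_⟩, fun x => (hφ x).1⟩
  by_cases hy : y ∈ U
  · by_cases hx : x ∈ succs A
    · exact (hφ y).2 x ⟨hx, ⟨α⟩⟩ α u
    · rcases hα x y hy α u (K.proj_eq_zero_iff.1 (hAK.eq_zero hx _)) with h | h
      · rw [h]; simp only [map_zero]
      · rw [h, h, map_zero]
  · exact hcomm α _ _ hy (hφ x).1 (hφ y).1 u

lemma Indecomp.fpc_of_inj (hL : L.Indecomp) {i : Hom L C} (hi : i.Inj) (h : FPc C) : FPc L := by
  obtain ⟨A, hA, hAC, G, hG, hc⟩ := h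
  exact hL.fpc hA (hAC.of_inj hi) hG fun y hy => hi.cmap_inj (hc y hy).1

lemma FPc.prod (hL : FPc L) (hN : FPc N) : FPc (QRep.prod L N) :=
  FPc.mid (ses_inl_snd L N) hL hN

lemma FCPc.mid {f : Hom L M} {g : Hom M N} (h : Hom.SES f g) (h₁ : FCPc L) (h₂ : FCPc N) :
    FCPc M := FPc.mid h.dual h₂ h₁

lemma FCPc.of_finite {S : Set Q} (hS : S.Finite) (h : ∀ x ∉ S, ∀ v : M.V x, v = 0) : FCPc M :=
  FPc.of_finite (S := Opposite.unop ⁻¹' S) (hS.preimage Opposite.unop_injective.injOn)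
    fun x hx ξ => ev_ext fun v => by
      rw [h x.unop hx v]; simp

lemma FCPc.exists_preds (h : FCPc M) :
    ∃ B : Set Q, B.Finite ∧ ∀ x (v : M.V x), v ≠ 0 → x ∈ preds B := by
  obtain ⟨B, hB, hBM, -⟩ := h
  refine ⟨Opposite.op ⁻¹' B, hB.preimage Opposite.op_injective.injOn, fun x v hv => ?_⟩
  by_contra hx
  refine hv (ev_sep (M := M) (x := Opposite.op x) fun ξ => ?_)
  rw [hBM.eq_zero (x := Opposite.op x) (fun h => hx (unop_mem_preds h)) ξ]
  simp

/-- No irreducible morphism from a direct sum of two indecomposable representations hits an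
indecomposable representation that is neither finitely presented nor finitely co-presented. -/
theorem Hom.Irr.false_of_coprod (hL : L.Indecomp) (hN : N.Indecomp) (hM : M.Indecomp)
    {f : Hom L M} {g : Hom N M} (hf : f.Irr) (hg : g.Irr) (hfg : (f.coprod g).Irr)
    (h₁ : ¬ FPc M) (h₂ : ¬ FCPc M) : False := by
  rcases hfg.inj_or_surj with hi | hs
  · have hfi : f.Inj := fun x a b h => by
      have := hi x (a₁ := pair a 0) (a₂ := pair b 0) (by simp [h])
      rw [← Hom.fst_pair a (0 : N.V x), this, Hom.fst_pair]
    have hgi : g.Inj := fun x a b h => by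
      have := hi x (a₁ := pair 0 a) (a₂ := pair 0 b) (by simp [h])
      rw [← Hom.snd_pair (0 : L.V x) a, this, Hom.snd_pair]
    have hs₁ := ses_range hfi
    have hs₂ := ses_range hgi
    refine h₁ (FPc.mid hs₁ (hL.fpc_of_inj (i := g.range.proj.comp f) (fun x => ?_)
      (hg.fpc_coker hN hs₂)) (hf.fpc_coker hL hs₁))
    rw [injective_iff_map_eq_zero]
    intro a ha
    obtain ⟨b, hb⟩ := g.range.proj_eq_zero_iff.1 ha
    have := hi x (a₁ := pair a (-b)) (a₂ := 0) (by
      rw [coprod_pair, map_neg, hb, map_zero, add_neg_cancel])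
    rw [← Hom.fst_pair a (-b), this, map_zero]
  · have hker : ∀ {L : QRep k Q} {f : Hom L M}, f.Irr → FCPc f.ker.rep := by
      intro L f hf
      rcases hf.inj_or_surj with h | h
      · exact FCPc.of_finite Set.finite_empty fun x _ v => f.ker.incl_inj x (h x (by
          rw [map_zero, map_zero]; exact f.ker.incl_mem v))
      · exact hf.fcpc_ker hM (ses_ker h)
    have hcok : ∀ {L : QRep k Q} {f : Hom L M}, L.Indecomp → f.Irr → FPc f.range.quot := by
      intro L f hL hf
      rcases hf.inj_or_surj with h | h
      · exact hf.fpc_coker hL (ses_range h)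
      · refine FPc.of_zero fun x v => ?_
        obtain ⟨m, rfl⟩ := f.range.proj_surj x v
        exact f.range.proj_eq_zero_iff.2 (h x m)
    let K : Sub M := ⟨fun x => f.range.S x ⊓ g.range.S x, fun α v hv =>
      ⟨f.range.closed α v hv.1, g.range.closed α v hv.2⟩⟩
    have hKc : FCPc K.rep := by
      have hκ := hfg.fcpc_ker hM (ses_ker hs)
      set κ := (f.coprod g).ker
      have hκ0 : ∀ x (w : κ.rep.V x), f.app x ((fst L N).app x (κ.incl.app x w)) +
          g.app x ((snd L N).app x (κ.incl.app x w)) = 0 := fun x w => by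
        rw [← coprod_app]
        exact κ.incl_mem w
      obtain ⟨t, ht⟩ := exists_lift_of_inj K.incl K.incl_inj
        (f.comp ((fst L N).comp κ.incl)) (fun x w => ⟨K.elt _ ⟨⟨_, rfl⟩,
          ⟨-(snd L N).app x (κ.incl.app x w), by
            rw [map_neg, neg_eq_iff_add_eq_zero, add_comm]
            exact hκ0 x w⟩⟩, rfl⟩)
      obtain ⟨i, hi⟩ := exists_lift_of_inj κ.incl κ.incl_inj
        ((f.ker.incl.comp (fst f.ker.rep g.ker.rep)).prod
          (g.ker.incl.comp (snd f.ker.rep g.ker.rep))) (fun x w => ⟨κ.elt _ (by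
            change (f.coprod g).app x (pair (f.ker.incl.app x _) (g.ker.incl.app x _)) = 0
            rw [coprod_pair, mem_ker.1 (f.ker.incl_mem _),
              mem_ker.1 (g.ker.incl_mem _), add_zero]), rfl⟩)
      have hit : Hom.SES i t := by
        refine ⟨fun x => ?_, fun x m => ?_, fun x w => ⟨fun hw => ?_, ?_⟩⟩
        · rw [injective_iff_map_eq_zero]
          intro w hw
          have := hi x w
          rw [hw, map_zero, prod_app, comp_app, comp_app] at this
          refine prod_ext (f.ker.incl_inj x ?_) (g.ker.incl_inj x ?_)
          · rw [map_zero, map_zero, ← fst_pair (f.ker.incl.app x _) (g.ker.incl.app x _), ← this,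
              map_zero]
          · rw [map_zero, map_zero, ← snd_pair (f.ker.incl.app x _) (g.ker.incl.app x _), ← this,
              map_zero]
        · obtain ⟨⟨a, ha⟩, ⟨b, hb⟩⟩ := K.incl_mem m
          refine ⟨κ.elt (pair a (-b)) ?_, K.incl_inj x ?_⟩
          · change (f.coprod g).app x _ = 0
            rw [coprod_pair, map_neg, ha, hb, add_neg_cancel]
          · rw [ht, comp_app, comp_app, Sub.incl_elt, fst_pair, ha]
        · have h0 : f.app x ((fst L N).app x (κ.incl.app x w)) = 0 :=
            (ht x w).symm.trans (by rw [hw, map_zero])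
          have h1 := hκ0 x w
          rw [h0, zero_add] at h1
          refine ⟨pair (f.ker.elt _ (mem_ker.2 h0)) (g.ker.elt _ (mem_ker.2 h1)), κ.incl_inj x ?_⟩
          rw [hi, prod_app, comp_app, comp_app, fst_pair, snd_pair, Sub.incl_elt, Sub.incl_elt,
            pair_eta]
        · rintro ⟨u, rfl⟩
          refine K.incl_inj x ?_
          rw [ht, comp_app, comp_app, hi, prod_app, fst_pair, comp_app,
            mem_ker.1 (f.ker.incl_mem _), map_zero]
      exact FPc.left hit.dual hκ
        (FPc.mid (ses_inl_snd _ _).dual (hker hg) (hker hf))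
    have hCc : FPc K.quot := by
      obtain ⟨ψ, hψ⟩ := exists_desc_of_surj K.proj K.proj_surj (f.range.proj.prod g.range.proj)
        (fun x v hv => by
          have hv := K.proj_eq_zero_iff.1 hv
          rw [prod_app, f.range.proj_eq_zero_iff.2 hv.1, g.range.proj_eq_zero_iff.2 hv.2,
            pair_zero])
      have hb : ψ.Bij := by
        refine fun x => ⟨?_, fun w => ?_⟩
        · rw [injective_iff_map_eq_zero]
          intro w hw
          obtain ⟨m, rfl⟩ := K.proj_surj x w
          rw [hψ, prod_app] at hw
          refine K.proj_eq_zero_iff.2 ⟨f.range.proj_eq_zero_iff.1 ?_,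
            g.range.proj_eq_zero_iff.1 ?_⟩
          · rw [← fst_pair (f.range.proj.app x m) (g.range.proj.app x m), hw, map_zero]
          · rw [← snd_pair (f.range.proj.app x m) (g.range.proj.app x m), hw, map_zero]
        · obtain ⟨m, hm⟩ := f.range.proj_surj x ((fst _ _).app x w)
          obtain ⟨n, hn⟩ := g.range.proj_surj x ((snd _ _).app x w)
          obtain ⟨u, rfl⟩ := hs x m
          obtain ⟨u', rfl⟩ := hs x n
          have hfz : ∀ a, f.range.proj.app x (f.app x a) = 0 := fun a =>
            f.range.proj_eq_zero_iff.2 ⟨a, rfl⟩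
          have hgz : ∀ a, g.range.proj.app x (g.app x a) = 0 := fun a =>
            g.range.proj_eq_zero_iff.2 ⟨a, rfl⟩
          refine ⟨K.proj.app x (g.app x ((snd L N).app x u) + f.app x ((fst L N).app x u')), ?_⟩
          rw [coprod_app, map_add, hfz, zero_add] at hm
          rw [coprod_app, map_add, hgz, add_zero] at hn
          rw [hψ, prod_app, map_add, map_add, hfz, hgz, add_zero, zero_add, hm, hn, pair_eta]
      obtain ⟨ψ', h1, h2⟩ := hb.exists_inv
      exact FPc.of_bij (f := ψ') (fun x => Function.bijective_iff_has_inverse.2 ⟨_, h2 x, h1 x⟩)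
        ((hcok hL hf).prod (hcok hN hg))
    have hinf : ∀ S : Set Q, S.Finite → ∃ x ∉ S, ∃ v : K.quot.V x, v ≠ 0 := by
      intro S hS
      by_contra! h
      exact h₂ (FCPc.mid K.ses hKc (FCPc.of_finite hS h))
    have hinf' : ∀ S : Set Q, S.Finite → ∃ x ∉ S, ∃ v : K.rep.V x, v ≠ 0 := by
      intro S hS
      by_contra! h
      exact h₁ (FPc.mid K.ses (FPc.of_finite hS h) hCc)
    obtain ⟨A, hA, hAC, G, hG, hGc⟩ := hCc
    obtain ⟨B, hB, hBK⟩ := hKc.exists_preds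
    have hBK' : ∀ x ∉ preds B, ∀ v ∈ K.S x, v = 0 := fun x hx v hv => by
      by_contra h
      exact hx (hBK x (K.elt v hv) fun h0 => h (congrArg (K.incl.app x) h0))
    set H : Set Q := G ∪ B ∪ {y | ∃ x ∈ preds B ∩ succs A, Nonempty (x ⟶ y)} with hHdef
    have hH : H.Finite := (hG.union hB).union (targets_finite (preds_inter_succs_finite hA hB))
    have hBH : preds B ⊆ preds H := fun x ⟨b, hb, p⟩ => ⟨b, Or.inl (Or.inr hb), p⟩
    let U : Set Q := succs A \ preds H
    classical
    let C : Sub M := ⟨fun x => if x ∈ U then ⊤ else ⊥, fun {x y} α v hv => by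
      by_cases hx : x ∈ U
      · have hy : y ∈ U := ⟨succs_step α hx.1, fun h => hx.2 (preds_step α h)⟩
        rw [if_pos hy]
        trivial
      · rw [if_neg hx, Submodule.mem_bot] at hv
        rw [hv, map_zero]
        exact zero_mem _⟩
    have hU : ∀ x ∈ U, C.S x = ⊤ := fun x hx => if_pos hx
    have hU' : ∀ x ∉ U, C.S x = ⊥ := fun x hx => if_neg hx
    have hC0 : ∀ x ∉ U, ∀ v : C.rep.V x, v = 0 := fun x hx v => by
      refine C.incl_inj x ?_
      have := C.incl_mem v
      rwa [hU' x hx, Submodule.mem_bot] at this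
    have hinj : (K.proj.comp C.incl).Inj := by
      intro x
      rw [injective_iff_map_eq_zero]
      intro v hv
      by_cases hx : x ∈ U
      · exact C.incl_inj x (hBK' x (fun h => hx.2 (hBH h)) _ (K.proj_eq_zero_iff.1 hv))
      · exact hC0 x hx v
    have hCinj : ∀ y, Function.Injective (C.rep.cmap y) := by
      intro y
      by_cases hy : y ∈ G
      · intro v w _
        funext α
        have hα : α.1 ∉ U := fun h =>
          h.2 (preds_step α.2 (subset_preds H (Or.inl (Or.inl hy))))
        rw [hC0 _ hα (v α), hC0 _ hα (w α)]
      · exact hinj.cmap_inj (hGc y hy).1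
    obtain ⟨j, hj⟩ := Bdd.exists_lift hA (hAC.of_inj hinj) hCinj hs C.incl
    refine hfg.false_of_sub_lift hs hM (C := C) ?_ j hj ?_ ?_
    · obtain ⟨x, hx, v, hv⟩ := hinf _ (preds_inter_succs_finite hA hH)
      obtain ⟨m, rfl⟩ := K.proj_surj x v
      have hxA := hAC x _ hv
      have hxU : x ∈ U := ⟨hxA, fun h => hx ⟨h, hxA⟩⟩
      refine ⟨x, C.elt m (by rw [hU x hxU]; trivial), fun h => hv ?_⟩
      have : m = 0 := congrArg (C.incl.app x) h
      rw [this, map_zero]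
    · refine exists_endo_lift hA hU hU' hAC
        (fun y hy => hGc y fun h => hy.2 (subset_preds H (Or.inl (Or.inl h)))) ?_
      intro x y hy α u hu
      by_contra! hcon
      obtain ⟨hu0, v, hv⟩ := hcon
      have hxB : x ∈ preds B := by_contra fun h => hu0 (hBK' x h u hu)
      by_cases hxA : x ∈ succs A
      · exact hy.2 (subset_preds H (Or.inr ⟨x, ⟨hxB, hxA⟩, ⟨α⟩⟩))
      · exact hv (hBK' y (fun h => hy.2 (hBH h)) _
          (K.closed α v (K.proj_eq_zero_iff.1 (hAC.eq_zero hxA _))))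
    · intro S hS
      by_contra! h
      obtain ⟨x, hx, v, hv⟩ := hinf' _ (preds_inter_succs_finite hS hB)
      refine hv (K.incl_inj x ?_)
      have hxU : x ∉ U := fun h => hv (K.incl_inj x (hBK' x (fun h' => h.2 (hBH h')) _
        (K.incl_mem v)))
      have hxS : x ∉ succs S := fun h => hx ⟨hBK x v hv, h⟩
      have h0 : (gen S (Sub.top C.quot)).elt _ (h x (C.proj.app x (K.incl.app x v))) = 0 :=
        gen_bdd.eq_zero hxS _
      have h1 : C.proj.app x (K.incl.app x v) = 0 :=
        congrArg ((gen S (Sub.top C.quot)).incl.app x) h0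
      rwa [C.proj_eq_zero_iff, hU' x hxU, Submodule.mem_bot] at h1

end Main

end QRep

section Bridge

variable (k) in
/-- A path, seen as a morphism of the path category. -/
noncomputable def pathHom {x y : Q} (p : Quiver.Path x y) : vtx k Q x ⟶ vtx k Q y :=
  (Free.embedding k (Paths Q)).map (X := (Paths.of Q).obj x) (Y := (Paths.of Q).obj y) p

lemma pathHom_nil (x : Q) : pathHom k (Quiver.Path.nil : Quiver.Path x x) = 𝟙 (vtx k Q x) :=
  (Free.embedding k (Paths Q)).map_id _

lemma pathHom_comp {x y z : Q} (p : Quiver.Path x y) (q : Quiver.Path y z) :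
    pathHom k (p.comp q) = pathHom k p ≫ pathHom k q :=
  (Free.embedding k (Paths Q)).map_comp (X := (Paths.of Q).obj x) (Y := (Paths.of Q).obj y)
    (Z := (Paths.of Q).obj z) p q

lemma pathHom_toPath {x y : Q} (α : x ⟶ y) : pathHom k α.toPath = arrHom k Q α := rfl

lemma pathHom_cons {x y z : Q} (p : Quiver.Path x y) (α : y ⟶ z) :
    pathHom k (p.cons α) = pathHom k p ≫ arrHom k Q α := pathHom_comp p α.toPath

variable (k) in
/-- The basis of a morphism space of the path category given by the paths. -/
noncomputable def pathBasis (x y : Q) : (Quiver.Path x y →₀ k) ≃ₗ[k] (vtx k Q x ⟶ vtx k Q y) :=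
  LinearEquiv.refl k (Quiver.Path x y →₀ k)

lemma pathBasis_single {x y : Q} (p : Quiver.Path x y) :
    pathBasis k x y (Finsupp.single p 1) = pathHom k p := rfl

lemma span_pathHom (x y : Q) :
    Submodule.span k (Set.range (pathHom k : Quiver.Path x y → _)) = ⊤ := by
  rw [eq_top_iff]
  intro f _
  obtain ⟨f, rfl⟩ := (pathBasis k x y).surjective f
  induction f using Finsupp.induction_linear with
  | zero => rw [map_zero]; exact zero_mem _
  | add f g hf hg => rw [map_add]; exact add_mem (hf trivial) (hg trivial)
  | single p r =>
    rw [← mul_one r, ← smul_eq_mul, ← Finsupp.smul_single, map_smul, pathBasis_single]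
    exact Submodule.smul_mem _ _ (Submodule.subset_span ⟨p, rfl⟩)

/-- A linear property of morphisms of the path category holds as soon as it holds for paths. -/
lemma linearMap_ext_pathHom {x y : Q} {V : Type} [AddCommGroup V] [Module k V]
    {f g : (vtx k Q x ⟶ vtx k Q y) →ₗ[k] V} (h : ∀ p, f (pathHom k p) = g (pathHom k p)) :
    f = g :=
  LinearMap.ext_on (span_pathHom x y) (by rintro _ ⟨p, rfl⟩; exact h p)

instance [SLF Q] (x y : Q) : FiniteDimensional k (vtx k Q x ⟶ vtx k Q y) :=
  Module.Finite.equiv (pathBasis k x y)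

variable {L M N X Y : PathCat k Q ⥤ ModuleCat.{0} k}

/-- The action of a module on morphisms, as a linear map. -/
def IsMod.mapₗ (hM : IsMod k M) (a b : PathCat k Q) : (a ⟶ b) →ₗ[k] M.obj a →ₗ[k] M.obj b where
  toFun f := (M.map f).hom
  map_add' f g := by rw [hM.1]; rfl
  map_smul' r f := by rw [hM.2]; rfl

/-- Naturality on arrows implies naturality on all morphisms. -/
lemma IsMod.naturality (hM : IsMod k M) (hN : IsMod k N)
    (φ : ∀ x : Q, M.obj (vtx k Q x) →ₗ[k] N.obj (vtx k Q x))
    (h : ∀ {x y : Q} (α : x ⟶ y) v,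
      φ y ((M.map (arrHom k Q α)).hom v) = (N.map (arrHom k Q α)).hom (φ x v))
    {x y : Q} (f : vtx k Q x ⟶ vtx k Q y) (v : M.obj (vtx k Q x)) :
    φ y ((M.map f).hom v) = (N.map f).hom (φ x v) := by
  have hp : ∀ {y : Q} (p : Quiver.Path x y) (v : M.obj (vtx k Q x)),
      φ y ((M.map (pathHom k p)).hom v) = (N.map (pathHom k p)).hom (φ x v) := by
    intro y p v
    induction p with
    | nil => rw [pathHom_nil, M.map_id, N.map_id]; rfl
    | cons p α ih =>
      rw [pathHom_cons, M.map_comp, N.map_comp, ModuleCat.hom_comp, ModuleCat.hom_comp,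
        LinearMap.comp_apply, LinearMap.comp_apply, h, ih]
  have := linearMap_ext_pathHom (f := φ y ∘ₗ (hM.mapₗ _ _).flip v)
    (g := (hN.mapₗ _ _).flip (φ x v)) (fun p => hp p v)
  exact LinearMap.congr_fun this f

/-- The representation of the quiver given by a locally finite dimensional module. -/
noncomputable def toRep (M : PathCat k Q ⥤ ModuleCat.{0} k) (hM : IsLfdMod k M) : QRep k Q :=
  have := fun x : Q => hM.2 (vtx k Q x)
  { V := fun x => M.obj (vtx k Q x)
    map := fun α => (M.map (arrHom k Q α)).hom }

/-- A natural transformation gives a morphism of representations. -/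
noncomputable def toHom (hM : IsLfdMod k M) (hN : IsLfdMod k N) (f : M ⟶ N) :
    QRep.Hom (toRep M hM) (toRep N hN) where
  app x := (f.app (vtx k Q x)).hom
  comm {x y} α v := by
    change (M.map (arrHom k Q α) ≫ f.app (vtx k Q y)).hom v = _
    rw [f.naturality]
    rfl

/-- A morphism of representations gives a natural transformation. -/
noncomputable def ofHom (hM : IsLfdMod k M) (hN : IsLfdMod k N)
    (f : QRep.Hom (toRep M hM) (toRep N hN)) :
    M ⟶ N where
  app a := ModuleCat.ofHom (f.app (a : Q) : M.obj (vtx k Q a) →ₗ[k] N.obj (vtx k Q a))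
  naturality a b g := by
    refine ModuleCat.hom_ext (LinearMap.ext fun v => ?_)
    exact IsMod.naturality hM.1 hN.1 f.app (fun α v => f.comm α v) (x := (a : Q)) (y := (b : Q)) g v

lemma nat_ext {f g : M ⟶ N} (h : ∀ (x : Q) (v : M.obj (vtx k Q x)),
    (f.app (vtx k Q x)).hom v = (g.app (vtx k Q x)).hom v) : f = g := by
  apply NatTrans.ext
  funext a
  exact ModuleCat.hom_ext (LinearMap.ext (h (a : Q)))

lemma QRep.pmap_comp (X : QRep k Q) {x y z : Q} (p : Quiver.Path x y) (q : Quiver.Path y z) :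
    X.pmap (p.comp q) = X.pmap q ∘ₗ X.pmap p := by
  induction q with
  | nil => rfl
  | cons q α ih => rw [Quiver.Path.comp_cons, QRep.pmap, QRep.pmap, ih, LinearMap.comp_assoc]

/-- The action of morphisms of the path category on a representation. -/
noncomputable def QRep.act (X : QRep k Q) (x y : Q) :
    (vtx k Q x ⟶ vtx k Q y) →ₗ[k] X.V x →ₗ[k] X.V y :=
  Finsupp.linearCombination k X.pmap ∘ₗ (pathBasis k x y).symm.toLinearMap

lemma QRep.act_pathHom (X : QRep k Q) {x y : Q} (p : Quiver.Path x y) :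
    X.act x y (pathHom k p) = X.pmap p := by
  change Finsupp.linearCombination k X.pmap (Finsupp.single p 1) = _
  rw [Finsupp.linearCombination_single, one_smul]

lemma QRep.act_comp (X : QRep k Q) {x y z : Q} (f : vtx k Q x ⟶ vtx k Q y)
    (g : vtx k Q y ⟶ vtx k Q z) : X.act x z (f ≫ g) = X.act y z g ∘ₗ X.act x y f := by
  have h1 : ∀ (p : Quiver.Path x y) (g : vtx k Q y ⟶ vtx k Q z),
      X.act x z (pathHom k p ≫ g) = X.act y z g ∘ₗ X.pmap p := by
    intro p g
    refine LinearMap.congr_fun (linearMap_ext_pathHom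
      (f := X.act x z ∘ₗ Linear.leftComp k _ (pathHom k p))
      (g := LinearMap.lcomp k _ (X.pmap p) ∘ₗ X.act y z) fun q => ?_) g
    change X.act x z (pathHom k p ≫ pathHom k q) = X.act y z (pathHom k q) ∘ₗ X.pmap p
    rw [← pathHom_comp, act_pathHom, act_pathHom, pmap_comp]
  refine LinearMap.congr_fun (linearMap_ext_pathHom
    (f := X.act x z ∘ₗ Linear.rightComp k _ g)
    (g := LinearMap.llcomp k (X.V x) (X.V y) (X.V z) (X.act y z g) ∘ₗ X.act x y) fun p => ?_) f
  change X.act x z (pathHom k p ≫ g) = X.act y z g ∘ₗ X.act x y (pathHom k p)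
  rw [h1, act_pathHom]

/-- The vertex underlying an object of the path category. -/
def unvtx (a : PathCat k Q) : Q := a

/-- The module given by a representation. -/
noncomputable def ofRep (X : QRep k Q) : PathCat k Q ⥤ ModuleCat.{0} k where
  obj a := ModuleCat.of k (X.V (unvtx a))
  map {a b} f := ModuleCat.ofHom (X.act (unvtx a) (unvtx b) f)
  map_id a := by
    refine congrArg ModuleCat.ofHom ?_
    exact (congrArg (X.act (unvtx a) (unvtx a)) (pathHom_nil (k := k) (unvtx a)).symm).trans
      (X.act_pathHom _)
  map_comp {a b c} f g := congrArg ModuleCat.ofHom (X.act_comp (x := (unvtx a)) (y := (unvtx b))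
    (z := (unvtx c)) f g)

lemma ofRep_isLfdMod (X : QRep k Q) : IsLfdMod k (ofRep X) :=
  ⟨⟨fun {a b} f g => congrArg ModuleCat.ofHom ((X.act (unvtx a) (unvtx b)).map_add f g),
    fun {a b} r f => congrArg ModuleCat.ofHom ((X.act (unvtx a) (unvtx b)).map_smul r f)⟩,
    fun a => X.fd (unvtx a)⟩

lemma act_arrHom (X : QRep k Q) {x y : Q} (α : x ⟶ y) : X.act x y (arrHom k Q α) = X.map α := by
  rw [← pathHom_toPath]
  exact X.act_pathHom _

/-- The comparison of a representation with the one obtained from its module. -/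
noncomputable def toToRep (X : QRep k Q) : QRep.Hom X (toRep (ofRep X) (ofRep_isLfdMod X)) where
  app x := (LinearMap.id : X.V x →ₗ[k] X.V x)
  comm α v := (LinearMap.congr_fun (act_arrHom X α) v).symm

/-- The inverse comparison. -/
noncomputable def ofToRep (X : QRep k Q) : QRep.Hom (toRep (ofRep X) (ofRep_isLfdMod X)) X where
  app x := (LinearMap.id : X.V x →ₗ[k] X.V x)
  comm α v := LinearMap.congr_fun (act_arrHom X α) v

end Bridge

section Bridge

variable {L M N : PathCat k Q ⥤ ModuleCat.{0} k}

lemma toHom_comp_app (hL : IsLfdMod k L) (hM : IsLfdMod k M) (hN : IsLfdMod k N) (f : L ⟶ M)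
    (g : M ⟶ N) (x : Q) (v : (toRep L hL).V x) :
    (toHom hL hN (f ≫ g)).app x v = (toHom hM hN g).app x ((toHom hL hM f).app x v) := rfl

lemma isSplitMono_iff (hM : IsLfdMod k M) (hN : IsLfdMod k N) (f : M ⟶ N) :
    IsSplitMono f ↔ (toHom hM hN f).SplitMono := by
  constructor
  · intro h
    refine ⟨toHom hN hM (retraction f), fun x v => ?_⟩
    rw [← toHom_comp_app, IsSplitMono.id]
    rfl
  · rintro ⟨r, hr⟩
    exact IsSplitMono.mk' ⟨ofHom hN hM r, nat_ext hr⟩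

lemma isSplitEpi_iff (hM : IsLfdMod k M) (hN : IsLfdMod k N) (f : M ⟶ N) :
    IsSplitEpi f ↔ (toHom hM hN f).SplitEpi := by
  constructor
  · intro h
    refine ⟨toHom hN hM (section_ f), fun x v => ?_⟩
    rw [← toHom_comp_app, IsSplitEpi.id]
    rfl
  · rintro ⟨s, hs⟩
    exact IsSplitEpi.mk' ⟨ofHom hN hM s, nat_ext hs⟩

lemma Irred.irr (hM : IsLfdMod k M) (hN : IsLfdMod k N) {f : M ⟶ N} (h : Irred k f) :
    (toHom hM hN f).Irr := by
  refine ⟨fun h' => h.1 ((isSplitMono_iff hM hN f).2 h'),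
    fun h' => h.2.1 ((isSplitEpi_iff hM hN f).2 h'), fun X g q hgq => ?_⟩
  have hX := ofRep_isLfdMod X
  rcases h.2.2 hX (ofHom hM hX ((toToRep X).comp g)) (ofHom hX hN (q.comp (ofToRep X)))
    (nat_ext hgq) with h' | h'
  · obtain ⟨r, hr⟩ := (isSplitMono_iff hM hX _).1 h'
    exact Or.inl ⟨r.comp (toToRep X), hr⟩
  · obtain ⟨s, hs⟩ := (isSplitEpi_iff hX hN _).1 h'
    exact Or.inr ⟨(ofToRep X).comp s, hs⟩

lemma eq_zero_of_isZero (hM : IsLfdMod k M) (h : IsZero M) (x : Q) (v : (toRep M hM).V x) :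
    v = 0 := by
  have h1 : 𝟙 M = 0 := h.eq_of_src _ _
  calc v = (toHom hM hM (𝟙 M)).app x v := rfl
    _ = 0 := by rw [h1]; rfl

lemma isZero_of_eq_zero (hM : IsLfdMod k M) (h : ∀ x (v : (toRep M hM).V x), v = 0) : IsZero M := by
  rw [IsZero.iff_id_eq_zero]
  exact nat_ext fun x v => h x v

lemma nonempty_iso_biprod {X Y : PathCat k Q ⥤ ModuleCat.{0} k} (i : X ⟶ M) (j : Y ⟶ M) (p : M ⟶ X)
    (q : M ⟶ Y) (h1 : i ≫ p = 𝟙 X) (h2 : j ≫ q = 𝟙 Y) (h3 : i ≫ q = 0) (h4 : j ≫ p = 0)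
    (h5 : p ≫ i + q ≫ j = 𝟙 M) : Nonempty (M ≅ X ⊞ Y) :=
  ⟨⟨biprod.lift p q, biprod.desc i j, by rw [biprod.lift_desc, h5], by
    apply biprod.hom_ext <;> apply biprod.hom_ext' <;> simp [h1, h2, h3, h4]⟩⟩

lemma Indec.indecomp (hM : IsLfdMod k M) (h : Indec k M) : (toRep M hM).Indecomp := by
  constructor
  · by_contra! h'
    exact h.1 (isZero_of_eq_zero hM h')
  · intro e he
    have hK := ofRep_isLfdMod e.ker.rep
    have hR := ofRep_isLfdMod e.range.rep
    obtain ⟨p, hp⟩ := QRep.Hom.exists_lift_of_inj e.range.incl e.range.incl_inj e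
      (fun x v => ⟨e.range.elt (e.app x v) ⟨v, rfl⟩, rfl⟩)
    obtain ⟨q, hq⟩ := QRep.Hom.exists_lift_of_inj e.ker.incl e.ker.incl_inj (QRep.Hom.id _ - e)
      (fun x v => ⟨e.ker.elt (v - e.app x v) (by
        rw [QRep.Hom.mem_ker, map_sub, he, sub_self]), rfl⟩)
    have hri : ∀ x v, e.app x (e.range.incl.app x v) = e.range.incl.app x v := by
      rintro x v
      obtain ⟨u, hu⟩ := e.range.incl_mem v
      rw [← hu, he]
    have hki : ∀ x v, e.app x (e.ker.incl.app x v) = 0 := fun x v => e.ker.incl_mem v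
    have hpr : ∀ x v, p.app x (e.range.incl.app x v) = v := fun x v =>
      e.range.incl_inj x ((hp _ _).trans (hri x v))
    have hpk : ∀ x v, p.app x (e.ker.incl.app x v) = 0 := fun x v =>
      e.range.incl_inj x ((hp _ _).trans ((hki x v).trans (map_zero _).symm))
    have hqr : ∀ x v, q.app x (e.range.incl.app x v) = 0 := fun x v =>
      e.ker.incl_inj x ((hq _ _).trans
        ((sub_eq_zero.2 (hri x v).symm).trans (map_zero _).symm))
    have hqk : ∀ x v, q.app x (e.ker.incl.app x v) = v := fun x v =>
      e.ker.incl_inj x ((hq _ _).trans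
        ((congrArg (fun w => e.ker.incl.app x v - w) (hki x v)).trans (sub_zero _)))
    have hpq : ∀ x v, e.range.incl.app x (p.app x v) + e.ker.incl.app x (q.app x v) = v := by
      intro x v
      rw [hp, hq]
      exact add_sub_cancel _ _
    obtain ⟨iso⟩ := nonempty_iso_biprod
      (ofHom hR hM (e.range.incl.comp (ofToRep _))) (ofHom hK hM (e.ker.incl.comp (ofToRep _)))
      (ofHom hM hR ((toToRep _).comp p)) (ofHom hM hK ((toToRep _).comp q))
      (nat_ext hpr) (nat_ext hqk) (nat_ext hqr) (nat_ext hpk) (nat_ext hpq)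
    rcases h.2 hR hK iso with h' | h'
    · left
      intro x v
      rw [← hp, show p.app x v = 0 from eq_zero_of_isZero hR h' x _, map_zero]
    · right
      intro x v
      have h1 := hq x v
      rw [show q.app x v = 0 from eq_zero_of_isZero hK h' x _, map_zero] at h1
      exact (sub_eq_zero.1 h1.symm).symm

end Bridge

section Bridge

variable {L M N : PathCat k Q ⥤ ModuleCat.{0} k}

lemma app_injective (f : M ⟶ N) [Mono f] (a : PathCat k Q) : Function.Injective (f.app a).hom :=
  (ModuleCat.mono_iff_injective _).1 ((NatTrans.mono_iff_mono_app f).1 inferInstance a)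

lemma app_surjective (f : M ⟶ N) [Epi f] (a : PathCat k Q) : Function.Surjective (f.app a).hom :=
  (ModuleCat.epi_iff_surjective _).1 ((NatTrans.epi_iff_epi_app f).1 inferInstance a)

lemma IsLfdMod.of_mono (hN : IsLfdMod k N) (f : M ⟶ N) [Mono f] : IsLfdMod k M := by
  have hm : ∀ a, Mono (f.app a) := (NatTrans.mono_iff_mono_app f).1 inferInstance
  refine ⟨⟨fun {a b} g h => ?_, fun {a b} r g => ?_⟩, fun a => ?_⟩
  · rw [← cancel_mono (f.app b), f.naturality, hN.1.1, Preadditive.comp_add, Preadditive.add_comp,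
      f.naturality, f.naturality]
  · rw [← cancel_mono (f.app b), f.naturality, hN.1.2, Linear.comp_smul, Linear.smul_comp,
      f.naturality]
  · have := hN.2 a
    exact Module.Finite.of_injective (f.app a).hom (app_injective f a)

lemma IsLfdMod.of_epi (hM : IsLfdMod k M) (f : M ⟶ N) [Epi f] : IsLfdMod k N := by
  have hm : ∀ a, Epi (f.app a) := (NatTrans.epi_iff_epi_app f).1 inferInstance
  refine ⟨⟨fun {a b} g h => ?_, fun {a b} r g => ?_⟩, fun a => ?_⟩
  · rw [← cancel_epi (f.app a), ← f.naturality, hM.1.1, Preadditive.comp_add, Preadditive.add_comp,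
      f.naturality, f.naturality]
  · rw [← cancel_epi (f.app a), ← f.naturality, hM.1.2, Linear.comp_smul, Linear.smul_comp,
      f.naturality]
  · have := hM.2 a
    exact Module.Finite.of_surjective (f.app a).hom (app_surjective f a)

lemma sum_app_hom {ι : Type} (s : Finset ι) (f : ι → (M ⟶ N)) (a : PathCat k Q) (v : M.obj a) :
    ((∑ j ∈ s, f j).app a).hom v = ∑ j ∈ s, ((f j).app a).hom v := by
  classical
  induction s using Finset.induction_on with
  | empty => simp
  | insert i s hi ih => rw [Finset.sum_insert hi, Finset.sum_insert hi, ← ih]; rfl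

lemma IsLfdMod.of_decomp {ι : Type} [Fintype ι] {T : ι → PathCat k Q ⥤ ModuleCat.{0} k}
    (hT : ∀ j, IsLfdMod k (T j)) (i : ∀ j, T j ⟶ M) (p : ∀ j, M ⟶ T j)
    (hip : ∑ j, p j ≫ i j = 𝟙 M) : IsLfdMod k M := by
  have key : ∀ (a : PathCat k Q) (v : M.obj a),
      ∑ j, ((i j).app a).hom (((p j).app a).hom v) = v := by
    intro a v
    have := sum_app_hom Finset.univ (fun j => p j ≫ i j) a v
    rw [hip] at this
    exact this.symm
  have hnat : ∀ j {a b : PathCat k Q} (f : a ⟶ b) v,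
      ((p j).app b).hom ((M.map f).hom v) = ((T j).map f).hom (((p j).app a).hom v) :=
    fun j a b f v => congrArg (fun g => ModuleCat.Hom.hom g v) ((p j).naturality f)
  have hmap : ∀ {a b : PathCat k Q} (f : a ⟶ b) (v : M.obj a), (M.map f).hom v =
      ∑ j, ((i j).app b).hom (((T j).map f).hom (((p j).app a).hom v)) := by
    intro a b f v
    rw [← key b ((M.map f).hom v)]
    exact Finset.sum_congr rfl fun j _ => by rw [hnat]
  refine ⟨⟨fun {a b} f g => ?_, fun {a b} r f => ?_⟩, fun a => ?_⟩
  · refine ModuleCat.hom_ext (LinearMap.ext fun v => ?_)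
    rw [ModuleCat.hom_add, LinearMap.add_apply, hmap, hmap, hmap, ← Finset.sum_add_distrib]
    refine Finset.sum_congr rfl fun j _ => ?_
    rw [(hT j).1.1, ModuleCat.hom_add, LinearMap.add_apply, map_add]
  · refine ModuleCat.hom_ext (LinearMap.ext fun v => ?_)
    rw [ModuleCat.hom_smul, LinearMap.smul_apply, hmap, hmap, Finset.smul_sum]
    refine Finset.sum_congr rfl fun j _ => ?_
    rw [(hT j).1.2, ModuleCat.hom_smul, LinearMap.smul_apply, map_smul]
  · have := fun j => (hT j).2 a
    refine Module.Finite.of_surjective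
      (∑ j, ((i j).app a).hom ∘ₗ LinearMap.proj j : (∀ j, (T j).obj a) →ₗ[k] M.obj a) fun v =>
        ⟨fun j => ((p j).app a).hom v, ?_⟩
    rw [LinearMap.sum_apply]
    exact key a v

lemma IsLfdMod.biproduct {ι : Type} [Fintype ι] {T : ι → PathCat k Q ⥤ ModuleCat.{0} k}
    (hT : ∀ j, IsLfdMod k (T j)) : IsLfdMod k (⨁ T) :=
  IsLfdMod.of_decomp hT (biproduct.ι T) (biproduct.π T) biproduct.total

lemma IsLfdMod.biprod (hM : IsLfdMod k M) : IsLfdMod k (M ⊞ M) :=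
  IsLfdMod.of_decomp (ι := Bool) (T := fun _ => M) (fun _ => hM)
    (fun b => if b then biprod.inl else biprod.inr)
    (fun b => if b then biprod.fst else biprod.snd)
    (by rw [Fintype.sum_bool]; simp [biprod.total])

lemma toRep_pmap (hM : IsLfdMod k M) {x y : Q} (p : Quiver.Path x y) (v : (toRep M hM).V x) :
    (toRep M hM).pmap p v = (M.map (pathHom k p)).hom v := by
  induction p with
  | nil => rw [pathHom_nil, M.map_id]; rfl
  | cons p α ih => rw [pathHom_cons, M.map_comp, QRep.pmap, LinearMap.comp_apply, ih]; rfl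

lemma ev_pmap {X : QRep k Q} {x y : Qᵒᵖ} (p : Quiver.Path x y) (ξ : X.dual.V x) (v : X.V y.unop) :
    QRep.ev (X.dual.pmap p ξ) v = QRep.ev ξ (X.pmap (pathUnop p) v) := by
  induction p with
  | nil => rfl
  | cons p α ih =>
    rw [pathUnop, QRep.pmap_comp, LinearMap.comp_apply, ← show QRep.ev (X.dual.pmap p ξ) _ = _ from
      ih _]
    rfl

section SLF

variable [SLF Q]

lemma projAt_isLfdMod (a : PathCat k Q) : IsLfdMod k (ProjAt k a) :=
  ⟨⟨fun f g => ModuleCat.hom_ext (LinearMap.ext fun v =>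
    Preadditive.comp_add _ _ _ (v : a ⟶ _) f g),
    fun r f => ModuleCat.hom_ext (LinearMap.ext fun v => Linear.comp_smul _ _ _ (v : a ⟶ _) r f)⟩,
    fun b => inferInstanceAs (FiniteDimensional k (vtx k Q (unvtx a) ⟶ vtx k Q (unvtx b)))⟩

lemma injAt_isLfdMod (a : PathCat k Q) : IsLfdMod k (InjAt k a) := by
  refine ⟨⟨fun f g => ?_, fun r f => ?_⟩, fun b => ?_⟩
  · refine ModuleCat.hom_ext (LinearMap.ext fun (ξ : Module.Dual k (_ ⟶ a)) =>
      LinearMap.ext fun h => ?_)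
    change ξ ((f + g) ≫ h) = ξ (f ≫ h) + ξ (g ≫ h)
    rw [Preadditive.add_comp, map_add]
  · refine ModuleCat.hom_ext (LinearMap.ext fun (ξ : Module.Dual k (_ ⟶ a)) =>
      LinearMap.ext fun h => ?_)
    change ξ ((r • f) ≫ h) = r • ξ (f ≫ h)
    rw [Linear.smul_comp, map_smul]
  · have : FiniteDimensional k (b ⟶ a) :=
      inferInstanceAs (FiniteDimensional k (vtx k Q (unvtx b) ⟶ vtx k Q (unvtx a)))
    exact inferInstanceAs (FiniteDimensional k (Module.Dual k (b ⟶ a)))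

/-- A free representation on one generator is the space of linear combinations of paths. -/
noncomputable def freeUnitEquiv (a x : Q) :
    (QRep.free k (fun _ : Unit => a)).V x ≃ₗ[k] (Quiver.Path a x →₀ k) :=
  Finsupp.domLCongr (Equiv.punitProd _ |>.symm.trans (Equiv.sigmaEquivProd Unit _).symm).symm

lemma freeUnitEquiv_single {a x : Q} (i : Unit) (p : Quiver.Path a x) :
    freeUnitEquiv (k := k) a x (QRep.fsingle i p) = Finsupp.single p 1 :=
  Finsupp.domLCongr_single _ _ _

lemma QRep.freeHom_bij {X : QRep k Q} {ι : Type} [Finite ι] {a : ι → Q} (n : ∀ i, X.V (a i))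
    (e : ∀ x, (QRep.free k a).V x ≃ₗ[k] X.V x)
    (h : ∀ x i (p : Quiver.Path (a i) x), e x (QRep.fsingle i p) = X.pmap p (n i)) :
    (QRep.freeHom n).Bij := by
  intro x
  have h' : ⇑((QRep.freeHom n).app x) = ⇑(e x) := by
    funext v
    refine QRep.free_mem_of_single
      (LinearMap.eqLocus ((QRep.freeHom n).app x) (e x).toLinearMap) (fun i p => ?_) v
    exact (QRep.freeHom_single n i p).trans (h x i p).symm
  rw [h']
  exact (e x).bijective

/-- The generator of a projective representation. -/
noncomputable def projGen (a : Q) : (toRep _ (projAt_isLfdMod (vtx k Q a))).V a := 𝟙 (vtx k Q a)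

lemma projGen_pmap {a x : Q} (p : Quiver.Path a x) :
    (toRep _ (projAt_isLfdMod (vtx k Q a))).pmap p (projGen a) = pathHom k p :=
  (toRep_pmap _ p _).trans (Category.id_comp (pathHom k p))

/-- A projective representation is free on one generator. -/
noncomputable def projEquiv (a x : Q) : (QRep.free k (fun _ : Unit => a)).V x ≃ₗ[k]
    (toRep _ (projAt_isLfdMod (vtx k Q a))).V x :=
  (freeUnitEquiv a x).trans (pathBasis k a x)

lemma projEquiv_single {a x : Q} (i : Unit) (p : Quiver.Path a x) :
    projEquiv a x (QRep.fsingle i p) = pathHom k p :=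
  (congrArg (pathBasis k a x) (freeUnitEquiv_single i p)).trans (pathBasis_single p)

lemma projAt_fpc (a : Q) : QRep.FPc (toRep _ (projAt_isLfdMod (vtx k Q a))) :=
  QRep.FPc.of_bij (QRep.freeHom_bij (a := fun _ : Unit => a) (fun _ => projGen (k := k) a)
    (projEquiv a) fun _ i p => (projEquiv_single i p).trans (projGen_pmap p).symm)
    (QRep.free_fpc _)

/-- The generator of the dual of an injective representation. -/
noncomputable def injGen (a : Q) :
    (toRep _ (injAt_isLfdMod (vtx k Q a))).dual.V (Opposite.op a) :=
  Module.Dual.eval k (vtx k Q a ⟶ vtx k Q a) (𝟙 (vtx k Q a))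

/-- Evaluation of an element of an injective representation. -/
noncomputable def injEv {a x : Q} (ξ : (toRep _ (injAt_isLfdMod (vtx k Q a))).V x)
    (f : vtx k Q x ⟶ vtx k Q a) : k :=
  (show Module.Dual k (vtx k Q x ⟶ vtx k Q a) from ξ) f

lemma injGen_pmap {a : Q} {x : Qᵒᵖ} (p : Quiver.Path (Opposite.op a) x)
    (ξ : (toRep _ (injAt_isLfdMod (vtx k Q a))).V x.unop) :
    QRep.ev ((toRep _ (injAt_isLfdMod (vtx k Q a))).dual.pmap p (injGen a)) ξ =
      injEv ξ (pathHom k (pathUnop p)) :=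
  ((ev_pmap _ _ _).trans (congrArg (QRep.ev (injGen a)) (toRep_pmap _ _ _))).trans
    (congrArg (injEv ξ) (Category.comp_id (pathHom k (pathUnop p))))

/-- A free representation of the opposite quiver as a space of linear combinations of paths. -/
noncomputable def freeOpEquiv (a : Q) (x : Qᵒᵖ) :
    (QRep.free k (fun _ : Unit => Opposite.op a)).V x ≃ₗ[k] (vtx k Q x.unop ⟶ vtx k Q a) :=
  (freeUnitEquiv (Opposite.op a) x).trans
    ((Finsupp.domLCongr (pathOpEquiv x.unop a).symm).trans (pathBasis k x.unop a))

lemma freeOpEquiv_single {a : Q} {x : Qᵒᵖ} (i : Unit) (p : Quiver.Path (Opposite.op a) x) :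
    freeOpEquiv a x (QRep.fsingle i p) = pathHom k (pathUnop p) := by
  change pathBasis k x.unop a (Finsupp.domLCongr (pathOpEquiv x.unop a).symm
    (freeUnitEquiv (Opposite.op a) x (QRep.fsingle i p))) = _
  rw [freeUnitEquiv_single]
  exact congrArg (pathBasis k x.unop a) (Finsupp.domLCongr_single _ _ _)

/-- The dual of an injective representation is free on one generator. -/
noncomputable def injEquiv (a : Q) (x : Qᵒᵖ) :
    (QRep.free k (fun _ : Unit => Opposite.op a)).V x ≃ₗ[k]
      (toRep _ (injAt_isLfdMod (vtx k Q a))).dual.V x :=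
  (freeOpEquiv a x).trans (Module.evalEquiv k (vtx k Q x.unop ⟶ vtx k Q a))

lemma injEquiv_single {a : Q} {x : Qᵒᵖ} (i : Unit) (p : Quiver.Path (Opposite.op a) x)
    (ξ : (toRep _ (injAt_isLfdMod (vtx k Q a))).V x.unop) :
    QRep.ev (injEquiv a x (QRep.fsingle i p)) ξ = injEv ξ (pathHom k (pathUnop p)) :=
  congrArg (injEv ξ) (freeOpEquiv_single i p)

lemma injAt_fcpc (a : Q) : QRep.FCPc (toRep _ (injAt_isLfdMod (vtx k Q a))) :=
  QRep.FPc.of_bij (QRep.freeHom_bij (a := fun _ : Unit => Opposite.op a)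
    (fun _ => injGen (k := k) a) (injEquiv a) fun _ i p => QRep.ev_ext fun ξ =>
      (injEquiv_single i p ξ).trans (injGen_pmap p ξ).symm) (QRep.free_fpc _)

end SLF
end Bridge

section Bridge

variable {L M N : PathCat k Q ⥤ ModuleCat.{0} k}

/-- The morphism from a projective module given by an element. -/
noncomputable def projMap (hM : IsMod k M) (a : PathCat k Q) (n : M.obj a) : ProjAt k a ⟶ M where
  app b := ModuleCat.ofHom ((hM.mapₗ a b).flip n)
  naturality b _ f := ModuleCat.hom_ext (LinearMap.ext fun (g : a ⟶ b) =>
    congrArg (fun h => ModuleCat.Hom.hom h n) (M.map_comp g f))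

/-- The morphism to an injective module given by a linear form. -/
noncomputable def injMap (hM : IsMod k M) (a : PathCat k Q) (ξ : Module.Dual k (M.obj a)) :
    M ⟶ InjAt k a where
  app b := ModuleCat.ofHom ((hM.mapₗ b a).flip.compr₂ ξ)
  naturality _ c f := ModuleCat.hom_ext (LinearMap.ext fun v => LinearMap.ext fun (g : c ⟶ a) =>
    (congrArg (fun h => ξ (ModuleCat.Hom.hom h v)) (M.map_comp f g)).symm)

lemma ses_kernel (hM : IsLfdMod k M) (hN : IsLfdMod k N) (f : M ⟶ N) [Epi f] :
    QRep.Hom.SES (toHom (hM.of_mono (kernel.ι f)) hM (kernel.ι f)) (toHom hM hN f) := by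
  refine ⟨fun x => app_injective _ _, fun x => app_surjective _ _, fun x v => ⟨fun hv => ?_, ?_⟩⟩
  · have hK := ofRep_isLfdMod (toHom hM hN f).ker.rep
    let i := ofHom hK hM ((toHom hM hN f).ker.incl.comp (ofToRep _))
    have hi : i ≫ f = 0 := nat_ext fun x w => (toHom hM hN f).ker.incl_mem w
    refine ⟨(toHom hK _ (kernel.lift f i hi)).app x
      ((toToRep _).app x ((toHom hM hN f).ker.elt v hv)), ?_⟩
    rw [← toHom_comp_app, kernel.lift_ι]
    rfl
  · rintro ⟨u, rfl⟩
    rw [← toHom_comp_app, kernel.condition]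
    rfl

lemma ses_cokernel (hM : IsLfdMod k M) (hN : IsLfdMod k N) (f : M ⟶ N) [Mono f] :
    QRep.Hom.SES (toHom hM hN f) (toHom hN (hN.of_epi (cokernel.π f)) (cokernel.π f)) := by
  refine ⟨fun x => app_injective _ _, fun x => app_surjective _ _, fun x v => ⟨fun hv => ?_, ?_⟩⟩
  · have hK := ofRep_isLfdMod (toHom hM hN f).range.quot
    let p := ofHom hN hK ((toToRep _).comp (toHom hM hN f).range.proj)
    have hp : f ≫ p = 0 := nat_ext fun x w => (QRep.Sub.proj_eq_zero_iff _).2 ⟨w, rfl⟩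
    refine (QRep.Sub.proj_eq_zero_iff (toHom hM hN f).range).1 ?_
    have h : (toHom hN hK p).app x v = 0 := by
      rw [← cokernel.π_desc f p hp, toHom_comp_app hN (hN.of_epi (cokernel.π f)), hv, map_zero]
    exact h
  · rintro ⟨u, rfl⟩
    rw [← toHom_comp_app, cokernel.condition]
    rfl

lemma biproduct_total_app {ι : Type} [Fintype ι] {T : ι → PathCat k Q ⥤ ModuleCat.{0} k}
    (hT : ∀ j, IsLfdMod k (T j)) (x : Q) (v : (toRep _ (IsLfdMod.biproduct hT)).V x) :
    ∑ j, (toHom (hT j) (IsLfdMod.biproduct hT) (biproduct.ι T j)).app x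
      ((toHom (IsLfdMod.biproduct hT) (hT j) (biproduct.π T j)).app x v) = v := by
  have := sum_app_hom Finset.univ (fun j => biproduct.π T j ≫ biproduct.ι T j) (vtx k Q x) v
  rw [biproduct.total] at this
  exact this.symm

section SLF

variable [SLF Q]

lemma QRep.FPc.exists_free_surj {X : QRep k Q} (h : QRep.FPc X) :
    ∃ (r : ℕ) (a : Fin r → Q) (n : ∀ i, X.V (a i)), (QRep.freeHom n).Surj := by
  obtain ⟨A, hA, hX, G, hG, hb⟩ := h
  obtain ⟨r, a, n, -, hn⟩ := QRep.exists_free_surj hG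
    (QRep.gen_top_of_surj hA hX fun y hy => (hb y hy).2)
  exact ⟨r, a, n, hn⟩

lemma QRep.freeHom_mem {X : QRep k Q} {ι : Type} [Finite ι] {a : ι → Q} (n : ∀ i, X.V (a i)) {x : Q}
    (S : Submodule k (X.V x)) (h : ∀ i (p : Quiver.Path (a i) x), X.pmap p (n i) ∈ S)
    (u : (QRep.free k a).V x) : (QRep.freeHom n).app x u ∈ S := by
  refine QRep.free_mem_of_single (S.comap ((QRep.freeHom n).app x)) (fun i p => ?_) u
  rw [Submodule.mem_comap, QRep.freeHom_single]
  exact h i p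

lemma QRep.ev_freeHom_eq_zero {X : QRep k Q} {ι : Type} [Finite ι] {a : ι → Qᵒᵖ}
    (n : ∀ i, X.dual.V (a i)) {x : Qᵒᵖ} (v : X.V x.unop)
    (h : ∀ i (p : Quiver.Path (a i) x), QRep.ev (X.dual.pmap p (n i)) v = 0)
    (u : (QRep.free k a).V x) : QRep.ev ((QRep.freeHom n).app x u) v = 0 :=
  QRep.freeHom_mem n (LinearMap.ker (Module.Dual.eval k (X.V x.unop) v)) h u

lemma QRep.FCPc.of_decomp {X : QRep k Q} {ι : Type} [Fintype ι] {T : ι → QRep k Q}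
    (i : ∀ j, QRep.Hom (T j) X) (p : ∀ j, QRep.Hom X (T j))
    (hip : ∀ x v, ∑ j, (i j).app x ((p j).app x v) = v) (h : ∀ j, QRep.FCPc (T j)) :
    QRep.FCPc X := by
  refine QRep.FPc.of_decomp (fun j => (p j).dual) (fun j => (i j).dual) (fun x ξ => ?_) h
  refine QRep.ev_ext fun v => ?_
  have h1 : ∀ s : Finset ι, QRep.ev (∑ j ∈ s, (p j).dual.app x ((i j).dual.app x ξ)) v =
      QRep.ev ξ (∑ j ∈ s, (i j).app x.unop ((p j).app x.unop v)) := by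
    classical
    intro s
    induction s using Finset.induction_on with
    | empty => exact (map_zero (show Module.Dual k (X.V x.unop) from ξ)).symm
    | insert j s hj ih =>
      rw [Finset.sum_insert hj, Finset.sum_insert hj, QRep.ev_add, ih]
      exact (map_add (show Module.Dual k (X.V x.unop) from ξ) _ _).symm
  rw [h1, hip]

lemma exists_epi_of_fpc (hM : IsLfdMod k M) (h : QRep.FPc (toRep M hM)) :
    ∃ (r : ℕ) (a : Fin r → PathCat k Q) (f : (⨁ fun i => ProjAt k (a i)) ⟶ M), Epi f := by
  obtain ⟨r, a, n, hn⟩ := h.exists_free_surj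
  refine ⟨r, fun i => vtx k Q (a i), biproduct.desc fun i => projMap hM.1 _ (n i), ?_⟩
  rw [NatTrans.epi_iff_epi_app]
  intro b
  rw [ModuleCat.epi_iff_surjective]
  intro v
  obtain ⟨u, hu⟩ := hn (unvtx b) v
  let S : Submodule k ((toRep M hM).V (unvtx b)) :=
    LinearMap.range ((biproduct.desc fun i => projMap hM.1 _ (n i)).app b).hom
  have hS : ∀ u, (QRep.freeHom n).app (unvtx b) u ∈ S := by
    refine @QRep.freeHom_mem k _ Q _ _ (toRep M hM) (Fin r) _ a n (unvtx b) S fun i p => ?_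
    refine ⟨((biproduct.ι (fun i => ProjAt k (vtx k Q (a i))) i).app (vtx k Q (unvtx b))).hom
      (pathHom (Q := Q) k p), ?_⟩
    have h1 := congrArg (fun φ : ProjAt k (vtx k Q (a i)) ⟶ M =>
      (φ.app (vtx k Q (unvtx b))).hom (pathHom (Q := Q) k p))
      (biproduct.ι_desc (fun i => projMap hM.1 (vtx k Q (a i)) (n i)) i)
    exact h1.trans (toRep_pmap hM p (n i)).symm
  have hv := hS u
  rw [hu] at hv
  exact hv

lemma exists_mono_of_fcpc (hM : IsLfdMod k M) (h : QRep.FCPc (toRep M hM)) :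
    ∃ (r : ℕ) (a : Fin r → PathCat k Q) (f : M ⟶ ⨁ fun i => InjAt k (a i)), Mono f := by
  obtain ⟨r, a, n, hn⟩ := QRep.FPc.exists_free_surj h
  refine ⟨r, fun i => vtx k Q (a i).unop, biproduct.lift fun i => injMap hM.1 _ (n i), ?_⟩
  rw [NatTrans.mono_iff_mono_app]
  intro b
  rw [ModuleCat.mono_iff_injective]
  refine (injective_iff_map_eq_zero ((biproduct.lift fun i => injMap hM.1 _ (n i)).app b).hom).2
    fun v hv => ?_
  have h1 : ∀ i (g : b ⟶ vtx k Q (a i).unop),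
      (show Module.Dual k (M.obj (vtx k Q (a i).unop)) from n i) ((M.map g).hom v) = 0 := by
    intro i g
    have h2 := congrArg (fun φ : M ⟶ InjAt k (vtx k Q (a i).unop) =>
      (φ.app b).hom v) (biproduct.lift_π (fun i => injMap hM.1 (vtx k Q (a i).unop) (n i)) i)
    have h3 : ((injMap hM.1 (vtx k Q (a i).unop) (n i)).app b).hom v = 0 := by
      refine h2.symm.trans ?_
      refine (congrArg
        (((biproduct.π (fun i => InjAt k (vtx k Q (a i).unop)) i).app b).hom) hv).trans
        (map_zero _)
    exact LinearMap.congr_fun (f := (show Module.Dual k (b ⟶ vtx k Q (a i).unop) from _)) h3 g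
  refine QRep.ev_sep (M := toRep M hM) (x := Opposite.op (unvtx b)) fun ξ => ?_
  obtain ⟨u, rfl⟩ := hn _ ξ
  refine (QRep.ev_freeHom_eq_zero (X := toRep M hM) n v (fun i p => ?_) u).trans
    (QRep.ev_zero_right _).symm
  exact ((ev_pmap _ _ _).trans (congrArg (QRep.ev (n i)) (toRep_pmap hM _ _))).trans (h1 i _)

lemma isFP_of_fpc (hM : IsLfdMod k M) (h : QRep.FPc (toRep M hM)) : IsFP k M := by
  obtain ⟨r, a, f, hf⟩ := exists_epi_of_fpc hM h
  have hT := fun i => projAt_isLfdMod (a i)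
  have hP : QRep.FPc (toRep _ (IsLfdMod.biproduct hT)) :=
    QRep.FPc.of_decomp _ _ (biproduct_total_app hT) fun i => projAt_fpc (unvtx (a i))
  exact ⟨r, a, f, hf, exists_epi_of_fpc _ (QRep.FPc.left (ses_kernel (IsLfdMod.biproduct hT) hM f)
    hP h)⟩

lemma isFCP_of_fcpc (hM : IsLfdMod k M) (h : QRep.FCPc (toRep M hM)) : IsFCP k M := by
  obtain ⟨r, a, f, hf⟩ := exists_mono_of_fcpc hM h
  have hT := fun i => injAt_isLfdMod (a i)
  have hP : QRep.FCPc (toRep _ (IsLfdMod.biproduct hT)) :=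
    QRep.FCPc.of_decomp _ _ (biproduct_total_app hT) fun i => injAt_fcpc (unvtx (a i))
  exact ⟨r, a, f, hf, exists_mono_of_fcpc _ (QRep.FPc.left
    (ses_cokernel hM (IsLfdMod.biproduct hT) f).dual hP h)⟩

end SLF
end Bridge

namespace QRep

variable {L M N : QRep k Q}

lemma Hom.bij_of_inverse {f : Hom L M} (g : Hom M L) (h₁ : ∀ x v, g.app x (f.app x v) = v)
    (h₂ : ∀ x v, f.app x (g.app x v) = v) : f.Bij := fun x =>
  ⟨fun a b h => by rw [← h₁ x a, h, h₁], fun v => ⟨_, h₂ x v⟩⟩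

lemma Hom.Irr.coprod_swap {f : Hom L M} {g : Hom N M} (h : (f.coprod g).Irr) :
    (g.coprod f).Irr := by
  have he : ((Hom.snd N L).prod (Hom.fst N L)).Bij :=
    bij_of_inverse ((Hom.snd L N).prod (Hom.fst L N))
      (fun x v => by simp only [prod_app, fst_pair, snd_pair, pair_eta])
      (fun x v => by simp only [prod_app, fst_pair, snd_pair, pair_eta])
  have hgf : (f.coprod g).comp ((Hom.snd N L).prod (Hom.fst N L)) = g.coprod f :=
    Hom.ext' fun x v => by rw [comp_app, prod_app, coprod_pair, coprod_app, add_comm]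
  exact hgf ▸ h.comp_bij he

end QRep

section Bridge

variable {L M N : PathCat k Q ⥤ ModuleCat.{0} k}

lemma nonempty_iso_of_bij (hM : IsLfdMod k M) (hN : IsLfdMod k N)
    {f : QRep.Hom (toRep M hM) (toRep N hN)} (hf : f.Bij) : Nonempty (M ≅ N) := by
  obtain ⟨g, h₁, h₂⟩ := hf.exists_inv
  exact ⟨⟨ofHom hM hN f, ofHom hN hM g, nat_ext h₁, nat_ext h₂⟩⟩

lemma toHom_total (hL : IsLfdMod k L) (x : Q) (v : (toRep _ hL.biprod).V x) :
    (toHom hL hL.biprod biprod.inl).app x ((toHom hL.biprod hL biprod.fst).app x v) +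
      (toHom hL hL.biprod biprod.inr).app x ((toHom hL.biprod hL biprod.snd).app x v) = v :=
  congrArg (fun f : L ⊞ L ⟶ L ⊞ L => (toHom hL.biprod hL.biprod f).app x v) biprod.total

lemma Irred.irr_coprod (hL : IsLfdMod k L) (hM : IsLfdMod k M) {f : L ⊞ L ⟶ M} (h : Irred k f) :
    ((toHom hL hM (biprod.inl ≫ f)).coprod (toHom hL hM (biprod.inr ≫ f))).Irr := by
  have hLL := hL.biprod
  have he : ((toHom hL hLL biprod.inl).coprod (toHom hL hLL biprod.inr)).Bij := by
    refine QRep.Hom.bij_of_inverse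
      ((toHom hLL hL biprod.fst).prod (toHom hLL hL biprod.snd)) (fun x v => ?_) fun x v => ?_
    · rw [QRep.Hom.prod_app, QRep.Hom.coprod_app, map_add, map_add, ← toHom_comp_app,
        ← toHom_comp_app, ← toHom_comp_app, ← toHom_comp_app, biprod.inl_fst, biprod.inr_fst,
        biprod.inl_snd, biprod.inr_snd]
      refine Eq.trans ?_ (QRep.pair_eta v)
      exact congrArg₂ QRep.pair (add_zero _) (zero_add _)
    · exact toHom_total hL x v
  have hf : (toHom hLL hM f).comp ((toHom hL hLL biprod.inl).coprod (toHom hL hLL biprod.inr)) =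
      (toHom hL hM (biprod.inl ≫ f)).coprod (toHom hL hM (biprod.inr ≫ f)) :=
    QRep.Hom.ext' fun x v => by
      rw [QRep.Hom.comp_app, QRep.Hom.coprod_app, QRep.Hom.coprod_app, map_add]
      rfl
  exact hf ▸ (h.irr hLL hM).comp_bij he

end Bridge

end Helpers

variable (k : Type) [Field k] [IsAlgClosed k]
variable (Q : Type) [Quiver.{0} Q]

/-- Let `M` be indecomposable in `rep(Q)`, neither finitely presented nor finitely
co-presented. Then any two indecomposables admitting an irreducible morphism to `M` are
isomorphic, and there is no irreducible morphism `L ⊕ L ⟶ M` with `L` indecomposable. -/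
theorem statement_14 (hQ : StronglyLocallyFinite Q)
    (M : PathCat k Q ⥤ ModuleCat.{0} k) (hM : IsLfdMod k M) (hind : Indec k M)
    (hnfp : ¬ IsFP k M) (hnfcp : ¬ IsFCP k M) :
    (∀ L₁ L₂ : PathCat k Q ⥤ ModuleCat.{0} k,
        IsLfdMod k L₁ → Indec k L₁ → IsLfdMod k L₂ → Indec k L₂ →
        (∃ f₁ : L₁ ⟶ M, Irred k f₁) → (∃ f₂ : L₂ ⟶ M, Irred k f₂) →
        Nonempty (L₁ ≅ L₂)) ∧
      (∀ L : PathCat k Q ⥤ ModuleCat.{0} k, IsLfdMod k L → Indec k L →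
        ¬ ∃ f : L ⊞ L ⟶ M, Irred k f) := by
  have : SLF Q := ⟨fun x => (hQ.1 x).1, fun x => (hQ.1 x).2, hQ.2⟩
  have h₁ : ¬ QRep.FPc (toRep M hM) := fun h => hnfp (isFP_of_fpc hM h)
  have h₂ : ¬ QRep.FCPc (toRep M hM) := fun h => hnfcp (isFCP_of_fcpc hM h)
  have hMi := hind.indecomp hM
  refine ⟨fun L₁ L₂ hL₁ hi₁ hL₂ hi₂ ⟨f₁, hf₁⟩ ⟨f₂, hf₂⟩ => ?_, fun L hL hi ⟨f, hf⟩ => ?_⟩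
  · have hi₁ := hi₁.indecomp hL₁
    have hi₂ := hi₂.indecomp hL₂
    have hf₁ := hf₁.irr hL₁ hM
    have hf₂ := hf₂.irr hL₂ hM
    by_contra hne
    have hbij : ∀ a : QRep.Hom (toRep L₂ hL₂) (toRep L₁ hL₁), ¬ a.Bij := fun a ha =>
      hne ((nonempty_iso_of_bij hL₂ hL₁ ha).map Iso.symm)
    exact hf₁.false_of_coprod hi₁ hi₂ hMi hf₂ (hi₁.irr_coprod hi₂ hMi hbij hf₁ hf₂) h₁ h₂
  · have hi := hi.indecomp hL
    have hc := hf.irr_coprod hL hM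
    exact (hi.irr_of_coprod hMi hc).false_of_coprod hi hi hMi
      (hi.irr_of_coprod hMi hc.coprod_swap) hc h₁ h₂

end Paper
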